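/- For every constant ε > 0 there exist a constant c_ε > 0 and a family {M_n^ε} of DAGs such that each M_n^ε has n inputs and n outputs, at most c_ε·n nodes, maximum indegree at most c_ε, and is maximally ST-robust with depth d = n^{1−ε}. -/

import Mathlib

/-! ## Basic digraph notions -/

/-- A directed path in a digraph `Adj`: a nonempty list of vertices, each
consecutive pair joined by a directed edge.  Its length (number of edges)
is `p.length - 1`, so a path "of length d" is a list with `p.length = d + 1`. -/
def PathIn {V : Type*} (Adj : V → V → Prop) (p : List V) : Prop :=
  p ≠ [] ∧ p.Chain' Adj

/-- A digraph is acyclic (is a DAG) if it has no directed cycle. -/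
def Acyclic {V : Type*} (Adj : V → V → Prop) : Prop :=
  ∀ v, ¬ Relation.TransGen Adj v v

/-- In-degree of a vertex. -/
noncomputable def indeg {V : Type*} (Adj : V → V → Prop) (v : V) : ℕ :=
  Nat.card {u // Adj u v}

/-- Out-degree of a vertex. -/
noncomputable def outdeg {V : Type*} (Adj : V → V → Prop) (v : V) : ℕ :=
  Nat.card {w // Adj v w}

/-- `δ(v) = max(indeg(v), outdeg(v))`. -/
noncomputable def delta {V : Type*} (Adj : V → V → Prop) (v : V) : ℕ :=
  max (indeg Adj v) (outdeg Adj v)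

/-- The number of edges of a digraph. -/
noncomputable def numEdges {V : Type*} (Adj : V → V → Prop) : ℕ :=
  Nat.card {e : V × V // Adj e.1 e.2}

/-- `(e,d)`-depth-robustness: for every set `S` of at most `e` vertices,
the graph minus `S` contains a directed path of length `d` (i.e. `d` edges). -/
def DepthRobust {V : Type*} (Adj : V → V → Prop) (e d : ℕ) : Prop :=
  ∀ S : Finset V, S.card ≤ e →
    ∃ p : List V, PathIn Adj p ∧ (∀ v ∈ p, v ∉ S) ∧ p.length = d + 1

/-- `(e,d)`-edge-depth-robustness: for every set `F` of at most `e` edges,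
the graph minus `F` contains a directed path of length `d`. -/
def EdgeDepthRobust {V : Type*} (Adj : V → V → Prop) (e d : ℕ) : Prop :=
  ∀ F : Finset (V × V), (∀ f ∈ F, Adj f.1 f.2) → F.card ≤ e →
    ∃ p : List V, PathIn (fun u w => Adj u w ∧ (u, w) ∉ F) p ∧ p.length = d + 1

/-- `u` is joined to `v` by a directed path all of whose vertices avoid `S`. -/
def ConnAvoiding {V : Type*} (Adj : V → V → Prop) (S : Finset V) (u v : V) : Prop :=
  ∃ p : List V, PathIn Adj p ∧ (∀ x ∈ p, x ∉ S) ∧ p.head? = some u ∧ p.getLast? = some v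

/-- `u` is joined to `v` by a directed path of length at least `d` avoiding `S`. -/
def ConnAvoidingLen {V : Type*} (Adj : V → V → Prop) (S : Finset V) (d : ℕ) (u v : V) : Prop :=
  ∃ p : List V, PathIn Adj p ∧ (∀ x ∈ p, x ∉ S) ∧ p.head? = some u ∧
    p.getLast? = some v ∧ d + 1 ≤ p.length

/-! ## Digraphs with designated inputs and outputs -/

/-- A finite digraph with `n` designated (distinct) inputs and `n` designated
(distinct) outputs. -/
structure IOGraph (n : ℕ) where
  V : Type
  [fin : Fintype V]
  [dec : DecidableEq V]
  Adj : V → V → Prop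
  inp : Fin n ↪ V
  out : Fin n ↪ V

attribute [instance] IOGraph.fin IOGraph.dec

/-- `(k1,k2)`-ST-robustness: after deleting any set `D` of at most `k1` vertices
there remain at least `k2` inputs and `k2` outputs such that every one of these
inputs is connected to every one of these outputs in `G - D`. -/
def STRobust {n : ℕ} (G : IOGraph n) (k1 k2 : ℕ) : Prop :=
  ∀ D : Finset G.V, D.card ≤ k1 →
    ∃ A B : Finset (Fin n), k2 ≤ A.card ∧ k2 ≤ B.card ∧
      ∀ a ∈ A, ∀ b ∈ B, ConnAvoiding G.Adj D (G.inp a) (G.out b)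

/-- `(k1,k2,d)`-ST-robustness: as `STRobust`, with all the connecting paths of
length at least `d`. -/
def STRobustD {n : ℕ} (G : IOGraph n) (k1 k2 d : ℕ) : Prop :=
  ∀ D : Finset G.V, D.card ≤ k1 →
    ∃ A B : Finset (Fin n), k2 ≤ A.card ∧ k2 ≤ B.card ∧
      ∀ a ∈ A, ∀ b ∈ B, ConnAvoidingLen G.Adj D d (G.inp a) (G.out b)

/-- Maximally ST-robust: `(k, n-k)`-ST-robust for all `0 ≤ k ≤ n`. -/
def MaxSTRobust {n : ℕ} (G : IOGraph n) : Prop := ∀ k ≤ n, STRobust G k (n - k)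

/-- Maximally ST-robust with depth `d`: `(k, n-k, d)`-ST-robust for all `0 ≤ k ≤ n`. -/
def MaxSTRobustD {n : ℕ} (G : IOGraph n) (d : ℕ) : Prop := ∀ k ≤ n, STRobustD G k (n - k) d

/-- An `n`-superconcentrator: for every `1 ≤ r ≤ n` and every `r` inputs and `r`
outputs there are `r` vertex-disjoint directed paths connecting the chosen inputs
to the chosen outputs. -/
def Superconcentrator {n : ℕ} (G : IOGraph n) : Prop :=
  ∀ r, 1 ≤ r → r ≤ n → ∀ X Y : Finset (Fin n), X.card = r → Y.card = r →
    ∃ P : Fin r → List G.V,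
      (∀ i, PathIn G.Adj (P i) ∧ (∃ x ∈ X, (P i).head? = some (G.inp x)) ∧
        ∃ y ∈ Y, (P i).getLast? = some (G.out y)) ∧
      ∀ i j, i ≠ j → ∀ v ∈ P i, v ∉ P j

/-- An `n`-connector: an `n`-superconcentrator such that moreover, for every
`1 ≤ r ≤ n`, every sequence of `r` distinct inputs and every sequence of `r`
distinct outputs, there are `r` vertex-disjoint directed paths where the `i`-th
path goes from the `i`-th chosen input to the `i`-th chosen output. -/
def Connector {n : ℕ} (G : IOGraph n) : Prop :=
  Superconcentrator G ∧
  ∀ r, 1 ≤ r → r ≤ n → ∀ x y : Fin r ↪ Fin n,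
    ∃ P : Fin r → List G.V,
      (∀ i, PathIn G.Adj (P i) ∧ (P i).head? = some (G.inp (x i)) ∧
        (P i).getLast? = some (G.out (y i))) ∧
      ∀ i j, i ≠ j → ∀ v ∈ P i, v ∉ P j

/-- A bundled finite digraph. -/
structure Dig where
  V : Type
  [fin : Fintype V]
  [dec : DecidableEq V]
  Adj : V → V → Prop

attribute [instance] Dig.fin Dig.dec

/-- `(s,t,ε)`-hardness of a graph together with a challenge set `VC`: for every
set `S` of at most `s` vertices, at least a `(1-ε)` fraction of the nodes of `VC`
have depth at least `t` in `G - S` (i.e. are the endpoint of a directed path of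
length `≥ t` in `G - S`). -/
def Hard {T : Type*} (Adj : T → T → Prop) (VC : Finset T) (s t : ℕ) (ε : ℝ) : Prop :=
  ∀ S : Finset T, S.card ≤ s →
    (1 - ε) * (VC.card : ℝ) ≤
      (Set.ncard {v | v ∈ VC ∧ ∃ p : List T, PathIn Adj p ∧ (∀ x ∈ p, x ∉ S) ∧
        p.getLast? = some v ∧ t + 1 ≤ p.length} : ℝ)

section
open Finset Classical

/-- counting: functions restricted to lie in given sets on a given part -/
theorem cnt_restrict {α β : Type} [Fintype α] [Fintype β] (D : ℕ) (c : ℝ) 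
    (Y : Finset α) (P : α → Finset (Fin D → β)) (hP : ∀ y ∈ Y, ((P y).card : ℝ) ≤ c * (Fintype.card β : ℝ) ^ D) :
    (#{f : α → Fin D → β | ∀ y ∈ Y, f y ∈ P y} : ℝ) ≤ c ^ (#Y) * (Fintype.card (α → Fin D → β) : ℝ) := by
  have h1 : ({f : α → Fin D → β | ∀ y ∈ Y, f y ∈ P y} : Finset _) =
      Fintype.piFinset (fun y => if y ∈ Y then P y else univ) := by
    ext f
    simp only [mem_filter, mem_univ, true_and, Fintype.mem_piFinset]
    refine forall_congr' fun y => ?_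
    by_cases hy : y ∈ Y <;> simp [hy]
  rw [h1, Fintype.card_piFinset]
  push_cast
  have h2 : (Fintype.card (α → Fin D → β) : ℝ) = ∏ _y : α, (Fintype.card β : ℝ) ^ D := by
    simp
  have h3 : c ^ (#Y) = ∏ y : α, (if y ∈ Y then c else 1) := by
    rw [Finset.prod_ite_mem]; simp
  rw [h2, h3, ← Finset.prod_mul_distrib]
  apply Finset.prod_le_prod
  · intros; positivity
  · intro y _
    by_cases hy : y ∈ Y
    · simpa [hy] using hP y hy
    · simp [hy]

theorem exists_D_pow (c τ : ℝ) (hc : 0 < c) (hc1 : c ≤ 1) (hτ : 0 < τ) (A : ℕ) :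
    ∃ D : ℕ, 1 ≤ D ∧ ∀ (a T : ℕ), 1 ≤ a → τ * a ≤ T → (2:ℝ) ^ (A * a) * ((1 - c) ^ D) ^ T < 1 / 2 := by
  obtain ⟨D, hD⟩ := exists_nat_ge ((A + 2) / (c * τ))
  refine ⟨D + 1, by omega, fun a T ha hT => ?_⟩
  have e1 : (1 - c) ≤ Real.exp (-c) := by
    have := Real.add_one_le_exp (-c); linarith
  have e2 : ((1 - c) ^ (D+1)) ^ T ≤ Real.exp (-c * (((D+1 : ℕ) : ℝ) * T)) := by
    rw [← pow_mul]
    calc (1 - c) ^ ((D+1) * T) ≤ Real.exp (-c) ^ ((D+1) * T) := by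
          apply pow_le_pow_left₀ (by linarith) e1
      _ = _ := by rw [← Real.exp_nat_mul]; congr 1; push_cast; ring
  have e3 : (2:ℝ) ^ (A * a) ≤ Real.exp (A * a) := by
    have : (2:ℝ) ≤ Real.exp 1 := by have := Real.add_one_le_exp (1:ℝ); linarith
    calc (2:ℝ) ^ (A * a) ≤ Real.exp 1 ^ (A * a) := pow_le_pow_left₀ (by norm_num) this _
      _ = _ := by rw [← Real.exp_nat_mul]; congr 1; push_cast; ring
  have ha' : (1:ℝ) ≤ a := by exact_mod_cast ha
  have e4 : (A + 2 : ℝ) * a ≤ c * (((D+1 : ℕ) : ℝ) * T) := by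
    rw [div_le_iff₀ (by positivity)] at hD
    push_cast
    calc (A + 2 : ℝ) * a ≤ (D * (c * τ)) * a := by gcongr
      _ = c * (D * (τ * a)) := by ring
      _ ≤ c * (D * T) := by gcongr
      _ ≤ c * ((D + 1) * T) := by gcongr; linarith
  calc (2:ℝ) ^ (A * a) * ((1 - c) ^ (D+1)) ^ T ≤ Real.exp (A * a) * Real.exp (-c * (((D+1 : ℕ) : ℝ) * T)) := by
        gcongr
    _ = Real.exp (A * a + -c * (((D+1 : ℕ) : ℝ) * T)) := by rw [Real.exp_add]
    _ ≤ Real.exp (-2) := by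
        apply Real.exp_le_exp.2
        nlinarith
    _ < 1/2 := by
        rw [Real.exp_neg, inv_lt_comm₀ (Real.exp_pos _) (by norm_num)]
        have := Real.add_one_le_exp (2:ℝ); norm_num; linarith

/-- generic hitting lemma, counting form -/
theorem lemG_count (c τ : ℝ) (hc : 0 < c) (hc1 : c ≤ 1) (hτ : 0 < τ) (A : ℕ) :
    ∃ D : ℕ, 1 ≤ D ∧ ∀ (α β 𝒞 : Type) [Fintype α] [Fintype β] [Fintype 𝒞] [Nonempty α] [Nonempty β]
      (F : 𝒞 → α → Finset β), (Fintype.card 𝒞 : ℝ) ≤ 2 ^ (A * Fintype.card α) →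
      (∀ κ y, c * Fintype.card β ≤ #(F κ y)) →
      (#{f : α → Fin D → β | ∃ κ, τ * Fintype.card α < #{y | ∀ d, f y d ∉ F κ y}} : ℝ) < 1 / 2 * Fintype.card (α → Fin D → β) := by
  obtain ⟨D, hD1, hD⟩ := exists_D_pow c τ hc hc1 hτ (A + 1)
  refine ⟨D, hD1, ?_⟩
  intro α β 𝒞 _ _ _ _ _ F hC hF
  set T := ⌊τ * Fintype.card α⌋₊ + 1 with hT
  have hTr : τ * Fintype.card α ≤ T := by
    rw [hT]; push_cast; exact (Nat.lt_floor_add_one _).le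
  set total : ℝ := (Fintype.card (α → Fin D → β) : ℝ) with htot
  have htpos : 0 < total := by rw [htot]; exact_mod_cast Fintype.card_pos
  have hsub : ({f : α → Fin D → β | ∃ κ, τ * Fintype.card α < #{y | ∀ d, f y d ∉ F κ y}} : Finset _) ⊆
      (univ : Finset (𝒞 × {Y : Finset α // #Y = T})).biUnion
        (fun p => {f | ∀ y ∈ p.2.1, f y ∈ Fintype.piFinset (fun _ => (F p.1 y)ᶜ)}) := by
    intro f hf
    simp only [mem_filter, mem_univ, true_and, mem_biUnion] at hf ⊢
    obtain ⟨κ, hκ⟩ := hf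
    have : T ≤ #{y | ∀ d, f y d ∉ F κ y} := by
      rw [hT]; apply Nat.succ_le_of_lt
      rw [Nat.floor_lt (by positivity)]; exact hκ
    obtain ⟨Y, hY, hYc⟩ := Finset.exists_subset_card_eq this
    refine ⟨⟨κ, Y, hYc⟩, fun y hy => ?_⟩
    have := hY hy
    simpa using this
  have hle := Finset.card_le_card hsub
  have hle2 := hle.trans Finset.card_biUnion_le
  have hle3 : (#({f : α → Fin D → β | ∃ κ, τ * Fintype.card α < #{y | ∀ d, f y d ∉ F κ y}} : Finset _) : ℝ) ≤
      ∑ p : (𝒞 × {Y : Finset α // #Y = T}), ((1 - c) ^ D) ^ T * total := by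
    refine (Nat.cast_le (α := ℝ).2 hle2).trans ?_
    push_cast
    apply Finset.sum_le_sum
    intro p _
    have := cnt_restrict D ((1 - c) ^ D) p.2.1 (fun y => Fintype.piFinset (fun _ => (F p.1 y)ᶜ)) ?_
    · rw [p.2.2] at this; exact this
    · intro y _
      rw [Fintype.card_piFinset]
      simp only [prod_const, card_univ, Fintype.card_fin]
      push_cast
      rw [← mul_pow]
      apply pow_le_pow_left₀ (by positivity)
      rw [card_compl, Nat.cast_sub (Finset.card_le_univ _)]
      have := hF p.1 y
      linarith
  refine lt_of_le_of_lt hle3 ?_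
  rw [Finset.sum_const, nsmul_eq_mul, ← mul_assoc]
  apply mul_lt_mul_of_pos_right _ htpos
  have hY : Fintype.card {Y : Finset α // #Y = T} ≤ 2 ^ Fintype.card α := by
    refine (Fintype.card_subtype_le _).trans ?_
    simp
  have hcard : ((#(univ : Finset (𝒞 × {Y : Finset α // #Y = T})) : ℕ) : ℝ) ≤ 2 ^ ((A + 1) * Fintype.card α) := by
    rw [card_univ, Fintype.card_prod]
    push_cast
    rw [add_mul, one_mul, pow_add]
    have : (Fintype.card {Y : Finset α // #Y = T} : ℝ) ≤ 2 ^ Fintype.card α := by exact_mod_cast hY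
    gcongr
  refine lt_of_le_of_lt ?_ (hD (Fintype.card α) T Fintype.card_pos hTr)
  gcongr

theorem lemG (c τ : ℝ) (hc : 0 < c) (hc1 : c ≤ 1) (hτ : 0 < τ) (A : ℕ) :
    ∃ D : ℕ, 1 ≤ D ∧ ∀ (α β 𝒞 : Type) [Fintype α] [Fintype β] [Fintype 𝒞] [Nonempty α] [Nonempty β]
      (F : 𝒞 → α → Finset β), (Fintype.card 𝒞 : ℝ) ≤ 2 ^ (A * Fintype.card α) →
      (∀ κ y, c * Fintype.card β ≤ #(F κ y)) →
      ∃ f : α → Fin D → β, ∀ κ, (#{y | ∀ d, f y d ∉ F κ y} : ℝ) ≤ τ * Fintype.card α := by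
  obtain ⟨D, hD1, hD⟩ := lemG_count c τ hc hc1 hτ A
  refine ⟨D, hD1, fun α β 𝒞 _ _ _ _ _ F hC hF => ?_⟩
  by_contra! hcon
  have := hD α β 𝒞 F hC hF
  rw [Finset.filter_true_of_mem (fun f _ => hcon f), card_univ] at this
  have : (0:ℝ) ≤ Fintype.card (α → Fin D → β) := by positivity
  linarith
end

section
open Finset Classical

theorem choose_le_exp (m z : ℕ) (hz : 1 ≤ z) : ((m.choose z : ℕ) : ℝ) ≤ (Real.exp 1 * m / z) ^ z := by
  have h1 : ((m.choose z : ℕ) : ℝ) ≤ (m:ℝ) ^ z / (z.factorial : ℝ) := by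
    have := Nat.choose_le_pow_div (α := ℝ) z m; simpa using this
  have h2 := Real.pow_div_factorial_le_exp (z:ℝ) (by positivity) z
  have hz' : (0:ℝ) < z := by exact_mod_cast hz
  refine h1.trans ?_
  rw [div_pow, mul_pow, ← Real.exp_nat_mul, mul_one]
  have hf : (0:ℝ) < z.factorial := by exact_mod_cast z.factorial_pos
  rw [div_le_iff₀ hf] at h2 ⊢
  rw [div_mul_eq_mul_div, le_div_iff₀ (by positivity)]
  have : 0 ≤ (m:ℝ) ^ z := by positivity
  nlinarith

theorem choose_mono_half (m x z : ℕ) (hxz : x ≤ z) (hz : z ≤ m) : (2 * m).choose x ≤ (2 * m).choose z := by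
  induction z, hxz using Nat.le_induction with
  | base => exact le_rfl
  | succ z _ ih =>
    refine (ih (by omega)).trans ?_
    apply Nat.choose_le_succ_of_lt_half_left; omega

theorem S_term (b a z x q D : ℕ) (hD : 1 ≤ D) (hz : 1 ≤ z) (hzb : 16 * (D:ℝ)^2 * z ≤ b) (ha : a ≤ 2 * b)
    (hx : x ≤ z) (hq : z ≤ q * x) :
    ((b.choose z : ℕ) : ℝ) * ((a.choose x : ℕ) : ℝ) * ((D * z / b : ℝ)) ^ ((4 * q) * x) ≤ (1/8:ℝ) ^ z := by
  have hD' : (1:ℝ) ≤ D := by exact_mod_cast hD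
  have hz' : (1:ℝ) ≤ z := by exact_mod_cast hz
  have hDD : (D:ℝ) ≤ D^2 := by nlinarith
  have hzb2 : (D:ℝ) * z ≤ b := by nlinarith
  have hzb3 : (z:ℝ) ≤ b := by nlinarith
  have hb : (0:ℝ) < b := by linarith
  have hzb4 : z ≤ b := by exact_mod_cast hzb3
  have h1 := choose_le_exp b z hz
  have h2 : ((a.choose x : ℕ) : ℝ) ≤ (Real.exp 1 * (2 * b) / z) ^ z := by
    have e1 : a.choose x ≤ (2 * b).choose z := (Nat.choose_le_choose x ha).trans (choose_mono_half b x z hx hzb4)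
    have e2 := choose_le_exp (2 * b) z hz
    push_cast at e2
    exact (Nat.cast_le.2 e1).trans e2
  have h3 : ((D * z / b : ℝ)) ^ ((4 * q) * x) ≤ (D * z / b : ℝ) ^ (4 * z) := by
    apply pow_le_pow_of_le_one (by positivity)
    · rw [div_le_one hb]; exact hzb2
    · rw [mul_assoc]; exact Nat.mul_le_mul_left 4 hq
  calc _ ≤ (Real.exp 1 * b / z) ^ z * (Real.exp 1 * (2 * b) / z) ^ z * (D * z / b : ℝ) ^ (4 * z) := by gcongr
    _ = (2 * (Real.exp 1 * (D^2 * z / b))^2) ^ z := by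
      rw [pow_mul, ← mul_pow, ← mul_pow]; congr 1; field_simp
    _ ≤ (1/8) ^ z := by
      apply pow_le_pow_left₀ (by positivity)
      have he : Real.exp 1 ≤ 4 := by have := Real.exp_one_lt_d9; linarith
      have h4 : (D:ℝ)^2 * z / b ≤ 1/16 := by rw [div_le_iff₀ hb]; linarith
      have h5 : Real.exp 1 * (D^2 * z / b) ≤ 4 * (1/16) := by gcongr
      have h6 : 0 ≤ Real.exp 1 * (D^2 * z / b) := by positivity
      nlinarith

theorem cnt_exists {β : Type} [Fintype β] [Nonempty β] (D : ℕ) (hD : 1 ≤ D) (Z : Finset β) :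
    (#{h : Fin D → β | ∃ d, h d ∈ Z} : ℝ) ≤ (D * #Z / Fintype.card β : ℝ) * (Fintype.card β : ℝ) ^ D := by
  have hb : (0:ℝ) < Fintype.card β := by exact_mod_cast Fintype.card_pos
  have hsub : ({h : Fin D → β | ∃ d, h d ∈ Z} : Finset _) ⊆
      univ.biUnion (fun d : Fin D => Fintype.piFinset (fun d' => if d' = d then Z else univ)) := by
    intro h hh
    simp only [mem_filter, mem_univ, true_and, mem_biUnion, Fintype.mem_piFinset] at hh ⊢
    obtain ⟨d, hd⟩ := hh
    refine ⟨d, fun d' => ?_⟩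
    by_cases e : d' = d
    · subst e; simpa using hd
    · simp [e]
  have hle := (Finset.card_le_card hsub).trans Finset.card_biUnion_le
  have hone : ∀ d : Fin D, #(Fintype.piFinset (fun d' : Fin D => if d' = d then Z else (univ : Finset β))) =
      #Z * Fintype.card β ^ (D - 1) := by
    intro d
    rw [Fintype.card_piFinset]
    rw [← Finset.mul_prod_erase univ _ (mem_univ d)]
    simp only [if_true]
    congr 1
    rw [Finset.prod_congr rfl (g := fun _ => Fintype.card β)]
    · simp
    · intro x hx
      rw [if_neg (Finset.ne_of_mem_erase hx), card_univ]
  simp only [hone, sum_const, card_univ, Fintype.card_fin, smul_eq_mul] at hle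
  refine (Nat.cast_le (α := ℝ).2 hle).trans ?_
  push_cast
  obtain ⟨D', rfl⟩ : ∃ D', D = D' + 1 := ⟨D - 1, by omega⟩
  simp only [Nat.add_sub_cancel]
  rw [pow_succ]
  apply le_of_eq
  field_simp

theorem sum_geo (b : ℕ) : ∑ z ∈ Icc 1 b, (1/8:ℝ) ^ z < 1/2 := by
  have : ∀ b : ℕ, ∑ z ∈ Icc 1 b, (1/8:ℝ) ^ z = (1 - (1/8)^b) / 7 := by
    intro b
    induction b with
    | zero => simp
    | succ b ih => rw [Finset.sum_Icc_succ_top (by omega), ih, pow_succ]; ring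
  rw [this]
  have : (0:ℝ) < (1/8)^b := by positivity
  linarith

/-- small-set expansion, counting form -/
theorem lemS_count (q D : ℕ) (hq : 2 ≤ q) (hD : 1 ≤ D) (α β : Type) [Fintype α] [Fintype β] [Nonempty β]
    (hab : Fintype.card α ≤ 2 * Fintype.card β) :
    (#{f : α × Fin (4 * q) → Fin D → β | ∃ Z : Finset β, 16 * (D:ℝ)^2 * #Z ≤ Fintype.card β ∧
        #Z < q * #{x | ∀ a, ∃ d, f (x, a) d ∈ Z}} : ℝ) < 1 / 2 * Fintype.card (α × Fin (4 * q) → Fin D → β) := by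
  set total : ℝ := (Fintype.card (α × Fin (4 * q) → Fin D → β) : ℝ) with htot
  have htpos : 0 < total := by rw [htot]; exact_mod_cast Fintype.card_pos
  set b := Fintype.card β with hb
  set Zs : ℕ → Finset (Finset β × Finset α) := fun z =>
    if 16 * (D:ℝ)^2 * z ≤ b then (powersetCard z univ) ×ˢ (powersetCard (z / q + 1) univ) else ∅ with hZs
  set Bad : Finset β × Finset α → Finset (α × Fin (4 * q) → Fin D → β) := fun p =>
    {f | ∀ y ∈ p.2 ×ˢ univ, f y ∈ ({h : Fin D → β | ∃ d, h d ∈ p.1} : Finset _)} with hBad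
  have hsub : ({f : α × Fin (4 * q) → Fin D → β | ∃ Z : Finset β, 16 * (D:ℝ)^2 * #Z ≤ Fintype.card β ∧
        #Z < q * #{x | ∀ a, ∃ d, f (x, a) d ∈ Z}} : Finset _) ⊆
      (Icc 1 b).biUnion (fun z => (Zs z).biUnion Bad) := by
    intro f hf
    simp only [mem_filter, mem_univ, true_and, mem_biUnion] at hf ⊢
    obtain ⟨Z, hZ, hlt⟩ := hf
    have hx : #Z / q + 1 ≤ #{x | ∀ a, ∃ d, f (x, a) d ∈ Z} := by
      rw [Nat.succ_le_iff, Nat.div_lt_iff_lt_mul (by omega), mul_comm]; exact hlt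
    obtain ⟨X, hX, hXc⟩ := Finset.exists_subset_card_eq hx
    have hXne : X.Nonempty := by rw [← card_pos, hXc]; exact Nat.succ_pos _
    refine ⟨#Z, ?_, (Z, X), ?_, ?_⟩
    · rw [mem_Icc]
      refine ⟨?_, card_le_univ _⟩
      obtain ⟨x, hxX⟩ := hXne
      have := hX hxX
      simp only [mem_filter, mem_univ, true_and] at this
      obtain ⟨d, hd⟩ := this ⟨0, by omega⟩
      exact card_pos.2 ⟨_, hd⟩
    · simp [hZs, hZ, hXc, hb]
    · simp only [hBad, mem_filter, mem_univ, true_and, mem_product]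
      rintro ⟨x, a⟩ ⟨hxX, -⟩
      have := hX hxX
      simp only [mem_filter, mem_univ, true_and] at this
      exact this a
  have hterm : ∀ z ∈ Icc 1 b, (#((Zs z).biUnion Bad) : ℝ) ≤ (1/8) ^ z * total := by
    intro z hz
    rw [mem_Icc] at hz
    by_cases hc : 16 * (D:ℝ)^2 * z ≤ b
    · have h1 : ∀ p ∈ Zs z, (#(Bad p) : ℝ) ≤ (D * z / b : ℝ) ^ ((4 * q) * (z / q + 1)) * total := by
        intro p hp
        simp only [hZs, if_pos hc, mem_product, mem_powersetCard, subset_univ, true_and] at hp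
        have := cnt_restrict D (D * z / b : ℝ) (p.2 ×ˢ (univ : Finset (Fin (4 * q))))
          (fun _ => ({h : Fin D → β | ∃ d, h d ∈ p.1} : Finset _)) ?_
        · rw [card_product, hp.2, card_univ, Fintype.card_fin, mul_comm (z / q + 1)] at this
          refine le_trans (le_of_eq ?_) (this.trans (le_of_eq ?_))
          · simp only [hBad]
            congr; exact Subsingleton.elim _ _
          · rw [htot]
            congr; exact Subsingleton.elim _ _
        · intro y _
          have := cnt_exists D hD p.1
          rw [hp.1] at this
          exact this
      have h2 : (#((Zs z).biUnion Bad) : ℝ) ≤ ∑ p ∈ Zs z, (#(Bad p) : ℝ) := by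
        exact_mod_cast card_biUnion_le
      refine h2.trans ((Finset.sum_le_sum h1).trans ?_)
      rw [sum_const, nsmul_eq_mul, ← mul_assoc]
      apply mul_le_mul_of_nonneg_right _ htpos.le
      simp only [hZs, if_pos hc, card_product, card_powersetCard, card_univ]
      push_cast
      apply S_term b _ z (z / q + 1) q D hD hz.1 hc hab
      · have := Nat.div_lt_self (n := z) (k := q) (by omega) (by omega)
        omega
      · have := Nat.lt_mul_div_succ z (b := q) (by omega)
        exact this.le
    · simp only [hZs, if_neg hc, biUnion_empty, card_empty]
      push_cast; positivity
  have hle := (Finset.card_le_card hsub).trans Finset.card_biUnion_le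
  refine lt_of_le_of_lt (Nat.cast_le (α := ℝ).2 hle) ?_
  push_cast
  refine lt_of_le_of_lt (Finset.sum_le_sum hterm) ?_
  rw [← Finset.sum_mul]
  exact mul_lt_mul_of_pos_right (sum_geo b) htpos

theorem lemS (q : ℕ) (hq : 2 ≤ q) (α β : Type) [Fintype α] [Fintype β] [Nonempty β]
    (hab : Fintype.card α ≤ 2 * Fintype.card β) :
    ∃ f : α → Fin (4 * q) → β, ∀ Z : Finset β, 16 * #Z ≤ Fintype.card β →
      q * #{x | ∀ a, f x a ∈ Z} ≤ #Z := by
  have h := lemS_count q 1 hq le_rfl α β hab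
  by_contra! hcon
  rw [Finset.filter_true_of_mem, card_univ] at h
  · have : (0:ℝ) ≤ Fintype.card (α × Fin (4 * q) → Fin 1 → β) := by positivity
    linarith
  · intro f _
    obtain ⟨Z, h1, h2⟩ := hcon (fun x a => f (x, a) 0)
    refine ⟨Z, ?_, ?_⟩
    · have : (16 * #Z : ℝ) ≤ Fintype.card β := by exact_mod_cast h1
      simpa using this
    · refine lt_of_lt_of_le h2 (Nat.mul_le_mul_left _ (card_le_card ?_))
      intro x hx
      simp only [mem_filter, mem_univ, true_and] at hx ⊢
      exact fun a => ⟨0, hx a⟩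

theorem lemES (γ τ : ℝ) (hγ : 0 < γ) (hγ1 : γ ≤ 1) (hτ : 0 < τ) (q : ℕ) (hq : 2 ≤ q) :
    ∃ D : ℕ, 1 ≤ D ∧ ∀ (β : Type) [Fintype β] [Nonempty β],
      ∃ f : β × Fin (4 * q) → Fin D → β,
        (∀ F : Finset β, γ * Fintype.card β ≤ #F → (#{x | ∃ a, ∀ d, f (x, a) d ∉ F} : ℝ) ≤ τ * Fintype.card β) ∧
        (∀ Z : Finset β, 16 * (D:ℝ)^2 * #Z ≤ Fintype.card β → q * #{x | ∀ a, ∃ d, f (x, a) d ∈ Z} ≤ #Z) := by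
  have hq0 : (0:ℝ) < q := by exact_mod_cast (by omega : 0 < q)
  obtain ⟨D, hD, hG⟩ := lemG_count γ (τ / (4 * q)) hγ hγ1 (by positivity) 1
  refine ⟨D, hD, fun β _ _ => ?_⟩
  haveI : Nonempty (Fin (4 * q)) := ⟨⟨0, by omega⟩⟩
  have h1 := hG (β × Fin (4 * q)) β {F : Finset β // γ * Fintype.card β ≤ #F} (fun F _ => F.1) (by
      have e1 : Fintype.card {F : Finset β // γ * Fintype.card β ≤ #F} ≤ 2 ^ Fintype.card β :=
        (Fintype.card_subtype_le _).trans (by simp)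
      have e2 : (2:ℕ) ^ Fintype.card β ≤ 2 ^ (1 * Fintype.card (β × Fin (4 * q))) := by
        apply Nat.pow_le_pow_right (by norm_num)
        rw [Fintype.card_prod, Fintype.card_fin, one_mul]
        exact Nat.le_mul_of_pos_right _ (by omega)
      exact_mod_cast e1.trans e2) (fun F _ => F.2)
  have h2 := lemS_count q D hq hD β β (by omega)
  by_contra! hcon
  set P : (β × Fin (4 * q) → Fin D → β) → Prop := fun f => ∃ κ : {F : Finset β // γ * Fintype.card β ≤ #F}, 
    τ / (4 * q) * (Fintype.card (β × Fin (4 * q)) : ℝ) < #{y | ∀ d, f y d ∉ κ.1} with hP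
  set Q : (β × Fin (4 * q) → Fin D → β) → Prop := fun f => ∃ Z : Finset β, 16 * (D:ℝ)^2 * #Z ≤ Fintype.card β ∧
        #Z < q * #{x | ∀ a, ∃ d, f (x, a) d ∈ Z} with hQ
  have hall : ∀ f, P f ∨ Q f := by
    intro f
    by_cases hp : P f
    · exact Or.inl hp
    · right
      apply hcon f
      intro F hF
      have h3 : (#{y : β × Fin (4 * q) | ∀ d, f y d ∉ F} : ℝ) ≤ τ / (4 * q) * (Fintype.card (β × Fin (4 * q)) : ℝ) := by
        by_contra! h
        exact hp ⟨⟨F, hF⟩, h⟩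
      rw [Fintype.card_prod, Fintype.card_fin] at h3
      push_cast at h3
      have h4 : #{x | ∃ a, ∀ d, f (x, a) d ∉ F} ≤ #{y : β × Fin (4 * q) | ∀ d, f y d ∉ F} := by
        have : ({x | ∃ a, ∀ d, f (x, a) d ∉ F} : Finset β) ⊆ image Prod.fst ({y : β × Fin (4 * q) | ∀ d, f y d ∉ F} : Finset _) := by
          intro x hx
          simp only [mem_filter, mem_univ, true_and, mem_image] at hx ⊢
          obtain ⟨a, ha⟩ := hx
          exact ⟨(x, a), ha, rfl⟩
        exact (card_le_card this).trans card_image_le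
      calc (#{x | ∃ a, ∀ d, f (x, a) d ∉ F} : ℝ) ≤ #{y : β × Fin (4 * q) | ∀ d, f y d ∉ F} := by exact_mod_cast h4
        _ ≤ _ := h3
        _ = _ := by field_simp
  have h5 : (univ : Finset (β × Fin (4 * q) → Fin D → β)) ⊆ univ.filter P ∪ univ.filter Q := by
    intro f _
    simpa using hall f
  have h6 := (card_le_card h5).trans (card_union_le _ _)
  have h7 : (Fintype.card (β × Fin (4 * q) → Fin D → β) : ℝ) ≤ #(univ.filter P) + #(univ.filter Q) := by
    rw [card_univ] at h6; exact_mod_cast h6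
  have h1' : (#(univ.filter P) : ℝ) < 1 / 2 * Fintype.card (β × Fin (4 * q) → Fin D → β) := by
    convert h1
  linarith
end

section
open Finset Classical

theorem sum_range_two_mul (f : ℕ → ℝ) (m : ℕ) :
    ∑ B ∈ range (2 * m), f B = ∑ B ∈ range m, (f (2 * B) + f (2 * B + 1)) := by
  induction m with
  | zero => simp
  | succ m ih => rw [Nat.mul_succ, sum_range_succ, sum_range_succ, ih, sum_range_succ]; ring

/-- number of elements of `D` in block `B` at scale `e` -/
noncomputable def blk (D : Finset ℕ) (e B : ℕ) : ℕ := #{v ∈ D | v / 2 ^ e = B}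

theorem blk_succ (D : Finset ℕ) (e B : ℕ) : blk D (e+1) B = blk D e (2 * B) + blk D e (2 * B + 1) := by
  unfold blk
  rw [← card_union_of_disjoint]
  · congr 1
    ext v
    simp only [mem_filter, mem_union, pow_succ, ← Nat.div_div_eq_div_mul]
    constructor
    · rintro ⟨h, h2⟩
      have : v / 2 ^ e = 2 * B ∨ v / 2 ^ e = 2 * B + 1 := by omega
      tauto
    · rintro (⟨h, h2⟩ | ⟨h, h2⟩) <;> exact ⟨h, by omega⟩
  · rw [disjoint_left]
    intro v h1 h2
    simp only [mem_filter] at h1 h2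
    omega

theorem blk_mono {D D' : Finset ℕ} (h : D ⊆ D') (e B : ℕ) : blk D e B ≤ blk D' e B :=
  card_le_card (filter_subset_filter _ h)

theorem card_block (e B n : ℕ) : #{v ∈ range n | v / 2 ^ e = B} ≤ 2 ^ e := by
  have : ({v ∈ range n | v / 2 ^ e = B} : Finset ℕ) ⊆ Ico (2 ^ e * B) (2 ^ e * B + 2 ^ e) := by
    intro v hv
    simp only [mem_filter, mem_Ico] at hv ⊢
    have h1 := Nat.div_add_mod v (2 ^ e)
    have h2 := Nat.mod_lt v (y := 2 ^ e) (by positivity)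
    rw [hv.2] at h1
    omega
  refine (card_le_card this).trans ?_
  simp

theorem energy (K : ℕ) (D : Finset ℕ) (hD : D ⊆ range (2 ^ K)) (n : ℕ) (hn : n ≤ K) :
    ∑ e ∈ range n, ∑ B ∈ range (2 ^ (K - e - 1)), ((blk D e (2 * B + 1) : ℝ) - blk D e (2 * B)) ^ 2 / 2 ^ (e + 1)
      + ∑ B ∈ range (2 ^ (K - n)), (blk D n B : ℝ) ^ 2 / 2 ^ n = (#D : ℝ) := by
  induction n with
  | zero =>
    simp only [range_zero, sum_empty, zero_add, Nat.sub_zero, pow_zero, div_one, blk, Nat.div_one]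
    have h1 : ∀ B ∈ range (2 ^ K), ((#{v ∈ D | v = B} : ℕ) : ℝ) ^ 2 = if B ∈ D then 1 else 0 := by
      intro B _
      by_cases hB : B ∈ D
      · rw [filter_eq' D B]; simp [hB]
      · rw [filter_eq' D B]; simp [hB]
    rw [sum_congr rfl h1, ← sum_filter, sum_const, nsmul_eq_mul, mul_one]
    congr 2
    ext v; simp only [mem_filter]; exact ⟨fun h => h.2, fun h => ⟨hD h, h⟩⟩
  | succ n ih =>
    rw [← ih (by omega), sum_range_succ, add_assoc]
    congr 1
    have h2 : 2 ^ (K - n) = 2 * 2 ^ (K - n - 1) := by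
      rw [← pow_succ']; congr 1; omega
    rw [h2, sum_range_two_mul, show K - (n + 1) = K - n - 1 by omega, ← sum_add_distrib]
    apply sum_congr rfl
    intro B _
    rw [blk_succ]; push_cast
    field_simp
    ring

theorem typeB (K : ℕ) (D : Finset ℕ) (hD : D ⊆ range (2 ^ K)) (g : ℝ) (hg : 0 < g) :
    ∑ e ∈ range K, (#{u ∈ range (2 ^ K) | u / 2 ^ e % 2 = 0 ∧
      g * 2 ^ e ≤ (blk D e (u / 2 ^ e + 1) : ℝ) - blk D e (u / 2 ^ e)} : ℝ) ≤ 2 / g ^ 2 * 2 ^ K := by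
  have hen := energy K D hD K le_rfl
  have hcard : (#D : ℝ) ≤ 2 ^ K := by
    have := card_le_card hD; rw [card_range] at this; exact_mod_cast this
  have hnn : (0:ℝ) ≤ ∑ B ∈ range (2 ^ (K - K)), (blk D K B : ℝ) ^ 2 / 2 ^ K := by positivity
  have key : ∀ e ∈ range K, (#{u ∈ range (2 ^ K) | u / 2 ^ e % 2 = 0 ∧
      g * 2 ^ e ≤ (blk D e (u / 2 ^ e + 1) : ℝ) - blk D e (u / 2 ^ e)} : ℝ) ≤
      2 / g ^ 2 * ∑ B ∈ range (2 ^ (K - e - 1)), ((blk D e (2 * B + 1) : ℝ) - blk D e (2 * B)) ^ 2 / 2 ^ (e + 1) := by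
    intro e he
    rw [mem_range] at he
    set X := ({u ∈ range (2 ^ K) | u / 2 ^ e % 2 = 0 ∧
      g * 2 ^ e ≤ (blk D e (u / 2 ^ e + 1) : ℝ) - blk D e (u / 2 ^ e)} : Finset ℕ) with hX
    have hmap : ∀ u ∈ X, u / 2 ^ (e + 1) ∈ range (2 ^ (K - e - 1)) := by
      intro u hu
      simp only [hX, mem_filter, mem_range] at hu ⊢
      rw [Nat.div_lt_iff_lt_mul (by positivity), ← pow_add]
      rw [show K - e - 1 + (e + 1) = K by omega]; exact hu.1
    rw [card_eq_sum_card_fiberwise hmap, mul_sum]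
    push_cast
    apply sum_le_sum
    intro B _
    by_cases hB : g * 2 ^ e ≤ (blk D e (2 * B + 1) : ℝ) - blk D e (2 * B)
    · have h1 : #{u ∈ X | u / 2 ^ (e + 1) = B} ≤ 2 ^ e := by
        refine le_trans (card_le_card ?_) (card_block e (2 * B) (2 ^ K))
        intro u hu
        simp only [hX, mem_filter] at hu ⊢
        obtain ⟨⟨h1, h2, _⟩, h3⟩ := hu
        rw [pow_succ, ← Nat.div_div_eq_div_mul] at h3
        exact ⟨h1, by omega⟩
      have h2 : (g * 2 ^ e) ^ 2 ≤ ((blk D e (2 * B + 1) : ℝ) - blk D e (2 * B)) ^ 2 := by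
        apply pow_le_pow_left₀ (by positivity) hB
      calc ((#{u ∈ X | u / 2 ^ (e + 1) = B} : ℕ) : ℝ) ≤ 2 ^ e := by exact_mod_cast h1
        _ = 2 / g ^ 2 * ((g * 2 ^ e) ^ 2 / 2 ^ (e + 1)) := by field_simp; ring
        _ ≤ _ := by gcongr
    · have : ({u ∈ X | u / 2 ^ (e + 1) = B} : Finset ℕ) = ∅ := by
        rw [filter_eq_empty_iff]
        intro u hu h3
        simp only [hX, mem_filter] at hu
        rw [pow_succ, ← Nat.div_div_eq_div_mul] at h3
        have h4 : u / 2 ^ e = 2 * B := by omega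
        rw [h4] at hu
        exact hB hu.2.2
      rw [this]; simp; positivity
  refine (sum_le_sum key).trans ?_
  rw [← mul_sum]
  gcongr
  linarith

theorem typeA (K R : ℕ) (D : ℕ → Finset ℕ) (hD : ∀ j, D j ⊆ range (2 ^ K)) (hm : Monotone D)
    (g : ℝ) (hg : 0 < g) (hg4 : g ≤ 1 / 4) (e : ℕ) :
    (#{u ∈ D R | ∃ j < R, u ∉ D j ∧ (1 - 2 * g) * 2 ^ e ≤ blk (D j) e (u / 2 ^ e)} : ℝ) ≤ 4 * g * #(D R) := by
  set X := ({u ∈ D R | ∃ j < R, u ∉ D j ∧ (1 - 2 * g) * 2 ^ e ≤ blk (D j) e (u / 2 ^ e)} : Finset ℕ) with hX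
  have hm1 : ∀ u ∈ X, u / 2 ^ e ∈ range (2 ^ K) := by
    intro u hu
    have := hD R (mem_filter.1 hu).1
    rw [mem_range] at this ⊢
    exact lt_of_le_of_lt (Nat.div_le_self _ _) this
  have hm2 : ∀ u ∈ D R, u / 2 ^ e ∈ range (2 ^ K) := by
    intro u hu
    have := hD R hu
    rw [mem_range] at this ⊢
    exact lt_of_le_of_lt (Nat.div_le_self _ _) this
  rw [card_eq_sum_card_fiberwise hm1, card_eq_sum_card_fiberwise hm2]
  push_cast
  rw [mul_sum]
  apply sum_le_sum
  intro B _
  by_cases hex : ∃ j < R, (1 - 2 * g) * 2 ^ e ≤ blk (D j) e B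
  · have hj0 := Nat.find_spec hex
    set j0 := Nat.find hex with hj0d
    have hsub : ({u ∈ X | u / 2 ^ e = B} : Finset ℕ) ∪ ({v ∈ D j0 | v / 2 ^ e = B} : Finset ℕ) ⊆ ({v ∈ range (2 ^ K) | v / 2 ^ e = B} : Finset ℕ) := by
      intro v hv
      simp only [mem_union, mem_filter, hX] at hv ⊢
      rcases hv with hv | hv
      · exact ⟨hD _ hv.1.1, hv.2⟩
      · exact ⟨hD _ hv.1, hv.2⟩
    have hdisj : Disjoint ({u ∈ X | u / 2 ^ e = B} : Finset ℕ) ({v ∈ D j0 | v / 2 ^ e = B} : Finset ℕ) := by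
      rw [disjoint_left]
      intro v h1 h2
      simp only [mem_filter, hX] at h1 h2
      obtain ⟨⟨_, j, hj, hvj, hbl⟩, hB⟩ := h1
      rw [hB] at hbl
      exact hvj (hm (Nat.find_min' hex ⟨hj, hbl⟩) h2.1)
    have h1 := card_le_card hsub
    rw [card_union_of_disjoint hdisj] at h1
    have h2 := h1.trans (card_block e B (2 ^ K))
    have h3 : ((#{u ∈ X | u / 2 ^ e = B} : ℕ) : ℝ) + (blk (D j0) e B : ℕ) ≤ 2 ^ e := by
      unfold blk; exact_mod_cast h2
    have h4 : (blk (D j0) e B : ℝ) ≤ blk (D R) e B := by exact_mod_cast blk_mono (hm hj0.1.le) e B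
    have h5 := hj0.2
    change _ ≤ 4 * g * (blk (D R) e B : ℝ)
    have h6 : (0:ℝ) < 2 ^ e := by positivity
    have h7 : (1/2:ℝ) * 2 ^ e ≤ (1 - 2 * g) * 2 ^ e := by gcongr; linarith
    have h8 : (1/2:ℝ) * 2 ^ e ≤ blk (D R) e B := by linarith
    nlinarith
  · have : ({u ∈ X | u / 2 ^ e = B} : Finset ℕ) = ∅ := by
      rw [filter_eq_empty_iff]
      intro u hu h3
      simp only [hX, mem_filter] at hu
      obtain ⟨_, j, hj, _, hbl⟩ := hu
      rw [h3] at hbl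
      exact hex ⟨j, hj, hbl⟩
    rw [this]; simp; positivity

theorem cascade (K R : ℕ) (D : ℕ → Finset ℕ) (hD : ∀ j, D j ⊆ range (2 ^ K)) (hm : Monotone D)
    (g : ℝ) (hg : 0 < g) (hg4 : g ≤ 1 / 4)
    (h : ∀ j < R, ∀ u ∈ D (j+1), u ∉ D j →
      (K:ℝ) / 6 ≤ #{e ∈ range K | u / 2 ^ e % 2 = 0 ∧ (1 - g) * 2 ^ e ≤ blk (D j) e (u / 2 ^ e + 1)}) :
    (K:ℝ) / 6 * #(D R \ D 0) ≤ 4 * g * K * #(D R) + R * (2 / g ^ 2 * 2 ^ K) := by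
  set A : ℕ → ℕ → Prop := fun e u => ∃ j < R, u ∉ D j ∧ (1 - 2 * g) * 2 ^ e ≤ blk (D j) e (u / 2 ^ e) with hA
  set Bp : ℕ → ℕ → ℕ → Prop := fun j e u => u / 2 ^ e % 2 = 0 ∧
      g * 2 ^ e ≤ (blk (D j) e (u / 2 ^ e + 1) : ℝ) - blk (D j) e (u / 2 ^ e) with hBp
  have hpt : ∀ u ∈ D R \ D 0, (K:ℝ) / 6 ≤ (∑ e ∈ range K, if A e u then (1:ℝ) else 0) +
      ∑ j ∈ range R, ∑ e ∈ range K, if Bp j e u then (1:ℝ) else 0 := by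
    intro u hu
    rw [mem_sdiff] at hu
    have hex : ∃ j, u ∈ D j := ⟨R, hu.1⟩
    have hs := Nat.find_spec hex
    have hne : Nat.find hex ≠ 0 := fun h0 => by rw [h0] at hs; exact hu.2 hs
    obtain ⟨j, hj⟩ := Nat.exists_eq_succ_of_ne_zero hne
    have hjR : j < R := by
      have := Nat.find_min' hex hu.1; omega
    have hnj : u ∉ D j := Nat.find_min hex (by omega)
    have hsj : u ∈ D (j+1) := by rw [hj] at hs; exact hs
    refine (h j hjR u hsj hnj).trans ?_
    have h1 : ∑ e ∈ range K, (if Bp j e u then (1:ℝ) else 0) ≤ ∑ j ∈ range R, ∑ e ∈ range K, if Bp j e u then (1:ℝ) else 0 := by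
      apply single_le_sum (f := fun j => ∑ e ∈ range K, if Bp j e u then (1:ℝ) else 0) _ (mem_range.2 hjR)
      intro i _
      apply sum_nonneg; intro e _; split_ifs <;> norm_num
    refine le_trans ?_ (add_le_add_right h1 _)
    rw [← sum_add_distrib, card_filter]
    push_cast
    apply sum_le_sum
    intro e _
    by_cases hc : u / 2 ^ e % 2 = 0 ∧ (1 - g) * 2 ^ e ≤ blk (D j) e (u / 2 ^ e + 1)
    · rw [if_pos hc]
      by_cases hb : (1 - 2 * g) * 2 ^ e ≤ blk (D j) e (u / 2 ^ e)
      · have : A e u := ⟨j, hjR, hnj, hb⟩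
        rw [if_pos this]
        have : (0:ℝ) ≤ if Bp j e u then (1:ℝ) else 0 := by split_ifs <;> norm_num
        linarith
      · have : Bp j e u := ⟨hc.1, by push Not at hb; nlinarith [hc.2]⟩
        rw [if_pos this]
        have : (0:ℝ) ≤ if A e u then (1:ℝ) else 0 := by split_ifs <;> norm_num
        linarith
    · rw [if_neg hc]
      have : (0:ℝ) ≤ if Bp j e u then (1:ℝ) else 0 := by split_ifs <;> norm_num
      have : (0:ℝ) ≤ if A e u then (1:ℝ) else 0 := by split_ifs <;> norm_num
      linarith
  have hsum := sum_le_sum hpt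
  rw [sum_const, nsmul_eq_mul, sum_add_distrib, mul_comm] at hsum
  refine hsum.trans (add_le_add ?_ ?_)
  · rw [sum_comm]
    have : ∀ e ∈ range K, ∑ u ∈ D R \ D 0, (if A e u then (1:ℝ) else 0) ≤ 4 * g * #(D R) := by
      intro e _
      refine le_trans ?_ (typeA K R D hD hm g hg hg4 e)
      rw [sum_boole]
      exact Nat.cast_le.2 (card_le_card (filter_subset_filter _ sdiff_subset))
    refine (sum_le_sum this).trans ?_
    rw [sum_const, card_range, nsmul_eq_mul]
    apply le_of_eq; ring
  · rw [sum_comm]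
    have : ∀ j ∈ range R, ∑ u ∈ D R \ D 0, ∑ e ∈ range K, (if Bp j e u then (1:ℝ) else 0) ≤ 2 / g ^ 2 * 2 ^ K := by
      intro j _
      rw [sum_comm]
      refine le_trans ?_ (typeB K (D j) (hD j) g hg)
      apply sum_le_sum
      intro e _
      rw [sum_boole]
      exact Nat.cast_le.2 (card_le_card (filter_subset_filter _ (sdiff_subset.trans (hD R))))
    refine (sum_le_sum this).trans ?_
    rw [sum_const, card_range, nsmul_eq_mul]
end

section
open Finset Classical

/-- directed acyclic multigraphs with explicit edge type and rank function -/
structure Net where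
  V : Type
  E : Type
  [fV : Fintype V]
  [fE : Fintype E]
  s : E → V
  t : E → V
  rk : V → ℕ
  rk_lt : ∀ e, rk (s e) < rk (t e)

attribute [instance] Net.fV Net.fE

/-- walks of given length avoiding `D` -/
inductive Net.Wk (G : Net) (D : Finset G.V) : ℕ → G.V → G.V → Prop
  | nil (v : G.V) : v ∉ D → Net.Wk G D 0 v v
  | snoc (l : ℕ) (u : G.V) (e : G.E) : Net.Wk G D l u (G.s e) → G.t e ∉ D → Net.Wk G D (l + 1) u (G.t e)

def Net.Rch (G : Net) (D : Finset G.V) (l : ℕ) (u v : G.V) : Prop := ∃ m, l ≤ m ∧ G.Wk D m u v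

theorem Net.Wk.trans {G : Net} {D : Finset G.V} {l m : ℕ} {u v w : G.V} (h1 : G.Wk D l u v) (h2 : G.Wk D m v w) :
    G.Wk D (l + m) u w := by
  induction h2 with
  | nil _ _ => exact h1
  | snoc k v e _ ht ih => exact Net.Wk.snoc (l + k) u e (ih h1) ht

theorem Net.Rch.trans {G : Net} {D : Finset G.V} {l m : ℕ} {u v w : G.V} (h1 : G.Rch D l u v) (h2 : G.Rch D m v w) :
    G.Rch D (l + m) u w := by
  obtain ⟨a, ha, h1⟩ := h1
  obtain ⟨b, hb, h2⟩ := h2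
  exact ⟨a + b, by omega, h1.trans h2⟩

theorem Net.Rch.mono {G : Net} {D : Finset G.V} {l m : ℕ} {u v : G.V} (h1 : G.Rch D l u v) (h : m ≤ l) :
    G.Rch D m u v := by
  obtain ⟨a, ha, h1⟩ := h1
  exact ⟨a, by omega, h1⟩

theorem Net.Wk.left_notMem {G : Net} {D : Finset G.V} {l : ℕ} {u v : G.V} (h : G.Wk D l u v) : u ∉ D := by
  induction h with
  | nil _ h => exact h
  | snoc _ _ _ _ _ ih => exact ih

theorem Net.Wk.right_notMem {G : Net} {D : Finset G.V} {l : ℕ} {u v : G.V} (h : G.Wk D l u v) : v ∉ D := by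
  cases h with
  | nil _ h => exact h
  | snoc _ _ _ _ h => exact h

theorem Net.Rch.refl {G : Net} {D : Finset G.V} {u : G.V} (h : u ∉ D) : G.Rch D 0 u u := ⟨0, le_rfl, .nil u h⟩

theorem Net.Rch.edge {G : Net} {D : Finset G.V} (e : G.E) (h : G.s e ∉ D) (h' : G.t e ∉ D) : G.Rch D 1 (G.s e) (G.t e) :=
  ⟨1, le_rfl, .snoc 0 _ e (.nil _ h) h'⟩

theorem Net.Rch.snoc {G : Net} {D : Finset G.V} {l : ℕ} {u : G.V} (e : G.E) (h : G.Rch D l u (G.s e)) (h' : G.t e ∉ D) :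
    G.Rch D (l + 1) u (G.t e) := by
  obtain ⟨a, ha, h⟩ := h
  exact ⟨a + 1, by omega, .snoc _ _ e h h'⟩

theorem Net.Rch.left_notMem {G : Net} {D : Finset G.V} {l : ℕ} {u v : G.V} (h : G.Rch D l u v) : u ∉ D := by
  obtain ⟨a, ha, h⟩ := h; exact h.left_notMem

theorem Net.Rch.right_notMem {G : Net} {D : Finset G.V} {l : ℕ} {u v : G.V} (h : G.Rch D l u v) : v ∉ D := by
  obtain ⟨a, ha, h⟩ := h; exact h.right_notMem

theorem Net.Rch.anti {G : Net} {D D' : Finset G.V} (hD : D' ⊆ D) {l : ℕ} {u v : G.V} (h : G.Rch D l u v) : G.Rch D' l u v := by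
  obtain ⟨a, ha, h⟩ := h
  refine ⟨a, ha, ?_⟩
  clear ha
  induction h with
  | nil v hv => exact .nil v (fun h => hv (hD h))
  | snoc l u e _ ht ih => exact .snoc l u e ih (fun h => ht (hD h))

/-! micro graph -/

abbrev Om (K t : ℕ) : Type := Fin (2 ^ K) × Fin K × Fin K × Fin t
abbrev Lo (K t : ℕ) (o : ℕ) : Type := Fin (2 ^ o) × Fin K × Fin t

variable {K t : ℕ}

def mkN (o : Fin K) (B : ℕ) (y : Lo K t o) : Om K t :=
  (⟨(B * 2 ^ (o:ℕ) + y.1) % 2 ^ K, Nat.mod_lt _ (by positivity)⟩, o, y.2.1, y.2.2)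

def lwN (o : ℕ) (x : Om K t) : Lo K t o :=
  (⟨x.1 % 2 ^ o, Nat.mod_lt _ (by positivity)⟩, x.2.2.1, x.2.2.2)

def swN (x : Om K t) : Om K t := (x.1, x.2.2.1, x.2.1, x.2.2.2)

theorem swN_swN (x : Om K t) : swN (swN x) = x := rfl

def portN (x : Om K t) : Fin K × Fin (2 ^ K) :=
  (x.2.1, ⟨x.1 / 2 ^ (x.2.1 : ℕ), lt_of_le_of_lt (Nat.div_le_self _ _) x.1.2⟩)

theorem mk_bound (o : Fin K) (B : ℕ) (hB : B < 2 ^ (K - o)) (l : ℕ) (hl : l < 2 ^ (o:ℕ)) : B * 2 ^ (o:ℕ) + l < 2 ^ K := by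
  have h1 : 2 ^ K = 2 ^ (K - o) * 2 ^ (o:ℕ) := by rw [← pow_add]; congr 1; omega
  rw [h1]
  calc B * 2 ^ (o:ℕ) + l < B * 2 ^ (o:ℕ) + 2 ^ (o:ℕ) := by omega
    _ = (B + 1) * 2 ^ (o:ℕ) := by ring
    _ ≤ _ := Nat.mul_le_mul_right _ hB

theorem mkN_val (o : Fin K) (B : ℕ) (hB : B < 2 ^ (K - o)) (y : Lo K t o) : ((mkN o B y).1 : ℕ) = B * 2 ^ (o:ℕ) + y.1 :=
  Nat.mod_eq_of_lt (mk_bound o B hB _ y.1.2)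

theorem mkN_div (o : Fin K) (B : ℕ) (hB : B < 2 ^ (K - o)) (y : Lo K t o) : ((mkN o B y).1 : ℕ) / 2 ^ (o:ℕ) = B := by
  rw [mkN_val o B hB]
  rw [mul_comm, Nat.mul_add_div (by positivity), Nat.div_eq_of_lt y.1.2, add_zero]

theorem mkN_inj (o : Fin K) (B : ℕ) (hB : B < 2 ^ (K - o)) : Function.Injective (mkN (t := t) o B) := by
  intro y y' h
  have h1 : ((mkN o B y).1 : ℕ) = (mkN o B y').1 := by rw [h]
  rw [mkN_val o B hB, mkN_val o B hB] at h1
  have h2 : y.2.1 = y'.2.1 := congrArg (fun x => x.2.2.1) h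
  have h3 : y.2.2 = y'.2.2 := congrArg (fun x => x.2.2.2) h
  refine Prod.ext (Fin.ext (by omega)) (Prod.ext h2 h3)

theorem mkN_lwN (x : Om K t) : mkN x.2.1 (x.1 / 2 ^ (x.2.1:ℕ)) (lwN x.2.1 x) = x := by
  refine Prod.ext (Fin.ext ?_) (Prod.ext rfl (Prod.ext rfl rfl))
  simp only [mkN, lwN]
  rw [mul_comm, Nat.div_add_mod, Nat.mod_eq_of_lt x.1.2]

theorem div_bound (x : Om K t) (o : Fin K) : (x.1 : ℕ) / 2 ^ (o:ℕ) < 2 ^ (K - o) := by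
  rw [Nat.div_lt_iff_lt_mul (by positivity), ← pow_add]
  rw [show K - (o:ℕ) + o = K by omega]; exact x.1.2

/-- counting within a port -/
theorem card_port (p : Fin K × Fin (2 ^ K)) (hB : (p.2 : ℕ) < 2 ^ (K - p.1)) (P : Om K t → Prop) [DecidablePred P] :
    #{x | portN x = p ∧ P x} = #{y : Lo K t p.1 | P (mkN p.1 p.2 y)} := by
  symm
  apply card_bij (fun y _ => mkN p.1 p.2 y)
  · intro y hy
    simp only [mem_filter, mem_univ, true_and] at hy ⊢
    refine ⟨Prod.ext rfl (Fin.ext (mkN_div p.1 p.2 hB y)), hy⟩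
  · intro y _ y' _ h
    exact mkN_inj p.1 p.2 hB h
  · intro x hx
    simp only [mem_filter, mem_univ, true_and] at hx ⊢
    obtain ⟨rfl, hx⟩ := hx
    exact ⟨lwN x.2.1 x, by change P (mkN x.2.1 (x.1 / 2 ^ (x.2.1:ℕ)) (lwN x.2.1 x)); rw [mkN_lwN]; exact hx, mkN_lwN x⟩

theorem card_outport (p : Fin K × Fin (2 ^ K)) (hB : (p.2 : ℕ) < 2 ^ (K - p.1)) (P : Om K t → Prop) [DecidablePred P] :
    #{x | portN (swN x) = p ∧ P x} = #{y : Lo K t p.1 | P (swN (mkN p.1 p.2 y))} := by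
  rw [← card_port p hB (fun x => P (swN x))]
  apply card_bij (fun x _ => swN x)
  · intro x hx
    simpa [swN_swN] using hx
  · intro x _ y _ h
    rw [← swN_swN x, h, swN_swN]
  · intro x hx
    exact ⟨swN x, by simpa [swN_swN] using hx, rfl⟩

theorem portN_bound (x : Om K t) : ((portN x).2 : ℕ) < 2 ^ (K - (portN x).1) := div_bound x x.2.1

theorem card_port_total (p : Fin K × Fin (2 ^ K)) (hB : (p.2 : ℕ) < 2 ^ (K - p.1)) :
    #{x : Om K t | portN x = p} = Fintype.card (Lo K t p.1) := by
  have := card_port (t := t) p hB (fun _ => True)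
  simpa using this

theorem card_outport_total (p : Fin K × Fin (2 ^ K)) (hB : (p.2 : ℕ) < 2 ^ (K - p.1)) :
    #{x : Om K t | portN (swN x) = p} = Fintype.card (Lo K t p.1) := by
  have := card_outport (t := t) p hB (fun _ => True)
  simpa using this

variable {q D : ℕ}

abbrev FF (K t q D : ℕ) := (o : Fin K) → Lo K t o × Fin (4 * q) → Fin D → Lo K t o

def evN (x : Om K t) : Prop := (x.1 : ℕ) / 2 ^ (x.2.2.1 : ℕ) % 2 = 0

def tgtN (f : FF K t q D) (x : Om K t) (a : Fin (4 * q)) (d : Fin D) : Om K t :=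
  mkN x.2.2.1 (x.1 / 2 ^ (x.2.2.1 : ℕ) + 1) (f x.2.2.1 (lwN x.2.2.1 (swN x), a) d)

theorem ev_bound (u : ℕ) (hu : u < 2 ^ K) (o : Fin K) (h : u / 2 ^ (o:ℕ) % 2 = 0) : u / 2 ^ (o:ℕ) + 1 < 2 ^ (K - o) := by
  have h1 : u / 2 ^ (o:ℕ) < 2 ^ (K - o) := by
    rw [Nat.div_lt_iff_lt_mul (by positivity), ← pow_add, show K - (o:ℕ) + o = K by omega]; exact hu
  have h2 : 2 ^ (K - (o:ℕ)) = 2 * 2 ^ (K - o - 1) := by rw [← pow_succ']; congr 1; omega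
  omega

theorem tgt_swmk (f : FF K t q D) (o : Fin K) (B : ℕ) (hB : B < 2 ^ (K - o)) (y : Lo K t o) (a d) :
    tgtN f (swN (mkN o B y)) a d = mkN o (B + 1) (f o (y, a) d) := by
  unfold tgtN
  have h1 : lwN o (mkN o B y) = y := by
    refine Prod.ext (Fin.ext ?_) rfl
    simp only [lwN]
    rw [mkN_val o B hB, mul_comm, Nat.mul_add_mod, Nat.mod_eq_of_lt y.1.2]
  change mkN o (((mkN o B y).1 : ℕ) / 2 ^ (o:ℕ) + 1) (f o (lwN o (mkN o B y), a) d) = _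
  rw [h1, mkN_div o B hB y]

/-- the micro graph as a net -/
noncomputable abbrev microNet (f : FF K t q D) : Net where
  V := Om K t
  E := {x : Om K t // evN x} × Fin (4 * q) × Fin D
  s e := e.1.1
  t e := tgtN f e.1.1 e.2.1 e.2.2
  rk x := x.1
  rk_lt := by
    rintro ⟨⟨x, hx⟩, a, d⟩
    simp only [tgtN]
    rw [mkN_val _ _ (ev_bound x.1 x.1.2 x.2.2.1 hx)]
    have h1 := Nat.div_add_mod (x.1 : ℕ) (2 ^ (x.2.2.1:ℕ))
    have h2 := Nat.mod_lt (x.1 : ℕ) (y := 2 ^ (x.2.2.1:ℕ)) (by positivity)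
    nlinarith

noncomputable def WN (f : FF K t q D) (Kill : Finset (Om K t)) : ℕ → Finset (Om K t)
  | 0 => Kill
  | j + 1 => WN f Kill j ∪ univ.filter (fun x => ¬ evN x ∨ ∃ a, ∀ d, tgtN f x a d ∈ WN f Kill j)

theorem WN_mono (f : FF K t q D) (Kill : Finset (Om K t)) : Monotone (WN f Kill) :=
  monotone_nat_of_le_succ (fun j => by rw [WN]; exact subset_union_left)
end

section
open Finset Classical

section good
variable {K t q D : ℕ} (f : FF K t q D) (Kill : Finset (Om K t))

def PB (j : ℕ) (o : Fin K) (B : ℕ) : Prop :=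
  (#{y : Lo K t o | mkN o B y ∉ WN f Kill j} : ℝ) < 1 / 24000 * Fintype.card (Lo K t o)

theorem PB_mono {i j : ℕ} (h : i ≤ j) (o : Fin K) (B : ℕ) (hp : PB f Kill i o B) : PB f Kill j o B := by
  refine lt_of_le_of_lt (Nat.cast_le.2 (card_le_card ?_)) hp
  intro y hy
  simp only [mem_filter, mem_univ, true_and] at hy ⊢
  exact fun hh => hy (WN_mono f Kill h hh)

noncomputable def Exc (R : ℕ) : Finset (Om K t) :=
  {x | evN x ∧ ∃ j ≤ R, ¬ PB f Kill j x.2.2.1 (x.1 / 2 ^ (x.2.2.1:ℕ) + 1) ∧ ∃ a, ∀ d, tgtN f x a d ∈ WN f Kill j}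

def E1 (f : FF K t q D) (τ : ℝ) : Prop := ∀ (o : Fin K) (F : Finset (Lo K t o)), 1 / 24000 * (Fintype.card (Lo K t o) : ℝ) ≤ #F →
    (#{x | ∃ a, ∀ d, f o (x, a) d ∉ F} : ℝ) ≤ τ * Fintype.card (Lo K t o)

theorem Exc_card (R : ℕ) (τ : ℝ) (hτ : 0 ≤ τ) (hE : E1 f τ) : (#(Exc f Kill R) : ℝ) ≤ τ * Fintype.card (Om K t) := by
  rw [← card_univ, card_eq_sum_card_fiberwise (f := fun x : Om K t => portN (swN x)) (t := univ) (fun _ _ => mem_univ _),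
    card_eq_sum_card_fiberwise (s := univ) (f := fun x : Om K t => portN (swN x)) (t := univ) (fun _ _ => mem_univ _)]
  push_cast
  rw [mul_sum]
  apply sum_le_sum
  intro p _
  by_cases hne : ({x ∈ Exc f Kill R | portN (swN x) = p} : Finset _).Nonempty
  · obtain ⟨x, hx⟩ := hne
    simp only [mem_filter] at hx
    obtain ⟨hxE, hxp⟩ := hx
    have hB : (p.2 : ℕ) < 2 ^ (K - p.1) := by rw [← hxp]; exact portN_bound _
    have e1 : ({x ∈ Exc f Kill R | portN (swN x) = p} : Finset (Om K t)) = ({x | portN (swN x) = p ∧ x ∈ Exc f Kill R} : Finset (Om K t)) := by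
      ext; simp [and_comm]
    rw [e1, card_outport p hB, card_outport_total p hB]
    simp only [Exc, mem_filter, mem_univ, true_and] at hxE
    obtain ⟨hev, j, hj, hnp, -⟩ := hxE
    have hp2 : (x.1 : ℕ) / 2 ^ (x.2.2.1:ℕ) = p.2 := by rw [← hxp]; rfl
    have hp1 : x.2.2.1 = p.1 := by rw [← hxp]; rfl
    rw [hp2, hp1] at hnp
    set j0 := Nat.findGreatest (fun j => ¬ PB f Kill j p.1 (p.2 + 1)) R with hj0
    have hs : ¬ PB f Kill j0 p.1 (p.2 + 1) := Nat.findGreatest_spec (P := fun j => ¬ PB f Kill j p.1 (p.2 + 1)) hj hnp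
    refine le_trans (Nat.cast_le.2 (card_le_card ?_)) (hE p.1 ({y | mkN p.1 (p.2 + 1) y ∉ WN f Kill j0}) ?_)
    · intro y hy
      simp only [mem_filter, mem_univ, true_and, Exc, not_not] at hy ⊢
      obtain ⟨_, i, hi, hpi, a, ha⟩ := hy
      refine ⟨a, fun d => ?_⟩
      have h1 := ha d
      rw [tgt_swmk f p.1 p.2 hB] at h1
      refine WN_mono f Kill ?_ h1
      have h2 : ((swN (mkN p.1 p.2 y)).1 : ℕ) / 2 ^ ((swN (mkN p.1 p.2 y)).2.2.1 : ℕ) = p.2 := mkN_div p.1 p.2 hB y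
      rw [h2] at hpi
      exact Nat.le_findGreatest (P := fun j => ¬ PB f Kill j p.1 (p.2 + 1)) hi hpi
    · unfold PB at hs
      push Not at hs
      exact hs
  · rw [not_nonempty_iff_eq_empty] at hne
    rw [hne]; simp; positivity

def badN (j u : ℕ) (o : Fin K) : Prop := u / 2 ^ (o:ℕ) % 2 ≠ 0 ∨ PB f Kill j o (u / 2 ^ (o:ℕ) + 1)

theorem badN_mono {i j : ℕ} (h : i ≤ j) {u : ℕ} {o : Fin K} (hp : badN f Kill i u o) : badN f Kill j u o := by
  rcases hp with hp | hp
  · exact Or.inl hp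
  · exact Or.inr (PB_mono f Kill h o _ hp)

theorem W_char (R j : ℕ) (hj : j ≤ R) (x : Om K t) (hx : x ∈ WN f Kill (j + 1)) :
    x ∈ Kill ∪ Exc f Kill R ∨ badN f Kill j x.1 x.2.2.1 := by
  induction j with
  | zero =>
    rw [WN, mem_union] at hx
    rcases hx with hx | hx
    · exact Or.inl (mem_union_left _ hx)
    · simp only [mem_filter, mem_univ, true_and] at hx
      by_cases hev : evN x
      · rcases hx with hx | hx
        · exact absurd hev hx
        · by_cases hp : PB f Kill 0 x.2.2.1 (x.1 / 2 ^ (x.2.2.1:ℕ) + 1)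
          · exact Or.inr (Or.inr hp)
          · left; apply mem_union_right
            simp only [Exc, mem_filter, mem_univ, true_and]
            exact ⟨hev, 0, hj, hp, hx⟩
      · exact Or.inr (Or.inl hev)
  | succ j ih =>
    rw [WN, mem_union] at hx
    rcases hx with hx | hx
    · rcases ih (by omega) hx with h | h
      · exact Or.inl h
      · exact Or.inr (badN_mono f Kill (by omega) h)
    · simp only [mem_filter, mem_univ, true_and] at hx
      by_cases hev : evN x
      · rcases hx with hx | hx
        · exact absurd hev hx
        · by_cases hp : PB f Kill (j+1) x.2.2.1 (x.1 / 2 ^ (x.2.2.1:ℕ) + 1)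
          · exact Or.inr (Or.inr hp)
          · left; apply mem_union_right
            simp only [Exc, mem_filter, mem_univ, true_and]
            exact ⟨hev, j+1, hj, hp, hx⟩
      · exact Or.inr (Or.inl hev)

def P0 (X : Finset (Om K t)) (o : Fin K) (B : ℕ) : Prop :=
  1 / 24000 * (Fintype.card (Lo K t o) : ℝ) ≤ #{y : Lo K t o | mkN o B y ∈ X}

noncomputable def f0 (X : Finset (Om K t)) : Finset ℕ :=
  {u ∈ range (2 ^ K) | 2 / 3 * (K:ℝ) < #{o : Fin K | u / 2 ^ (o:ℕ) % 2 ≠ 0} ∨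
    1 / 12 * (K:ℝ) < #{o : Fin K | u / 2 ^ (o:ℕ) % 2 = 0 ∧ P0 X o (u / 2 ^ (o:ℕ) + 1)}}

noncomputable def DD (R j : ℕ) : Finset ℕ :=
  f0 (Kill ∪ Exc f Kill R) ∪ {u ∈ range (2 ^ K) | 11 / 12 * (K:ℝ) ≤ #{o : Fin K | badN f Kill j u o}}

theorem card_odd (o : Fin K) : 2 * #{u ∈ range (2 ^ K) | u / 2 ^ (o:ℕ) % 2 ≠ 0} = 2 ^ K := by
  set X := ({u ∈ range (2 ^ K) | u / 2 ^ (o:ℕ) % 2 ≠ 0} : Finset ℕ)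
  set Y := ({u ∈ range (2 ^ K) | ¬ u / 2 ^ (o:ℕ) % 2 ≠ 0} : Finset ℕ)
  have h1 : #X + #Y = 2 ^ K := by
    have := card_filter_add_card_filter_not (s := range (2 ^ K)) (fun u => u / 2 ^ (o:ℕ) % 2 ≠ 0)
    rw [card_range] at this; exact this
  have h2 : #Y = #X := by
    apply card_bij (fun u _ => u + 2 ^ (o:ℕ))
    · intro u hu
      simp only [Y, X, mem_filter, mem_range, not_not] at hu ⊢
      have hb := ev_bound u hu.1 o hu.2
      have hd : (u + 2 ^ (o:ℕ)) / 2 ^ (o:ℕ) = u / 2 ^ (o:ℕ) + 1 := Nat.add_div_right _ (by positivity)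
      refine ⟨?_, by rw [hd]; omega⟩
      rw [← hd, Nat.div_lt_iff_lt_mul (by positivity), ← pow_add, show K - (o:ℕ) + o = K by omega] at hb
      exact hb
    · intro a _ b _ h; omega
    · intro u hu
      simp only [Y, X, mem_filter, mem_range, not_not, exists_prop] at hu ⊢
      have hge : 2 ^ (o:ℕ) ≤ u := by
        by_contra hlt
        rw [Nat.div_eq_of_lt (by omega)] at hu; omega
      refine ⟨u - 2 ^ (o:ℕ), ⟨lt_of_le_of_lt (Nat.sub_le _ _) hu.1, ?_⟩, by omega⟩
      have hd : (u - 2 ^ (o:ℕ) + 2 ^ (o:ℕ)) / 2 ^ (o:ℕ) = (u - 2 ^ (o:ℕ)) / 2 ^ (o:ℕ) + 1 := Nat.add_div_right _ (by positivity)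
      rw [Nat.sub_add_cancel hge] at hd
      omega
  omega

theorem markovN {α β : Type} [Fintype β] (s : Finset α) (P : α → β → Prop) [∀ a b, Decidable (P a b)] (c M : ℝ) 
    (hM : (∑ b : β, (#{a ∈ s | P a b} : ℝ)) ≤ M) : c * #{a ∈ s | c < #{b | P a b}} ≤ M := by
  refine le_trans ?_ hM
  have : ∑ b : β, (#{a ∈ s | P a b} : ℝ) = ∑ a ∈ s, (#{b | P a b} : ℝ) := by
    simp only [card_filter]
    push_cast
    rw [sum_comm]
  rw [this]
  calc c * #{a ∈ s | c < #{b | P a b}} = ∑ a ∈ s with c < #{b | P a b}, c := by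
        rw [sum_const, nsmul_eq_mul, mul_comm]
    _ ≤ ∑ a ∈ s with c < #{b | P a b}, (#{b | P a b} : ℝ) := by
        apply sum_le_sum; intro a ha; exact (mem_filter.1 ha).2.le
    _ ≤ _ := sum_le_sum_of_subset_of_nonneg (filter_subset _ _) (by intros; positivity)

theorem f0_card (hK : 1 ≤ K) (ht : 1 ≤ t) (X : Finset (Om K t)) (hX : (#X : ℝ) ≤ 1 / 5760000 * Fintype.card (Om K t)) :
    (#(f0 X) : ℝ) ≤ 4 / 5 * 2 ^ K := by
  have hK' : (0:ℝ) < K := by exact_mod_cast hK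
  have ht' : (0:ℝ) < t := by exact_mod_cast ht
  have h1 := markovN (range (2 ^ K)) (fun (u:ℕ) (o : Fin K) => u / 2 ^ (o:ℕ) % 2 ≠ 0) (2 / 3 * K) (K * 2 ^ K / 2) (by
    have : ∀ o : Fin K, (#{u ∈ range (2 ^ K) | u / 2 ^ (o:ℕ) % 2 ≠ 0} : ℝ) = 2 ^ K / 2 := by
      intro o
      have := card_odd o
      have h2 : (2 * #{u ∈ range (2 ^ K) | u / 2 ^ (o:ℕ) % 2 ≠ 0} : ℝ) = 2 ^ K := by exact_mod_cast this
      linarith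
    rw [sum_congr rfl (fun o _ => this o)]
    simp; apply le_of_eq; ring)
  -- second
  have hsum : ∑ o : Fin K, (#{u ∈ range (2 ^ K) | u / 2 ^ (o:ℕ) % 2 = 0 ∧ P0 X o (u / 2 ^ (o:ℕ) + 1)} : ℝ) ≤ 1 / 240 * (K * 2 ^ K) := by
    have hfib : (#X : ℝ) = ∑ o : Fin K, ∑ B : Fin (2 ^ K), (#{x ∈ X | portN x = (o, B)} : ℝ) := by
      rw [card_eq_sum_card_fiberwise (f := fun x : Om K t => portN x) (t := univ) (fun _ _ => mem_univ _)]
      push_cast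
      rw [Fintype.sum_prod_type]
    have hport : ∀ o : Fin K, (#{u ∈ range (2 ^ K) | u / 2 ^ (o:ℕ) % 2 = 0 ∧ P0 X o (u / 2 ^ (o:ℕ) + 1)} : ℝ) * (1 / 24000 * (K * t)) ≤
        ∑ B : Fin (2 ^ K), (#{x ∈ X | portN x = (o, B)} : ℝ) := by
      intro o
      set Y := ({u ∈ range (2 ^ K) | u / 2 ^ (o:ℕ) % 2 = 0 ∧ P0 X o (u / 2 ^ (o:ℕ) + 1)} : Finset ℕ) with hY
      have hbd : ∀ u ∈ Y, u / 2 ^ (o:ℕ) + 1 < 2 ^ (K - o) := by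
        intro u hu
        simp only [hY, mem_filter, mem_range] at hu
        exact ev_bound u hu.1 o hu.2.1
      have hpow : 2 ^ (K - (o:ℕ)) ≤ 2 ^ K := Nat.pow_le_pow_right (by norm_num) (by omega)
      have hmap : ∀ u ∈ Y, (fun u => u / 2 ^ (o:ℕ) + 1) u ∈ range (2 ^ K) := by
        intro u hu
        rw [mem_range]
        exact (hbd u hu).trans_le hpow
      rw [card_eq_sum_card_fiberwise hmap, sum_range]
      push_cast
      rw [sum_mul]
      apply sum_le_sum
      intro B _
      by_cases hne : ({u ∈ Y | u / 2 ^ (o:ℕ) + 1 = (B:ℕ)} : Finset ℕ).Nonempty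
      · obtain ⟨u, hu⟩ := hne
        rw [mem_filter] at hu
        have hBb : (B : ℕ) < 2 ^ (K - o) := by rw [← hu.2]; exact hbd u hu.1
        have hP : P0 X o B := by
          have := hu.1
          simp only [hY, mem_filter] at this
          rw [← hu.2]; exact this.2.2
        have e1 : ({x ∈ X | portN x = (o, B)} : Finset _) = ({x | portN x = (o, B) ∧ x ∈ X} : Finset _) := by
          ext; simp [and_comm]
        rw [e1, card_port (o, B) hBb]
        unfold P0 at hP
        refine le_trans ?_ hP
        have h5 : #{u ∈ Y | u / 2 ^ (o:ℕ) + 1 = (B:ℕ)} ≤ 2 ^ (o:ℕ) := by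
          refine le_trans (card_le_card ?_) (card_block o (B - 1) (2 ^ K))
          intro v hv
          simp only [hY, mem_filter] at hv ⊢
          exact ⟨hv.1.1, by omega⟩
        have h6 : (#{u ∈ Y | u / 2 ^ (o:ℕ) + 1 = (B:ℕ)} : ℝ) ≤ 2 ^ (o:ℕ) := by exact_mod_cast h5
        simp only [Fintype.card_prod, Fintype.card_fin]
        push_cast
        calc (#{u ∈ Y | u / 2 ^ (o:ℕ) + 1 = (B:ℕ)} : ℝ) * (1 / 24000 * (K * t)) ≤ 2 ^ (o:ℕ) * (1 / 24000 * (K * t)) := by gcongr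
          _ = _ := by ring
      · rw [not_nonempty_iff_eq_empty] at hne
        rw [hne]; simp
    have h3 := sum_le_sum (s := univ) (fun o _ => hport o)
    rw [← hfib, ← sum_mul] at h3
    have h4 := h3.trans hX
    simp only [Fintype.card_prod, Fintype.card_fin] at h4
    push_cast at h4
    have h5 : (0:ℝ) < K * t := by positivity
    have h6 : (∑ o : Fin K, (#{u ∈ range (2 ^ K) | u / 2 ^ (o:ℕ) % 2 = 0 ∧ P0 X o (u / 2 ^ (o:ℕ) + 1)} : ℝ)) * (K * t) ≤ (1 / 240 * (K * 2 ^ K)) * (K * t) := by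
      linarith
    exact le_of_mul_le_mul_right h6 h5
  have h2 := markovN (range (2 ^ K)) (fun (u:ℕ) (o : Fin K) => u / 2 ^ (o:ℕ) % 2 = 0 ∧ P0 X o (u / 2 ^ (o:ℕ) + 1)) (1 / 12 * K) (1 / 240 * (K * 2 ^ K)) hsum
  have h7 : (#(f0 X) : ℝ) ≤ #{u ∈ range (2 ^ K) | 2 / 3 * (K:ℝ) < #{o : Fin K | u / 2 ^ (o:ℕ) % 2 ≠ 0}} + 
      #{u ∈ range (2 ^ K) | 1 / 12 * (K:ℝ) < #{o : Fin K | u / 2 ^ (o:ℕ) % 2 = 0 ∧ P0 X o (u / 2 ^ (o:ℕ) + 1)}} := by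
    unfold f0
    rw [filter_or]
    exact_mod_cast card_union_le _ _
  set A : ℝ := (#{u ∈ range (2 ^ K) | 2 / 3 * (K:ℝ) < #{o : Fin K | u / 2 ^ (o:ℕ) % 2 ≠ 0}} : ℝ)
  set B : ℝ := (#{u ∈ range (2 ^ K) | 1 / 12 * (K:ℝ) < #{o : Fin K | u / 2 ^ (o:ℕ) % 2 = 0 ∧ P0 X o (u / 2 ^ (o:ℕ) + 1)}} : ℝ)
  have h8 : A ≤ 3 / 4 * 2 ^ K := by
    refine le_of_mul_le_mul_left ?_ hK'; linarith
  have h9 : B ≤ 1 / 20 * 2 ^ K := by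
    refine le_of_mul_le_mul_left ?_ hK'; linarith
  linarith
end good
end

section
open Finset Classical

section good2
variable {K t q D : ℕ} (f : FF K t q D) (Kill : Finset (Om K t))

theorem density (hK : 1 ≤ K) (ht : 1 ≤ t) (R j : ℕ) (hj : j ≤ R) (o : Fin K) (B : ℕ) (hB : B < 2 ^ (K - o))
    (h0 : ¬ P0 (Kill ∪ Exc f Kill R) o B) (h1 : PB f Kill (j + 1) o B) :
    (1 - 1 / 1000) * (2:ℝ) ^ (o:ℕ) ≤ blk (DD f Kill R j) o B := by
  have hK' : (0:ℝ) < K := by exact_mod_cast hK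
  have ht' : (0:ℝ) < t := by exact_mod_cast ht
  unfold P0 at h0
  unfold PB at h1
  push Not at h0
  set m : ℝ := (Fintype.card (Lo K t o) : ℝ) with hm
  have hmv : m = 2 ^ (o:ℕ) * (K * t) := by
    rw [hm]; simp only [Fintype.card_prod, Fintype.card_fin]; push_cast; ring
  set NB : Finset (Lo K t o) := {y | ¬ badN f Kill j (B * 2 ^ (o:ℕ) + y.1) y.2.1} with hNB
  have hc1 : (#NB : ℝ) ≤ 1 / 12000 * m := by
    have : NB ⊆ ({y : Lo K t o | mkN o B y ∉ WN f Kill (j+1)} : Finset _) ∪ ({y : Lo K t o | mkN o B y ∈ Kill ∪ Exc f Kill R} : Finset _) := by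
      intro y hy
      simp only [hNB, mem_filter, mem_univ, true_and] at hy
      rw [mem_union, mem_filter, mem_filter]
      by_cases hw : mkN o B y ∈ WN f Kill (j + 1)
      · rcases W_char f Kill R j hj _ hw with h | h
        · right; exact ⟨mem_univ _, h⟩
        · exfalso; apply hy; rw [mkN_val o B hB] at h; exact h
      · left; exact ⟨mem_univ _, hw⟩
    have h2 := (card_le_card this).trans (card_union_le _ _)
    have h3 : (#NB : ℝ) ≤ (#{y : Lo K t o | mkN o B y ∉ WN f Kill (j+1)} : ℝ) + (#{y : Lo K t o | mkN o B y ∈ Kill ∪ Exc f Kill R} : ℝ) := by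
      exact_mod_cast h2
    linarith
  set L : Finset (Fin (2 ^ (o:ℕ))) := {l | B * 2 ^ (o:ℕ) + (l:ℕ) ∉ DD f Kill R j} with hL
  have hc2 : (#L : ℝ) * (1 / 12 * K * t) ≤ #NB := by
    have e1 : (#NB : ℝ) = ∑ l : Fin (2 ^ (o:ℕ)), (#{o' : Fin K | ¬ badN f Kill j (B * 2 ^ (o:ℕ) + l) o'} : ℝ) * t := by
      simp only [hNB, card_filter]
      push_cast
      rw [Fintype.sum_prod_type]
      apply sum_congr rfl
      intro l _
      rw [Fintype.sum_prod_type, sum_mul]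
      apply sum_congr rfl
      intro o' _
      by_cases hb : badN f Kill j (B * 2 ^ (o:ℕ) + l) o' <;> simp [hb]
    rw [e1]
    calc (#L : ℝ) * (1 / 12 * K * t) = ∑ l ∈ L, (1 / 12 * K * t : ℝ) := by simp
      _ ≤ ∑ l ∈ L, (#{o' : Fin K | ¬ badN f Kill j (B * 2 ^ (o:ℕ) + l) o'} : ℝ) * t := by
        apply sum_le_sum
        intro l hl
        simp only [hL, mem_filter, mem_univ, true_and, DD, mem_union, not_or, mem_range, not_and, not_le] at hl
        have h4 := hl.2 (mk_bound o B hB l l.2)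
        have h5 := card_filter_add_card_filter_not (s := (univ : Finset (Fin K))) (fun o' => badN f Kill j (B * 2 ^ (o:ℕ) + l) o')
        rw [card_univ, Fintype.card_fin] at h5
        have h6 : (#{o' : Fin K | badN f Kill j (B * 2 ^ (o:ℕ) + l) o'} : ℝ) + (#{o' : Fin K | ¬ badN f Kill j (B * 2 ^ (o:ℕ) + l) o'} : ℝ) = K := by
          exact_mod_cast h5
        gcongr
        linarith
      _ ≤ _ := sum_le_sum_of_subset_of_nonneg (subset_univ _) (by intros; positivity)
  have hc3 : (#L : ℝ) ≤ 1 / 1000 * 2 ^ (o:ℕ) := by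
    have h5 : (0:ℝ) < K * t := by positivity
    refine le_of_mul_le_mul_right ?_ h5
    rw [hmv] at hc1
    linarith
  have hc4 : #({l | ¬ (B * 2 ^ (o:ℕ) + (l:ℕ) ∉ DD f Kill R j)} : Finset (Fin (2 ^ (o:ℕ)))) ≤ blk (DD f Kill R j) o B := by
    unfold blk
    apply card_le_card_of_injOn (fun l : Fin (2 ^ (o:ℕ)) => B * 2 ^ (o:ℕ) + (l:ℕ))
    · intro l hl
      simp only [not_not, coe_filter, mem_univ, true_and, Set.mem_ofPred_eq] at hl ⊢
      refine ⟨hl, ?_⟩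
      rw [mul_comm, Nat.mul_add_div (by positivity), Nat.div_eq_of_lt l.2, add_zero]
    · intro a _ b _ h
      exact Fin.ext (by simpa using h)
  have h5 := card_filter_add_card_filter_not (s := (univ : Finset (Fin (2 ^ (o:ℕ))))) (fun l => B * 2 ^ (o:ℕ) + (l:ℕ) ∉ DD f Kill R j)
  rw [card_univ, Fintype.card_fin] at h5
  have h6 : (2:ℝ) ^ (o:ℕ) ≤ #L + blk (DD f Kill R j) o B := by
    have : 2 ^ (o:ℕ) ≤ #L + blk (DD f Kill R j) o B := h5.symm.le.trans (Nat.add_le_add_left hc4 _)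
    exact_mod_cast this
  linarith

theorem finK_range (K : ℕ) (P : ℕ → Prop) [DecidablePred P] : #{o : Fin K | P o} = #{e ∈ range K | P e} := by
  rw [card_filter, card_filter, sum_range]

theorem DD_mono (R : ℕ) : Monotone (DD f Kill R) := by
  intro i j h u hu
  simp only [DD, mem_union, mem_filter] at hu ⊢
  rcases hu with hu | hu
  · exact Or.inl hu
  · refine Or.inr ⟨hu.1, hu.2.trans (Nat.cast_le.2 (card_le_card ?_))⟩
    intro o ho
    simp only [mem_filter, mem_univ, true_and] at ho ⊢
    exact badN_mono f Kill h ho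

theorem DD_sub (R j : ℕ) : DD f Kill R j ⊆ range (2 ^ K) := by
  intro u hu
  simp only [DD, f0, mem_union, mem_filter] at hu
  rcases hu with hu | hu <;> exact hu.1

/-- split of number of bad scales for u outside f0 -/
theorem split_bad (R j : ℕ) (u : ℕ) (hu : u ∈ DD f Kill R j) (hu0 : u ∉ f0 (Kill ∪ Exc f Kill R)) :
    (K:ℝ) / 6 ≤ #{o : Fin K | u / 2 ^ (o:ℕ) % 2 = 0 ∧ PB f Kill j o (u / 2 ^ (o:ℕ) + 1) ∧ ¬ P0 (Kill ∪ Exc f Kill R) o (u / 2 ^ (o:ℕ) + 1)} := by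
  set X := Kill ∪ Exc f Kill R
  simp only [DD, mem_union, mem_filter] at hu
  have h1 := hu.resolve_left hu0
  simp only [f0, mem_filter, not_and, not_or, not_lt] at hu0
  have h2 := hu0 h1.1
  have h3 : (#{o : Fin K | badN f Kill j u o}) ≤ #{o : Fin K | u / 2 ^ (o:ℕ) % 2 ≠ 0} + #{o : Fin K | u / 2 ^ (o:ℕ) % 2 = 0 ∧ P0 X o (u / 2 ^ (o:ℕ) + 1)} + 
     #{o : Fin K | u / 2 ^ (o:ℕ) % 2 = 0 ∧ PB f Kill j o (u / 2 ^ (o:ℕ) + 1) ∧ ¬ P0 X o (u / 2 ^ (o:ℕ) + 1)} := by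
    refine le_trans (card_le_card ?_) ((card_union_le _ _).trans (Nat.add_le_add_right (card_union_le _ _) _))
    intro o ho
    have ho' := (mem_filter.1 ho).2
    unfold badN at ho'
    simp only [mem_filter, mem_union, mem_univ, true_and]
    tauto
  have h4 := (Nat.cast_le (α := ℝ)).2 h3
  push_cast at h4
  linarith [h1.2, h2.1, h2.2]

theorem DD_zero (hK : 1 ≤ K) (ht : 1 ≤ t) (R : ℕ) : DD f Kill R 0 ⊆ f0 (Kill ∪ Exc f Kill R) := by
  intro u hu
  by_contra h0
  have h1 := split_bad f Kill R 0 u hu h0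
  have hK' : (0:ℝ) < K := by exact_mod_cast hK
  have ht' : (0:ℝ) < t := by exact_mod_cast ht
  have h2 : ({o : Fin K | u / 2 ^ (o:ℕ) % 2 = 0 ∧ PB f Kill 0 o (u / 2 ^ (o:ℕ) + 1) ∧ ¬ P0 (Kill ∪ Exc f Kill R) o (u / 2 ^ (o:ℕ) + 1)} : Finset (Fin K)) = ∅ := by
    apply filter_eq_empty_iff.2
    rintro o _ ⟨_, h3, h4⟩
    apply h4
    unfold PB at h3
    unfold P0
    set B := u / 2 ^ (o:ℕ) + 1
    set m : ℝ := (Fintype.card (Lo K t o) : ℝ) with hm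
    have hm0 : 0 < m := by
      rw [hm]; simp only [Fintype.card_prod, Fintype.card_fin]; push_cast; positivity
    have h5 := card_filter_add_card_filter_not (s := (univ : Finset (Lo K t o))) (fun y => mkN o B y ∈ Kill)
    rw [card_univ] at h5
    have h6 : (#{y : Lo K t o | mkN o B y ∈ Kill} : ℝ) + (#{y : Lo K t o | mkN o B y ∉ Kill} : ℝ) = m := by
      rw [hm]; exact_mod_cast h5
    have h7 : (#{y : Lo K t o | mkN o B y ∈ Kill} : ℝ) ≤ (#{y : Lo K t o | mkN o B y ∈ Kill ∪ Exc f Kill R} : ℝ) := by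
      refine Nat.cast_le.2 (card_le_card ?_)
      intro y hy
      simp only [mem_filter, mem_univ, true_and, mem_union] at hy ⊢
      exact Or.inl hy
    have h8 : (#{y : Lo K t o | mkN o B y ∉ WN f Kill 0} : ℝ) = (#{y : Lo K t o | mkN o B y ∉ Kill} : ℝ) := rfl
    linarith
  rw [h2] at h1
  simp at h1
  linarith

theorem DD_card (hK : 1 ≤ K) (ht : 1 ≤ t) (R : ℕ) (hR : (R:ℝ) * (12 * 10 ^ 9) ≤ K)
    (hE : E1 f (1 / 11520000)) (hKill : (#Kill : ℝ) ≤ 1 / 11520000 * Fintype.card (Om K t)) :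
    (#(DD f Kill R R) : ℝ) ≤ 9 / 10 * 2 ^ K := by
  have hK' : (0:ℝ) < K := by exact_mod_cast hK
  have hx := Exc_card f Kill R _ (by norm_num) hE
  have hX : (#(Kill ∪ Exc f Kill R) : ℝ) ≤ 1 / 5760000 * Fintype.card (Om K t) := by
    have : (#(Kill ∪ Exc f Kill R) : ℝ) ≤ #Kill + #(Exc f Kill R) := by exact_mod_cast card_union_le _ _
    linarith
  have h0 := f0_card hK ht _ hX
  have h1 := cascade K R (DD f Kill R) (DD_sub f Kill R) (DD_mono f Kill R) (1 / 1000) (by norm_num) (by norm_num) (by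
    intro j hj u hu hu'
    have hu0 : u ∉ f0 (Kill ∪ Exc f Kill R) := fun h => hu' (mem_union_left _ h)
    have hlt : u < 2 ^ K := by
      have := DD_sub f Kill R _ hu
      rwa [mem_range] at this
    refine (split_bad f Kill R (j+1) u hu hu0).trans ?_
    rw [← finK_range K (fun e => u / 2 ^ e % 2 = 0 ∧ ((1 - 1/1000) * 2 ^ e : ℝ) ≤ blk (DD f Kill R j) e (u / 2 ^ e + 1))]
    refine Nat.cast_le.2 (card_le_card ?_)
    intro o ho
    simp only [mem_filter, mem_univ, true_and] at ho ⊢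
    exact ⟨ho.1, density f Kill hK ht R j hj.le o _ (ev_bound u hlt o ho.1) ho.2.2 ho.2.1⟩)
  have h2 : (#(DD f Kill R R) : ℝ) ≤ #(DD f Kill R R \ DD f Kill R 0) + #(f0 (Kill ∪ Exc f Kill R)) := by
    have h3 : #(DD f Kill R R) ≤ #(DD f Kill R R \ DD f Kill R 0) + #(DD f Kill R 0) := by
      have := card_sdiff_add_card (s := DD f Kill R R) (t := DD f Kill R 0)
      rw [this]; exact card_le_card subset_union_left
    have h4 := card_le_card (DD_zero f Kill hK ht R)
    exact_mod_cast h3.trans (Nat.add_le_add_left h4 _)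
  have h5 : (#(DD f Kill R R) : ℝ) ≤ 2 ^ K := by
    have := card_le_card (DD_sub f Kill R R)
    rw [card_range] at this
    exact_mod_cast this
  set a : ℝ := (#(DD f Kill R R \ DD f Kill R 0) : ℝ)
  set P : ℝ := (2:ℝ) ^ K with hP
  have hPp : 0 < P := by positivity
  have h6 : (K:ℝ) / 6 * a ≤ 4 / 1000 * K * P + K * P / 6000 := by
    have h7 : 4 * (1 / 1000) * (K:ℝ) * #(DD f Kill R R) ≤ 4 / 1000 * K * P := by
      have : (K:ℝ) * #(DD f Kill R R) ≤ K * P := by gcongr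
      linarith
    have h8 : (R:ℝ) * (2 / (1 / 1000) ^ 2 * P) ≤ K * P / 6000 := by
      have : (R:ℝ) * (12 * 10 ^ 9) * P ≤ K * P := by gcongr
      norm_num at this ⊢
      linarith
    linarith
  have h7 : a ≤ 1 / 10 * P := by
    refine le_of_mul_le_mul_left ?_ hK'
    have : 0 < (K:ℝ) * P := by positivity
    linarith
  linarith

theorem good_count (hK : 1 ≤ K) (ht : 1 ≤ t) (R : ℕ) (hR : (R:ℝ) * (12 * 10 ^ 9) ≤ K)
    (hE : E1 f (1 / 11520000)) (hKill : (#Kill : ℝ) ≤ 1 / 11520000 * Fintype.card (Om K t)) :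
    1 / 240 * (Fintype.card (Om K t) : ℝ) ≤ #(WN f Kill (R + 1))ᶜ := by
  have hK' : (0:ℝ) < K := by exact_mod_cast hK
  have ht' : (0:ℝ) < t := by exact_mod_cast ht
  have h0 := DD_card f Kill hK ht R hR hE hKill
  have hx := Exc_card f Kill R _ (by norm_num) hE
  set N : ℝ := (Fintype.card (Om K t) : ℝ) with hN
  have hNv : N = 2 ^ K * (K * (K * t)) := by
    rw [hN]; simp only [Fintype.card_prod, Fintype.card_fin]; push_cast; ring
  set NB : Finset (Om K t) := {x | ¬ badN f Kill R x.1 x.2.2.1} with hNB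
  have h1 : (#NB : ℝ) ≤ #(WN f Kill (R + 1))ᶜ + (#Kill + #(Exc f Kill R)) := by
    have : NB ⊆ (WN f Kill (R + 1))ᶜ ∪ (Kill ∪ Exc f Kill R) := by
      intro x hx
      simp only [hNB, mem_filter, mem_univ, true_and] at hx
      rw [mem_union, mem_compl]
      by_cases hw : x ∈ WN f Kill (R + 1)
      · exact Or.inr ((W_char f Kill R R le_rfl x hw).resolve_right hx)
      · exact Or.inl hw
    have h2 := (card_le_card this).trans ((card_union_le _ _).trans (Nat.add_le_add_left (card_union_le _ _) _))
    exact_mod_cast h2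
  set L : Finset (Fin (2 ^ K)) := {u | (u:ℕ) ∉ DD f Kill R R} with hL
  have hLc : 1 / 10 * (2:ℝ) ^ K ≤ #L := by
    have h5 := card_filter_add_card_filter_not (s := (univ : Finset (Fin (2 ^ K)))) (fun u => (u:ℕ) ∈ DD f Kill R R)
    rw [card_univ, Fintype.card_fin] at h5
    have h6 : #({u | (u:ℕ) ∈ DD f Kill R R} : Finset (Fin (2 ^ K))) ≤ #(DD f Kill R R) := by
      apply card_le_card_of_injOn (fun u : Fin (2 ^ K) => (u:ℕ))
      · intro u hu; simpa using hu
      · intro a _ b _ h; exact Fin.ext h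
    have h7 : (2:ℝ) ^ K ≤ #(DD f Kill R R) + #L := by
      have : 2 ^ K ≤ #(DD f Kill R R) + #L := h5.symm.le.trans (Nat.add_le_add_right h6 _)
      exact_mod_cast this
    linarith
  have hc2 : (#L : ℝ) * (1 / 12 * K * (K * t)) ≤ #NB := by
    have e1 : (#NB : ℝ) = ∑ u : Fin (2 ^ K), (#{o' : Fin K | ¬ badN f Kill R u o'} : ℝ) * (K * t) := by
      simp only [hNB, card_filter]
      push_cast
      rw [Fintype.sum_prod_type]
      apply sum_congr rfl
      intro l _
      simp only [Fintype.sum_prod_type]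
      rw [sum_comm, sum_mul]
      apply sum_congr rfl
      intro o' _
      by_cases hb : badN f Kill R l o' <;> simp [hb]
    rw [e1]
    calc (#L : ℝ) * (1 / 12 * K * (K * t)) = ∑ l ∈ L, (1 / 12 * K * (K * t) : ℝ) := by simp
      _ ≤ ∑ l ∈ L, (#{o' : Fin K | ¬ badN f Kill R l o'} : ℝ) * (K * t) := by
        apply sum_le_sum
        intro l hl
        simp only [hL, mem_filter, mem_univ, true_and, DD, mem_union, not_or, mem_range, not_and, not_le] at hl
        have h4 := hl.2 l.2
        have h5 := card_filter_add_card_filter_not (s := (univ : Finset (Fin K))) (fun o' => badN f Kill R l o')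
        rw [card_univ, Fintype.card_fin] at h5
        have h6 : (#{o' : Fin K | badN f Kill R l o'} : ℝ) + (#{o' : Fin K | ¬ badN f Kill R l o'} : ℝ) = K := by
          exact_mod_cast h5
        gcongr
        linarith
      _ ≤ _ := sum_le_sum_of_subset_of_nonneg (subset_univ _) (by intros; positivity)
  have h5 : 1 / 10 * (2:ℝ) ^ K * (1 / 12 * K * (K * t)) ≤ (#L : ℝ) * (1 / 12 * K * (K * t)) := by gcongr
  have h6 : 1 / 120 * N ≤ #NB := by rw [hNv]; linarith
  have hN0 : 0 ≤ N := by rw [hNv]; positivity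
  linarith
end good2
end

section
open Finset Classical

section dense
variable {K t q D : ℕ} (f : FF K t q D) (Kill : Finset (Om K t))

def S1 (f : FF K t q D) : Prop := ∀ (o : Fin K) (Z : Finset (Lo K t o)), 16 * (D:ℝ) ^ 2 * #Z ≤ Fintype.card (Lo K t o) →
  q * #{x | ∀ a, ∃ d, f o (x, a) d ∈ Z} ≤ #Z

theorem expand_step (hS : S1 f) (U U' : Finset (Om K t)) (hU : ∀ y ∈ U, evN y ∧ ∀ a, ∃ d, tgtN f y a d ∈ U')
    (hport : ∀ p : Fin K × Fin (2 ^ K), (p.2 : ℕ) < 2 ^ (K - p.1) → 16 * (D:ℝ) ^ 2 * #{z | portN z = p ∧ z ∈ U'} ≤ Fintype.card (Lo K t p.1)) :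
    q * #U ≤ #U' := by
  set key : Om K t → Fin K × ℕ := fun y => (y.2.2.1, y.1 / 2 ^ (y.2.2.1:ℕ) + 1)
  set key' : Om K t → Fin K × ℕ := fun z => (z.2.1, z.1 / 2 ^ (z.2.1:ℕ))
  have h1 : #U = ∑ p ∈ U.image key, #{y ∈ U | key y = p} :=
    card_eq_sum_card_fiberwise (fun y hy => mem_image_of_mem key hy)
  have h2 : ∑ p ∈ U.image key, #{z ∈ U' | key' z = p} ≤ #U' := by
    rw [sum_card_fiberwise_eq_card_filter]
    exact card_filter_le _ _
  rw [h1, mul_sum]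
  refine (sum_le_sum ?_).trans h2
  intro p hp
  rw [mem_image] at hp
  obtain ⟨y, hy, rfl⟩ := hp
  have hev := (hU y hy).1
  set o := y.2.2.1 with ho
  set B := (y.1 : ℕ) / 2 ^ (o:ℕ) with hB
  have hBb : B < 2 ^ (K - o) := div_bound y o
  have hB1 : B + 1 < 2 ^ (K - o) := ev_bound y.1 y.1.2 o hev
  have hpow : 2 ^ (K - (o:ℕ)) ≤ 2 ^ K := Nat.pow_le_pow_right (by norm_num) (by omega)
  set pin : Fin K × Fin (2 ^ K) := (o, ⟨B + 1, hB1.trans_le hpow⟩) with hpin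
  set pout : Fin K × Fin (2 ^ K) := (o, ⟨B, hBb.trans_le hpow⟩) with hpout
  have e1 : #{z ∈ U' | key' z = (o, B + 1)} = #{y : Lo K t o | mkN o (B + 1) y ∈ U'} := by
    rw [← card_port pin hB1 (fun z => z ∈ U')]
    congr 1
    ext z
    simp only [mem_filter, mem_univ, true_and, key', hpin, portN, Prod.mk.injEq]
    constructor
    · rintro ⟨h1, h2, h3⟩
      exact ⟨⟨h2, Fin.ext h3⟩, h1⟩
    · rintro ⟨⟨h2, h3⟩, h1⟩
      exact ⟨h1, h2, congrArg Fin.val h3⟩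
  have e2 : #{y' ∈ U | key y' = (o, B + 1)} = #{y : Lo K t o | swN (mkN o B y) ∈ U} := by
    rw [← card_outport pout hBb (fun z => z ∈ U)]
    congr 1
    ext z
    simp only [mem_filter, mem_univ, true_and, key, hpout, portN, swN, Prod.mk.injEq]
    constructor
    · rintro ⟨h1, h2, h3⟩
      exact ⟨⟨h2, Fin.ext (by simpa using h3)⟩, h1⟩
    · rintro ⟨⟨h2, h3⟩, h1⟩
      refine ⟨h1, h2, ?_⟩
      have := congrArg Fin.val h3
      simp only at this
      rw [this]
  change q * #{y' ∈ U | key y' = (o, B + 1)} ≤ #{z ∈ U' | key' z = (o, B + 1)}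
  rw [e1, e2]
  refine le_trans ?_ (hS o _ ?_)
  · refine Nat.mul_le_mul_left _ (card_le_card ?_)
    intro y hy
    simp only [mem_filter, mem_univ, true_and] at hy ⊢
    intro a
    obtain ⟨d, hd⟩ := (hU _ hy).2 a
    rw [tgt_swmk f o B hBb] at hd
    exact ⟨d, hd⟩
  · have := hport pin hB1
    rw [card_port pin hB1 (fun z => z ∈ U')] at this
    exact this

noncomputable def Uj (R : ℕ) (x : Om K t) : ℕ → Finset (Om K t)
  | 0 => {x}
  | j + 1 => {z | z ∉ WN f Kill (R - j) ∧ ∃ y ∈ Uj R x j, evN y ∧ ∃ a d, tgtN f y a d = z}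

theorem Uj_rch (R : ℕ) (x : Om K t) (hx : x ∉ WN f Kill (R + 1)) (j : ℕ) : ∀ z ∈ Uj f Kill R x j, z ∉ WN f Kill (R + 1 - j) ∧ (microNet f).Rch Kill 0 x z := by
  have hk : ∀ i, Kill ⊆ WN f Kill i := fun i => WN_mono f Kill (Nat.zero_le i)
  induction j with
  | zero =>
    intro z hz
    simp only [Uj, mem_singleton] at hz
    subst hz
    exact ⟨hx, Net.Rch.refl (fun h => hx (hk _ h))⟩
  | succ j ih =>
    intro z hz
    simp only [Uj, mem_filter, mem_univ, true_and] at hz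
    obtain ⟨hz, y, hy, hev, a, d, rfl⟩ := hz
    refine ⟨by rw [show R + 1 - (j + 1) = R - j by omega]; exact hz, ?_⟩
    exact ((ih y hy).2.snoc (G := microNet f) (⟨⟨y, hev⟩, a, d⟩ : (microNet f).E) (fun h => hz (hk _ h))).mono (by omega)

theorem dense_lemma (hS : S1 f) (R : ℕ) (hq : Fintype.card (Om K t) < q ^ (R + 1)) (x : Om K t) (hx : x ∉ WN f Kill (R + 1)) :
    ∃ p : Fin K × Fin (2 ^ K), (p.2 : ℕ) < 2 ^ (K - p.1) ∧
      (Fintype.card (Lo K t p.1) : ℝ) < 16 * (D:ℝ) ^ 2 * #{z | portN z = p ∧ (microNet f).Rch Kill 0 x z} := by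
  by_contra hcon
  push Not at hcon
  have key : ∀ j ≤ R + 1, q ^ j ≤ #(Uj f Kill R x j) := by
    intro j
    induction j with
    | zero => intro _; simp [Uj]
    | succ j ih =>
      intro hj
      have h1 := expand_step f hS (Uj f Kill R x j) (Uj f Kill R x (j+1)) (by
        intro y hy
        have h2 := (Uj_rch f Kill R x hx j y hy).1
        rw [show R + 1 - j = (R - j) + 1 by omega, WN, mem_union, not_or] at h2
        have h3 := h2.2
        simp only [mem_filter, mem_univ, true_and, not_or, not_not, not_exists, not_forall] at h3
        refine ⟨h3.1, fun a => ?_⟩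
        obtain ⟨d, hd⟩ := h3.2 a
        refine ⟨d, ?_⟩
        simp only [Uj, mem_filter, mem_univ, true_and]
        exact ⟨hd, y, hy, h3.1, a, d, rfl⟩) (by
        intro p hp
        refine le_trans ?_ (hcon p hp)
        gcongr with z hz
        rintro h
        exact (Uj_rch f Kill R x hx _ z h).2)
      calc q ^ (j + 1) = q * q ^ j := pow_succ' q j
        _ ≤ q * #(Uj f Kill R x j) := Nat.mul_le_mul_left _ (ih (by omega))
        _ ≤ _ := h1
  have h1 := key (R + 1) le_rfl
  have h2 := card_le_univ (Uj f Kill R x (R + 1))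
  omega

end dense

/-- output of the micro graph construction -/
theorem micro : ∃ β : ℝ, 0 < β ∧ ∃ Cdeg K0 : ℕ, ∀ K ≥ K0, ∀ t, 1 ≤ t → t ≤ 2 ^ (4 * K) →
    ∃ (q D : ℕ) (f : FF K t q D), Fintype.card (microNet f).E ≤ Cdeg * Fintype.card (Om K t) ∧
      ∀ Kill : Finset (Om K t), (#Kill : ℝ) ≤ 1 / 11520000 * Fintype.card (Om K t) → 
        ∃ Good : Finset (Om K t), 1 / 240 * (Fintype.card (Om K t) : ℝ) ≤ #Good ∧
          ∀ x ∈ Good, ∃ p : Fin K × Fin (2 ^ K), (p.2 : ℕ) < 2 ^ (K - p.1) ∧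
            β * (#{z : Om K t | portN z = p} : ℝ) < #{z : Om K t | portN z = p ∧ (microNet f).Rch Kill 0 x z} := by
  obtain ⟨h, hh⟩ : ∃ h : ℕ, h = 12 * 10 ^ 9 := ⟨_, rfl⟩
  have hh1 : 1 ≤ h := by rw [hh]; norm_num
  have hhr : (h : ℝ) = 12 * 10 ^ 9 := by rw [hh]; norm_num
  clear hh
  set q := 2 ^ (16 * h) with hq
  have hq2 : 2 ≤ q := by
    rw [hq]; exact le_self_pow₀ (by norm_num) (by omega)
  obtain ⟨D, hD, hDf⟩ := lemES (1 / 24000) (1 / 11520000) (by norm_num) (by norm_num) (by norm_num) q hq2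
  refine ⟨1 / (16 * (D:ℝ) ^ 2), by positivity, 4 * q * D, 8 * h, ?_⟩
  intro K hK t ht ht2
  have hK1 : 1 ≤ K := by omega
  have : ∀ o : Fin K, ∃ g : Lo K t o × Fin (4 * q) → Fin D → Lo K t o, (∀ F : Finset (Lo K t o), 1 / 24000 * (Fintype.card (Lo K t o) : ℝ) ≤ #F →
    (#{x | ∃ a, ∀ d, g (x, a) d ∉ F} : ℝ) ≤ 1 / 11520000 * Fintype.card (Lo K t o)) ∧ 
     (∀ Z : Finset (Lo K t o), 16 * (D:ℝ) ^ 2 * #Z ≤ Fintype.card (Lo K t o) → q * #{x | ∀ a, ∃ d, g (x, a) d ∈ Z} ≤ #Z) := by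
    intro o
    have : Nonempty (Lo K t o) := ⟨(⟨0, by positivity⟩, ⟨0, by omega⟩, ⟨0, by omega⟩)⟩
    obtain ⟨g, hg1, hg2⟩ := hDf (Lo K t o)
    refine ⟨g, fun F hF => ?_, fun Z hZ => ?_⟩
    · convert hg1 F hF using 4
    · convert hg2 Z hZ using 4
  choose f hf1 hf2 using this
  refine ⟨q, D, f, ?_, ?_⟩
  · change Fintype.card ({x : Om K t // evN x} × Fin (4 * q) × Fin D) ≤ _
    rw [Fintype.card_prod, Fintype.card_prod, Fintype.card_fin, Fintype.card_fin, mul_comm]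
    exact Nat.mul_le_mul_left _ (Fintype.card_subtype_le _)
  · intro Kill hKill
    set R := K / h with hR
    have hR1 : (R:ℝ) * (12 * 10 ^ 9) ≤ K := by
      rw [← hhr]; exact_mod_cast Nat.div_mul_le_self K h
    refine ⟨(WN f Kill (R + 1))ᶜ, good_count f Kill hK1 ht R hR1 hf1 hKill, ?_⟩
    intro x hx
    rw [mem_compl] at hx
    obtain ⟨p, hp, hlt⟩ := dense_lemma f Kill hf2 R (by
      have h1 : Fintype.card (Om K t) ≤ 2 ^ (7 * K) := by
        simp only [Fintype.card_prod, Fintype.card_fin]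
        calc 2 ^ K * (K * (K * t)) ≤ 2 ^ K * (2 ^ K * (2 ^ K * 2 ^ (4 * K))) := by
              have := Nat.lt_two_pow_self (n := K)
              gcongr
          _ = 2 ^ (7 * K) := by rw [← pow_add, ← pow_add, ← pow_add]; congr 1; ring
      refine h1.trans_lt ?_
      rw [hq, ← pow_mul]
      apply Nat.pow_lt_pow_right (by norm_num)
      have : K < h * (R + 1) := by rw [hR]; exact Nat.lt_mul_div_succ K (by omega)
      nlinarith) x hx
    refine ⟨p, hp, ?_⟩
    rw [card_port_total p hp]
    have hD0 : (0:ℝ) < 16 * (D:ℝ) ^ 2 := by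
      have : (0:ℝ) < D := by exact_mod_cast hD
      positivity
    rw [one_div, inv_mul_lt_iff₀ hD0]
    exact hlt
end

section
open Finset Classical

/-- edgeless net -/
noncomputable abbrev Layer (α : Type) [Fintype α] : Net where
  V := α
  E := Empty
  s := Empty.elim
  t := Empty.elim
  rk := fun _ => 0
  rk_lt := fun e => e.elim

theorem Net.Wk.cons {G : Net} {D : Finset G.V} {l : ℕ} {v : G.V} (e : G.E) (h : G.Wk D l (G.t e) v) (hs : G.s e ∉ D) :
    G.Wk D (l + 1) (G.s e) v := by
  have h1 : G.Wk D 1 (G.s e) (G.t e) := .snoc 0 _ e (.nil _ hs) h.left_notMem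
  have := h1.trans h
  rwa [add_comm] at this

theorem Net.exists_bound (G : Net) : ∃ M, ∀ v, G.rk v < M :=
  ⟨univ.sup G.rk + 1, fun v => Nat.lt_succ_of_le (le_sup (f := G.rk) (mem_univ v))⟩

noncomputable def Net.bd (G : Net) : ℕ := G.exists_bound.choose
theorem Net.bd_spec (G : Net) (v : G.V) : G.rk v < G.bd := G.exists_bound.choose_spec v

noncomputable abbrev Net.rev (G : Net) : Net where
  V := G.V
  E := G.E
  s := G.t
  t := G.s
  rk v := G.bd - G.rk v
  rk_lt e := by
    have h1 := G.rk_lt e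
    have h2 := G.bd_spec (G.t e)
    omega

theorem Net.rev_wk {G : Net} {D : Finset G.V} {l : ℕ} {u v : G.V} (h : G.Wk D l u v) : G.rev.Wk D l v u := by
  induction h with
  | nil v hv => exact Net.Wk.nil (G := G.rev) v hv
  | snoc l u e _ ht ih => exact Net.Wk.cons (G := G.rev) e ih ht

theorem Net.rev_rch {G : Net} {D : Finset G.V} {l : ℕ} {u v : G.V} (h : G.Rch D l u v) : G.rev.Rch D l v u := by
  obtain ⟨m, hm, h⟩ := h
  exact ⟨m, hm, Net.rev_wk h⟩

/-- `A` followed by `B` with additional edges from `A` to `B` -/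
noncomputable abbrev Join (A B : Net) (X : Type) [Fintype X] (tl : X → A.V) (hd : X → B.V) : Net where
  V := A.V ⊕ B.V
  E := (A.E ⊕ B.E) ⊕ X
  s := Sum.elim (Sum.map A.s B.s) (fun x => .inl (tl x))
  t := Sum.elim (Sum.map A.t B.t) (fun x => .inr (hd x))
  rk := Sum.elim A.rk (fun b => A.bd + B.rk b)
  rk_lt := by
    rintro ((e | e) | x)
    · exact A.rk_lt e
    · exact Nat.add_lt_add_left (B.rk_lt e) _
    · exact (A.bd_spec _).trans_le (Nat.le_add_right _ _)

section
variable {A B : Net} {X : Type} [Fintype X] {tl : X → A.V} {hd : X → B.V} {D : Finset (A.V ⊕ B.V)}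

theorem Join.left {l : ℕ} {u v : A.V} (h : A.Rch D.toLeft l u v) : (Join A B X tl hd).Rch D l (.inl u) (.inl v) := by
  obtain ⟨m, hm, h⟩ := h
  refine ⟨m, hm, ?_⟩
  clear hm
  induction h with
  | nil v hv => exact Net.Wk.nil (G := Join A B X tl hd) _ (by simpa using hv)
  | snoc l u e _ ht ih => exact Net.Wk.snoc (G := Join A B X tl hd) l _ (.inl (.inl e)) ih (by simpa using ht)

theorem Join.right {l : ℕ} {u v : B.V} (h : B.Rch D.toRight l u v) : (Join A B X tl hd).Rch D l (.inr u) (.inr v) := by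
  obtain ⟨m, hm, h⟩ := h
  refine ⟨m, hm, ?_⟩
  clear hm
  induction h with
  | nil v hv => exact Net.Wk.nil (G := Join A B X tl hd) _ (by simpa using hv)
  | snoc l u e _ ht ih => exact Net.Wk.snoc (G := Join A B X tl hd) l _ (.inl (.inr e)) ih (by simpa using ht)

theorem Join.cross (x : X) (h : Sum.inl (tl x) ∉ D) (h' : Sum.inr (hd x) ∉ D) :
    (Join A B X tl hd).Rch D 1 (.inl (tl x)) (.inr (hd x)) :=
  Net.Rch.edge (G := Join A B X tl hd) (.inr x) h h'

theorem Join.cardE : Fintype.card (Join A B X tl hd).E = Fintype.card A.E + Fintype.card B.E + Fintype.card X := by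
  change Fintype.card ((A.E ⊕ B.E) ⊕ X) = _
  rw [Fintype.card_sum, Fintype.card_sum]
theorem Join.cardV : Fintype.card (Join A B X tl hd).V = Fintype.card A.V + Fintype.card B.V := by
  change Fintype.card (A.V ⊕ B.V) = _
  rw [Fintype.card_sum]
end

/-- glueing a family of nets along extra edges -/
noncomputable abbrev Glue {ι : Type} [Fintype ι] (N : ι → Net) (lev : ι → ℕ) (X : Type) [Fintype X]
    (tl hd : X → (i : ι) × (N i).V) (hl : ∀ x, lev (tl x).1 < lev (hd x).1) : Net where
  V := (i : ι) × (N i).V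
  E := ((i : ι) × (N i).E) ⊕ X
  s := Sum.elim (fun e => ⟨e.1, (N e.1).s e.2⟩) tl
  t := Sum.elim (fun e => ⟨e.1, (N e.1).t e.2⟩) hd
  rk v := lev v.1 * (univ.sup (fun i => (N i).bd)) + (N v.1).rk v.2
  rk_lt := by
    rintro (e | x)
    · exact Nat.add_lt_add_left ((N e.1).rk_lt e.2) _
    · set M := univ.sup (fun i => (N i).bd)
      have h1 : (N (tl x).1).rk (tl x).2 < M := ((N (tl x).1).bd_spec _).trans_le (le_sup (f := fun i => (N i).bd) (mem_univ _))
      have h2 : (lev (tl x).1 + 1) * M ≤ lev (hd x).1 * M := Nat.mul_le_mul_right _ (hl x)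
      simp only [Sum.elim_inr]
      nlinarith

noncomputable def sres {ι : Type} {V : ι → Type} (D : Finset ((i : ι) × V i)) (i : ι) : Finset (V i) :=
  D.preimage (Sigma.mk i) (sigma_mk_injective.injOn)

theorem mem_sres {ι : Type} {V : ι → Type} (D : Finset ((i : ι) × V i)) (i : ι) (v : V i) : v ∈ sres D i ↔ ⟨i, v⟩ ∈ D := by
  simp [sres]

theorem sum_sres {ι : Type} [Fintype ι] {V : ι → Type} (D : Finset ((i : ι) × V i)) : ∑ i, #(sres D i) = #D := by
  rw [card_eq_sum_card_fiberwise (f := fun v : (i : ι) × V i => v.1) (t := univ) (fun _ _ => mem_univ _)]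
  apply sum_congr rfl
  intro i _
  apply card_bij (fun v _ => (⟨i, v⟩ : (i : ι) × V i))
  · intro v hv
    simpa [mem_sres] using hv
  · intro a _ b _ h
    exact sigma_mk_injective h
  · rintro ⟨j, v⟩ hv
    simp only [mem_filter] at hv
    obtain ⟨hv, rfl⟩ := hv
    exact ⟨v, (mem_sres _ _ _).2 hv, rfl⟩

section
variable {ι : Type} [Fintype ι] {N : ι → Net} {lev : ι → ℕ} {X : Type} [Fintype X]
    {tl hd : X → (i : ι) × (N i).V} {hl : ∀ x, lev (tl x).1 < lev (hd x).1} {D : Finset ((i : ι) × (N i).V)}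

theorem Glue.lift {i : ι} {l : ℕ} {u v : (N i).V} (h : (N i).Rch (sres D i) l u v) : 
    (Glue N lev X tl hd hl).Rch D l ⟨i, u⟩ ⟨i, v⟩ := by
  obtain ⟨m, hm, h⟩ := h
  refine ⟨m, hm, ?_⟩
  clear hm
  induction h with
  | nil v hv => exact Net.Wk.nil (G := Glue N lev X tl hd hl) _ (by simpa [mem_sres] using hv)
  | snoc l u e _ ht ih => exact Net.Wk.snoc (G := Glue N lev X tl hd hl) l _ (.inl ⟨i, e⟩) ih (by simpa [mem_sres] using ht)

theorem Glue.cross (x : X) (h : tl x ∉ D) (h' : hd x ∉ D) : (Glue N lev X tl hd hl).Rch D 1 (tl x) (hd x) :=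
  Net.Rch.edge (G := Glue N lev X tl hd hl) (.inr x) h h'

theorem Glue.cardE : Fintype.card (Glue N lev X tl hd hl).E = ∑ i, Fintype.card (N i).E + Fintype.card X := by
  change Fintype.card (((i : ι) × (N i).E) ⊕ X) = _
  rw [Fintype.card_sum, Fintype.card_sigma]
theorem Glue.cardV : Fintype.card (Glue N lev X tl hd hl).V = ∑ i, Fintype.card (N i).V := by
  change Fintype.card ((i : ι) × (N i).V) = _
  rw [Fintype.card_sigma]
end
end

section
open Finset Classical

theorem pick1 (c τ : ℝ) (hc : 0 < c) (hc1 : c ≤ 1) (hτ : 0 < τ) : ∃ D ≥ 1, ∀ (α β : Type) [Fintype α] [Fintype β] [Nonempty α] [Nonempty β],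
    Fintype.card β ≤ Fintype.card α → ∃ f : α → Fin D → β, ∀ X : Finset β, c * Fintype.card β ≤ #X →
      (#{y | ∀ d, f y d ∉ X} : ℝ) ≤ τ * Fintype.card α := by
  obtain ⟨D, hD, h⟩ := lemG c τ hc hc1 hτ 1
  refine ⟨D, hD, ?_⟩
  intro α β _ _ _ _ hab
  obtain ⟨f, hf⟩ := h α β (Finset β) (fun κ _ => if c * Fintype.card β ≤ #κ then κ else univ) (by
    rw [Fintype.card_finset]; push_cast
    exact pow_le_pow_right₀ (by norm_num) (by omega)) (by
    intro κ y
    split_ifs with h1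
    · exact h1
    · rw [card_univ]; exact mul_le_of_le_one_left (by positivity) hc1)
  refine ⟨f, fun X hX => ?_⟩
  have := hf X
  simp only [if_pos hX] at this
  convert this using 4

theorem key_markov {α β : Type} [Fintype α] (k : α → β) [DecidableEq β] (Q : Finset α) (c : ℝ) :
    c * (#{z | c * (#{z' | k z' = k z} : ℝ) < #{z' | k z' = k z ∧ z' ∈ Q}} : ℝ) ≤ #Q := by
  set Z : Finset α := {z | c * (#{z' | k z' = k z} : ℝ) < #{z' | k z' = k z ∧ z' ∈ Q}} with hZ
  have h1 : #Z = ∑ p ∈ Z.image k, #{z ∈ Z | k z = p} := card_eq_sum_card_fiberwise (fun y hy => mem_image_of_mem k hy)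
  have h2 : ∑ p ∈ Z.image k, #{z ∈ Q | k z = p} ≤ #Q := by
    rw [sum_card_fiberwise_eq_card_filter]
    exact card_filter_le _ _
  have h3 : (∑ p ∈ Z.image k, (#{z ∈ Q | k z = p} : ℝ)) ≤ #Q := by exact_mod_cast h2
  rw [h1]
  push_cast
  rw [mul_sum]
  refine (sum_le_sum ?_).trans h3
  intro p hp
  rw [mem_image] at hp
  obtain ⟨z, hz, rfl⟩ := hp
  rw [hZ, mem_filter] at hz
  have h4 : ({z' ∈ Z | k z' = k z} : Finset α) = ({z' | k z' = k z} : Finset α) := by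
    ext z'
    simp only [mem_filter, mem_univ, true_and, and_iff_right_iff_imp, hZ]
    intro h
    rw [h]; exact hz.2
  have h5 : ({z' ∈ Q | k z' = k z} : Finset α) = ({z' | k z' = k z ∧ z' ∈ Q} : Finset α) := by
    ext z'; simp [and_comm]
  rw [h4, h5]
  exact hz.2.le

theorem lwN_mkN {K t : ℕ} (o : Fin K) (B : ℕ) (hB : B < 2 ^ (K - o)) (y : Lo K t o) : lwN o (mkN o B y) = y := by
  refine Prod.ext (Fin.ext ?_) rfl
  simp only [lwN]
  rw [mkN_val o B hB, mul_comm, Nat.mul_add_mod, Nat.mod_eq_of_lt y.1.2]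

abbrev Port (K : ℕ) := Fin K × Fin (2 ^ K)

/-- thick micro net -/
theorem thick (γ1 : ℝ) (hγ : 0 < γ1) : ∃ δ1 : ℝ, 0 < δ1 ∧ ∃ C K0 : ℕ, ∀ K ≥ K0, ∀ t, 1 ≤ t → t ≤ 2 ^ (4 * K) →
    ∃ (T : Net) (a b : Om K t → T.V), Fintype.card T.V ≤ 2 * Fintype.card (Om K t) ∧ Fintype.card T.E ≤ C * Fintype.card (Om K t) ∧ 
      ∀ D : Finset T.V, (#D : ℝ) ≤ δ1 * Fintype.card (Om K t) → ∀ Bl : Finset (Port K), 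
        (#{z : Om K t | portN z ∈ Bl} : ℝ) ≤ 1 / 46080000 * Fintype.card (Om K t) →
        ∃ Good : Finset (Om K t), 1 / 240 * (Fintype.card (Om K t) : ℝ) ≤ #Good ∧
          ∀ x ∈ Good, ∃ p : Port K, p ∉ Bl ∧ 0 < #{z : Om K t | portN z = p} ∧
            (#{z : Om K t | portN z = p ∧ ¬ T.Rch D 0 (a x) (b z)} : ℝ) ≤ 2 * γ1 * #{z : Om K t | portN z = p} := by
  obtain ⟨β0, hβ0, Cd, K0, hmic⟩ := micro
  set β := min β0 1
  have hβ : 0 < β := lt_min hβ0 one_pos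
  obtain ⟨D1, hD1, hpick⟩ := pick1 β γ1 hβ (min_le_right _ _) hγ
  refine ⟨min (1 / 46080000) (γ1 / 46080000), by positivity, Cd + D1, max K0 1, ?_⟩
  intro K hK t ht ht2
  have hK1 : 1 ≤ K := le_of_max_le_right hK
  obtain ⟨q, Dd, f, hE, hG⟩ := hmic K (le_of_max_le_left hK) t ht ht2
  have : ∀ o : Fin K, ∃ g : Lo K t o → Fin D1 → Lo K t o, ∀ X : Finset (Lo K t o), β * Fintype.card (Lo K t o) ≤ #X →
      (#{y | ∀ d, g y d ∉ X} : ℝ) ≤ γ1 * Fintype.card (Lo K t o) := by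
    intro o
    have : Nonempty (Lo K t o) := ⟨(⟨0, by positivity⟩, ⟨0, by omega⟩, ⟨0, by omega⟩)⟩
    obtain ⟨g, hg⟩ := hpick (Lo K t o) (Lo K t o) le_rfl
    exact ⟨g, fun X hX => by convert hg X hX using 4⟩
  choose g hg using this
  set tl : Om K t × Fin D1 → (microNet f).V := fun e => mkN e.1.2.1 (e.1.1 / 2 ^ (e.1.2.1:ℕ)) (g e.1.2.1 (lwN e.1.2.1 e.1) e.2) with htl
  set T := Join (microNet f) (Layer (Om K t)) (Om K t × Fin D1) tl (fun e => e.1) with hT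
  refine ⟨T, Sum.inl, Sum.inr, ?_, ?_, ?_⟩
  · rw [Join.cardV]
    change Fintype.card (Om K t) + Fintype.card (Om K t) ≤ _
    omega
  · rw [Join.cardE, Fintype.card_prod (Om K t), Fintype.card_fin D1]
    change _ + Fintype.card Empty + _ ≤ _
    rw [Fintype.card_empty]
    nlinarith
  · intro D hD Bl hBl
    set N : ℝ := (Fintype.card (Om K t) : ℝ) with hN
    set D' : Finset (Om K t ⊕ Om K t) := D with hD'
    set Q : Finset (Om K t) := D'.toRight with hQ
    set Z0 : Finset (Om K t) := {z | γ1 * (#{z' : Om K t | portN z' = portN z} : ℝ) < #{z' : Om K t | portN z' = portN z ∧ z' ∈ Q}} with hZ0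
    have hZ0c : γ1 * #Z0 ≤ #Q := by convert key_markov portN Q γ1
    set Kill : Finset (Om K t) := D'.toLeft ∪ (({z | portN z ∈ Bl} : Finset (Om K t)) ∪ Z0) with hKill
    have hcD : (#D'.toLeft : ℝ) + #Q = #D := by
      have := card_toLeft_add_card_toRight (u := D')
      exact_mod_cast this
    have hD1a : (#D : ℝ) ≤ 1 / 46080000 * N := hD.trans (by gcongr; exact min_le_left _ _)
    have hD1b : (#D : ℝ) ≤ γ1 / 46080000 * N := hD.trans (by gcongr; exact min_le_right _ _)
    have hZ0d : (#Z0 : ℝ) ≤ 1 / 46080000 * N := by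
      refine le_of_mul_le_mul_left ?_ hγ
      have : (0:ℝ) ≤ #D'.toLeft := by positivity
      linarith
    have hKc : (#Kill : ℝ) ≤ 1 / 11520000 * N := by
      have h1 : #Kill ≤ #D'.toLeft + (#({z | portN z ∈ Bl} : Finset (Om K t)) + #Z0) :=
        (card_union_le _ _).trans (Nat.add_le_add_left (card_union_le _ _) _)
      have h2 : (#Kill : ℝ) ≤ #D'.toLeft + ((#({z | portN z ∈ Bl} : Finset (Om K t)) : ℝ) + #Z0) := by exact_mod_cast h1
      have : (0:ℝ) ≤ #Q := by positivity
      have : 0 ≤ N := by positivity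
      linarith
    obtain ⟨Good, hGc, hGood⟩ := hG Kill hKc
    refine ⟨Good, hGc, ?_⟩
    intro x hx
    obtain ⟨p, hp, hlt⟩ := hGood x hx
    have hpos : (0:ℝ) < #{z : Om K t | portN z = p ∧ (microNet f).Rch Kill 0 x z} := lt_of_le_of_lt (by positivity) hlt
    obtain ⟨z0, hz0⟩ := card_pos.1 (Nat.cast_pos.1 hpos)
    rw [mem_filter] at hz0
    obtain ⟨-, hz0p, hz0r⟩ := hz0
    have hz0k : ¬ (z0 ∈ (Kill : Finset (Om K t))) := hz0r.right_notMem
    simp only [hKill, mem_union, mem_filter, mem_univ, true_and, not_or] at hz0k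
    rw [hz0p] at hz0k
    have hz0c := hz0k.2.2
    simp only [hZ0, mem_filter, mem_univ, true_and, not_lt] at hz0c
    rw [hz0p] at hz0c
    refine ⟨p, hz0k.2.1, card_pos.2 ⟨z0, by simpa using hz0p⟩, ?_⟩
    have hlt' : β * (#{z : Om K t | portN z = p} : ℝ) ≤ #{z : Om K t | portN z = p ∧ (microNet f).Rch Kill 0 x z} :=
      le_trans (by gcongr; exact min_le_left _ _) hlt.le
    rw [card_port_total p hp, card_port p hp (fun z => (microNet f).Rch Kill 0 x z)] at hlt'
    have h3 := hg p.1 _ hlt'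
    have h4 : #{z : Om K t | portN z = p ∧ ¬ T.Rch D 0 (Sum.inl x) (Sum.inr z)} ≤ 
        #{z : Om K t | portN z = p ∧ z ∈ Q} + #{z : Om K t | portN z = p ∧ ∀ d, ¬ (microNet f).Rch Kill 0 x (tl (z, d))} := by
      refine (card_le_card ?_).trans (card_union_le _ _)
      intro z hz
      simp only [mem_filter, mem_univ, true_and, mem_union] at hz ⊢
      by_cases hzQ : z ∈ Q
      · exact Or.inl ⟨hz.1, hzQ⟩
      · right
        refine ⟨hz.1, fun d hr => hz.2 ?_⟩
        have hr' : (microNet f).Rch D'.toLeft 0 x (tl (z, d)) := by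
          have hsub : D'.toLeft ⊆ Kill := subset_union_left
          exact hr.anti hsub
        have h5 := Join.left (A := microNet f) (B := Layer (Om K t)) (X := Om K t × Fin D1) (tl := tl) (hd := fun e => e.1) (D := D') hr'
        have h6 := Join.cross (A := microNet f) (B := Layer (Om K t)) (X := Om K t × Fin D1) (tl := tl) (hd := fun e => e.1) (D := D') (z, d)
          h5.right_notMem (by simpa [hQ] using hzQ)
        exact (h5.trans h6).mono (by omega)
    rw [card_port p hp (fun z => ∀ d, ¬ (microNet f).Rch Kill 0 x (tl (z, d)))] at h4
    have h5 : #{y : Lo K t p.1 | ∀ d, ¬ (microNet f).Rch Kill 0 x (tl (mkN p.1 p.2 y, d))} = 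
        #{y : Lo K t p.1 | ∀ d, g p.1 y d ∉ ({y : Lo K t p.1 | (microNet f).Rch Kill 0 x (mkN p.1 p.2 y)} : Finset (Lo K t p.1))} := by
      congr 1
      ext y
      simp only [mem_filter, mem_univ, true_and]
      have : ∀ d, tl (mkN p.1 p.2 y, d) = mkN p.1 p.2 (g p.1 y d) := by
        intro d
        change mkN p.1 (((mkN p.1 p.2 y).1 : ℕ) / 2 ^ (p.1:ℕ)) (g p.1 (lwN p.1 (mkN p.1 p.2 y)) d) = _
        rw [lwN_mkN p.1 p.2 hp, mkN_div p.1 p.2 hp]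
      simp only [this]
    rw [h5] at h4
    have h6 := (Nat.cast_le (α := ℝ)).2 h4
    push_cast at h6
    refine h6.trans ?_
    have h7 : (#{z : Om K t | portN z = p} : ℝ) = Fintype.card (Lo K t p.1) := by rw [card_port_total p hp]
    rw [h7] at hz0c ⊢
    linarith
end

section
open Finset Classical

theorem key_sum {α β : Type} [Fintype α] (k : α → β) [DecidableEq β] (Bl : Finset β) (Q : Finset α) (c : ℝ)
    (h : ∀ p ∈ Bl, (#{z | k z = p ∧ z ∈ Q} : ℝ) ≤ c * #{z | k z = p}) :
    (#{z | k z ∈ Bl ∧ z ∈ Q} : ℝ) ≤ c * #{z | k z ∈ Bl} := by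
  have h1 : (#{z | k z ∈ Bl ∧ z ∈ Q} : ℝ) = ∑ p ∈ Bl, (#{z | k z = p ∧ z ∈ Q} : ℝ) := by
    have e : ({z | k z ∈ Bl ∧ z ∈ Q} : Finset α) = {z ∈ Q | k z ∈ Bl} := by ext; simp [and_comm]
    rw [e, ← sum_card_fiberwise_eq_card_filter]
    push_cast
    apply sum_congr rfl
    intro p _
    congr 2
    ext; simp [and_comm]
  have h2 : (#{z | k z ∈ Bl} : ℝ) = ∑ p ∈ Bl, (#{z | k z = p} : ℝ) := by
    rw [← sum_card_fiberwise_eq_card_filter]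
    push_cast
    rfl
  rw [h1, h2, mul_sum]
  exact sum_le_sum h

theorem half1 : ∃ δ1 : ℝ, 0 < δ1 ∧ ∃ C K0 : ℕ, ∀ K ≥ K0, ∀ t, 2 ^ K ≤ t → t ≤ 2 ^ (4 * K) →
    ∃ (M : Net) (a b : Om K t → M.V), Fintype.card M.V ≤ 4 * Fintype.card (Om K t) ∧ Fintype.card M.E ≤ C * Fintype.card (Om K t) ∧ 
      ∀ D : Finset M.V, (#D : ℝ) ≤ δ1 * Fintype.card (Om K t) → 
        ∃ Good : Finset (Om K t), 1 / 240 * (Fintype.card (Om K t) : ℝ) ≤ #Good ∧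
          ∀ x ∈ Good, 1 / 100000000 * (Fintype.card (Om K t) : ℝ) ≤ #{z : Om K t | M.Rch D 0 (a x) (b z)} := by
  obtain ⟨δ1, hδ1, C, K0, hth⟩ := thick (1 / 8) (by norm_num)
  obtain ⟨D2, hD2, hG⟩ := lemG (1 / 240) (1 / 92160000) (by norm_num) (by norm_num) (by norm_num) 3
  refine ⟨δ1, hδ1, 2 * C + D2, max K0 1, ?_⟩
  intro K hK t ht ht2
  have hK1 : 1 ≤ K := le_of_max_le_right hK
  have ht1 : 1 ≤ t := le_trans Nat.one_le_two_pow ht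
  obtain ⟨T, a, b, hTV, hTE, hT⟩ := hth K (le_of_max_le_left hK) t ht1 ht2
  set N : ℝ := (Fintype.card (Om K t) : ℝ) with hN
  have hne : Nonempty (Om K t) := ⟨(⟨0, by positivity⟩, ⟨0, by omega⟩, ⟨0, by omega⟩, ⟨0, by omega⟩)⟩
  have hN0 : 0 < N := by rw [hN]; exact_mod_cast Fintype.card_pos
  have hG0 : ∀ (D : Finset T.V) (Bl : Finset (Port K)), ∃ G : Finset (Om K t), 1 / 240 * N ≤ #G ∧ 
      ((#D : ℝ) ≤ δ1 * N → (#{z : Om K t | portN z ∈ Bl} : ℝ) ≤ 1 / 46080000 * N → 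
        ∀ x ∈ G, ∃ p : Port K, p ∉ Bl ∧ 0 < #{z : Om K t | portN z = p} ∧
            (#{z : Om K t | portN z = p ∧ ¬ T.Rch D 0 (a x) (b z)} : ℝ) ≤ 2 * (1 / 8) * #{z : Om K t | portN z = p}) := by
    intro D Bl
    by_cases h1 : (#D : ℝ) ≤ δ1 * N
    · by_cases h2 : (#{z : Om K t | portN z ∈ Bl} : ℝ) ≤ 1 / 46080000 * N
      · obtain ⟨G, hg1, hg2⟩ := hT D h1 Bl h2
        exact ⟨G, hg1, fun _ _ => hg2⟩
      · exact ⟨univ, by rw [card_univ]; linarith, fun _ h => absurd h h2⟩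
    · exact ⟨univ, by rw [card_univ]; linarith, fun h _ => absurd h h1⟩
  choose G hGc hGp using hG0
  obtain ⟨φ, hφ⟩ := hG (Om K t) (Om K t) (Finset T.V × (Port K → Finset (Port K))) (fun κ y => G κ.1 (κ.2 (portN y))) (by
    have : Fintype.card (Finset T.V × (Port K → Finset (Port K))) ≤ 2 ^ (3 * Fintype.card (Om K t)) := by
      rw [Fintype.card_prod, Fintype.card_finset, Fintype.card_fun, Fintype.card_finset, ← pow_mul, ← pow_add]
      apply Nat.pow_le_pow_right (by norm_num)
      have : Fintype.card (Port K) * Fintype.card (Port K) ≤ Fintype.card (Om K t) := by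
        simp only [Fintype.card_prod, Fintype.card_fin]
        calc K * 2 ^ K * (K * 2 ^ K) = 2 ^ K * (K * (K * 2 ^ K)) := by ring
          _ ≤ _ := by gcongr
      omega
    exact_mod_cast this) (fun κ y => hGc _ _)
  set tl : Om K t × Fin D2 → T.V := fun e => b e.1 with htl
  set hd : Om K t × Fin D2 → T.V := fun e => a (φ e.1 e.2) with hhd
  refine ⟨Join T T (Om K t × Fin D2) tl hd, fun x => Sum.inl (a x), fun x => Sum.inr (b x), ?_, ?_, ?_⟩
  · rw [Join.cardV]; omega
  · rw [Join.cardE, Fintype.card_prod (Om K t), Fintype.card_fin D2]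
    nlinarith
  · intro D hD
    have hcD := card_toLeft_add_card_toRight (u := D)
    have hE1 : (#D.toLeft : ℝ) ≤ δ1 * N := le_trans (Nat.cast_le.2 (by omega)) hD
    have hE2 : (#D.toRight : ℝ) ≤ δ1 * N := le_trans (Nat.cast_le.2 (by omega)) hD
    have hB : ∀ p : Port K, ∃ B : Finset (Port K), 
       (∃ Bl : Finset (Port K), (#{z : Om K t | portN z ∈ Bl} : ℝ) ≤ 1 / 46080000 * N ∧ 1 / 2 * (#{y : Om K t | portN y = p} : ℝ) < #{y : Om K t | portN y = p ∧ ∀ d, φ y d ∉ G D.toRight Bl}) → 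
       ((#{z : Om K t | portN z ∈ B} : ℝ) ≤ 1 / 46080000 * N ∧ 1 / 2 * (#{y : Om K t | portN y = p} : ℝ) < #{y : Om K t | portN y = p ∧ ∀ d, φ y d ∉ G D.toRight B}) := by
      intro p
      by_cases h : (∃ Bl : Finset (Port K), (#{z : Om K t | portN z ∈ Bl} : ℝ) ≤ 1 / 46080000 * N ∧ 1 / 2 * (#{y : Om K t | portN y = p} : ℝ) < #{y : Om K t | portN y = p ∧ ∀ d, φ y d ∉ G D.toRight Bl})
      · obtain ⟨B, hB⟩ := h
        exact ⟨B, fun _ => hB⟩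
      · exact ⟨∅, fun h' => absurd h' h⟩
    choose Blf hBlf using hB
    set Q : Finset (Om K t) := {y | ∀ d, φ y d ∉ G D.toRight (Blf (portN y))} with hQ
    have hQc : (#Q : ℝ) ≤ 1 / 92160000 * N := by
      have := hφ (D.toRight, Blf)
      rw [hQ]
      convert this using 4
    set At : Finset (Port K) := {p | 1 / 2 * (#{y : Om K t | portN y = p} : ℝ) < #{y : Om K t | portN y = p ∧ y ∈ Q}} with hAt
    have hAtc : (#{z : Om K t | portN z ∈ At} : ℝ) ≤ 1 / 46080000 * N := by
      have h1 := key_markov (α := Om K t) portN Q (1 / 2)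
      have h2 : (#{z : Om K t | portN z ∈ At} : ℝ) ≤ 2 * #Q := by
        simp only [hAt, mem_filter, mem_univ, true_and]
        have : 1 / 2 * (#{z : Om K t | 1 / 2 * (#{y : Om K t | portN y = portN z} : ℝ) < #{y : Om K t | portN y = portN z ∧ y ∈ Q}} : ℝ) ≤ #Q := by
          convert h1
        linarith
      linarith
    obtain ⟨Good, hg1, hg2⟩ := hT D.toLeft hE1 At hAtc
    refine ⟨Good, hg1, fun x hx => ?_⟩
    obtain ⟨p, hpA, hp0, hpr⟩ := hg2 x hx
    set RS : Finset (Om K t) := {z | ¬ (Join T T (Om K t × Fin D2) tl hd).Rch D 0 (Sum.inl (a x)) (Sum.inr (b z))} with hRS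
    set Bx : Finset (Port K) := {p' | (#{z : Om K t | portN z = p' ∧ z ∈ RS} : ℝ) ≤ 1 / 4 * #{z : Om K t | portN z = p'}} with hBx
    have hbig : 1 / 46080000 * N < (#{z : Om K t | portN z ∈ Bx} : ℝ) := by
      by_contra hcon
      push Not at hcon
      -- p is typical
      have htyp : (#{y : Om K t | portN y = p ∧ ∀ d, φ y d ∉ G D.toRight Bx} : ℝ) ≤ 1 / 2 * (#{y : Om K t | portN y = p} : ℝ) := by
        by_contra h
        push Not at h
        have h2 := (hBlf p ⟨Bx, hcon, h⟩).2
        apply hpA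
        simp only [hAt, mem_filter, mem_univ, true_and]
        refine h2.trans_le (Nat.cast_le.2 (card_le_card ?_))
        intro y hy
        simp only [mem_filter, mem_univ, true_and, hQ] at hy ⊢
        refine ⟨hy.1, ?_⟩
        rw [hy.1]; exact hy.2
      have hex : ∃ y : Om K t, portN y = p ∧ T.Rch D.toLeft 0 (a x) (b y) ∧ ∃ d, φ y d ∈ G D.toRight Bx := by
        by_contra h
        push Not at h
        have h3 : #{y : Om K t | portN y = p} ≤ #{z : Om K t | portN z = p ∧ ¬ T.Rch D.toLeft 0 (a x) (b z)} + #{y : Om K t | portN y = p ∧ ∀ d, φ y d ∉ G D.toRight Bx} := by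
          refine (card_le_card ?_).trans (card_union_le _ _)
          intro y hy
          simp only [mem_filter, mem_univ, true_and, mem_union] at hy ⊢
          by_cases hr : T.Rch D.toLeft 0 (a x) (b y)
          · exact Or.inr ⟨hy, h y hy hr⟩
          · exact Or.inl ⟨hy, hr⟩
        have h4 := (Nat.cast_le (α := ℝ)).2 h3
        push_cast at h4
        have h5 : (0:ℝ) < #{z : Om K t | portN z = p} := Nat.cast_pos.2 hp0
        linarith
      obtain ⟨y, hyp, hyr, d, hyd⟩ := hex
      obtain ⟨p', hp'B, hp'0, hp'r⟩ := hGp D.toRight Bx hE2 hcon _ hyd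
      apply hp'B
      simp only [hBx, mem_filter, mem_univ, true_and]
      refine le_trans (Nat.cast_le.2 (card_le_card ?_)) (hp'r.trans (by linarith))
      intro z hz
      simp only [mem_filter, mem_univ, true_and, hRS] at hz ⊢
      refine ⟨hz.1, fun hr => hz.2 ?_⟩
      have h1 := Join.left (A := T) (B := T) (X := Om K t × Fin D2) (tl := tl) (hd := hd) (D := D) hyr
      have h3 := Join.right (A := T) (B := T) (X := Om K t × Fin D2) (tl := tl) (hd := hd) (D := D) hr
      have h2 := Join.cross (A := T) (B := T) (X := Om K t × Fin D2) (tl := tl) (hd := hd) (D := D) (y, d) h1.right_notMem h3.left_notMem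
      exact ((h1.trans h2).trans h3).mono (by omega)
    have h1 := key_sum (α := Om K t) portN Bx RS (1 / 4) (by
      intro p' hp'
      rw [hBx, mem_filter] at hp'
      convert hp'.2)
    have h2 : #{z : Om K t | portN z ∈ Bx} ≤ #{z : Om K t | portN z ∈ Bx ∧ z ∈ RS} + #{z : Om K t | (Join T T (Om K t × Fin D2) tl hd).Rch D 0 (Sum.inl (a x)) (Sum.inr (b z))} := by
      refine (card_le_card ?_).trans (card_union_le _ _)
      intro z hz
      simp only [mem_filter, mem_univ, true_and, mem_union, hRS] at hz ⊢
      tauto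
    have h3 := (Nat.cast_le (α := ℝ)).2 h2
    push_cast at h3
    have h1' : (#{z : Om K t | portN z ∈ Bx ∧ z ∈ RS} : ℝ) ≤ 1 / 4 * (#{z : Om K t | portN z ∈ Bx} : ℝ) := by convert h1
    linarith

theorem half (γ : ℝ) (hγ : 0 < γ) : ∃ κ : ℝ, 0 < κ ∧ ∃ C K0 : ℕ, ∀ K ≥ K0, ∀ t, 2 ^ K ≤ t → t ≤ 2 ^ (4 * K) →
    ∃ (H : Net) (a b : Om K t → H.V), Fintype.card H.V ≤ 5 * Fintype.card (Om K t) ∧ Fintype.card H.E ≤ C * Fintype.card (Om K t) ∧ 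
      ∀ D : Finset H.V, (#D : ℝ) ≤ κ * Fintype.card (Om K t) → 
        (#{x : Om K t | (#{z : Om K t | H.Rch D 0 (a x) (b z)} : ℝ) < 1 / 100000000 * (Fintype.card (Om K t) : ℝ)} : ℝ) ≤ γ * Fintype.card (Om K t) := by
  obtain ⟨δ1, hδ1, C, K0, hth⟩ := half1
  obtain ⟨D3, hD3, hG⟩ := pick1 (1 / 240) (γ / 2) (by norm_num) (by norm_num) (by positivity)
  refine ⟨min δ1 (γ / 2), by positivity, C + D3, max K0 1, ?_⟩
  intro K hK t ht ht2
  have hK1 : 1 ≤ K := le_of_max_le_right hK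
  have ht1 : 1 ≤ t := le_trans Nat.one_le_two_pow ht
  obtain ⟨M, a, b, hMV, hME, hM⟩ := hth K (le_of_max_le_left hK) t ht ht2
  set N : ℝ := (Fintype.card (Om K t) : ℝ) with hN
  have hne : Nonempty (Om K t) := ⟨(⟨0, by positivity⟩, ⟨0, by omega⟩, ⟨0, by omega⟩, ⟨0, by omega⟩)⟩
  obtain ⟨ψ, hψ⟩ := hG (Om K t) (Om K t) le_rfl
  set tl : Om K t × Fin D3 → (Layer (Om K t)).V := fun e => e.1 with htl
  set hd : Om K t × Fin D3 → M.V := fun e => a (ψ e.1 e.2) with hhd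
  refine ⟨Join (Layer (Om K t)) M (Om K t × Fin D3) tl hd, fun x => Sum.inl x, fun x => Sum.inr (b x), ?_, ?_, ?_⟩
  · rw [Join.cardV]
    change Fintype.card (Om K t) + _ ≤ _
    omega
  · rw [Join.cardE, Fintype.card_prod (Om K t), Fintype.card_fin D3]
    change Fintype.card Empty + _ + _ ≤ _
    rw [Fintype.card_empty]
    nlinarith
  · intro D hD
    have hcD := card_toLeft_add_card_toRight (u := D)
    have hE1 : (#D.toLeft : ℝ) ≤ γ / 2 * N := le_trans (Nat.cast_le.2 (by omega)) (hD.trans (by gcongr; exact min_le_right _ _))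
    have hE2 : (#D.toRight : ℝ) ≤ δ1 * N := le_trans (Nat.cast_le.2 (by omega)) (hD.trans (by gcongr; exact min_le_left _ _))
    obtain ⟨Good, hg1, hg2⟩ := hM D.toRight hE2
    have h1 := hψ Good hg1
    have h2 : #{x : Om K t | (#{z : Om K t | (Join (Layer (Om K t)) M (Om K t × Fin D3) tl hd).Rch D 0 (Sum.inl x) (Sum.inr (b z))} : ℝ) < 1 / 100000000 * N} ≤ #D.toLeft + #{y | ∀ d, ψ y d ∉ Good} := by
      refine (card_le_card ?_).trans (card_union_le _ _)
      intro x hx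
      simp only [mem_filter, mem_univ, true_and, mem_union] at hx ⊢
      by_contra hcon
      push Not at hcon
      obtain ⟨hxD, d, hd'⟩ := hcon
      refine absurd hx (not_lt.2 ((hg2 _ hd').trans (Nat.cast_le.2 (card_le_card ?_))))
      intro z hz
      simp only [mem_filter, mem_univ, true_and] at hz ⊢
      have h3 := Join.right (A := Layer (Om K t)) (B := M) (X := Om K t × Fin D3) (tl := tl) (hd := hd) (D := D) hz
      have h2 := Join.cross (A := Layer (Om K t)) (B := M) (X := Om K t × Fin D3) (tl := tl) (hd := hd) (D := D) (x, d) (by simpa using hxD) h3.left_notMem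
      exact (h2.trans h3).mono (by omega)
    have h3 := (Nat.cast_le (α := ℝ)).2 h2
    push_cast at h3
    refine h3.trans ?_
    have h1' : (#{y | ∀ d, ψ y d ∉ Good} : ℝ) ≤ γ / 2 * N := by convert h1 using 4
    linarith
end

section
open Finset Classical

theorem hubN (γ : ℝ) (hγ : 0 < γ) : ∃ κ : ℝ, 0 < κ ∧ ∃ C K0 : ℕ, ∀ K ≥ K0, ∀ t, 2 ^ K ≤ t → t ≤ 2 ^ (4 * K) →
    ∃ (H : Net) (a b : Om K t → H.V), Fintype.card H.V ≤ C * Fintype.card (Om K t) ∧ Fintype.card H.E ≤ C * Fintype.card (Om K t) ∧ 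
      ∀ D : Finset H.V, (#D : ℝ) ≤ κ * Fintype.card (Om K t) → 
        ∃ A B : Finset (Om K t), (#Aᶜ : ℝ) ≤ γ * Fintype.card (Om K t) ∧ (#Bᶜ : ℝ) ≤ γ * Fintype.card (Om K t) ∧
          ∀ x ∈ A, ∀ y ∈ B, H.Rch D 0 (a x) (b y) := by
  obtain ⟨κ, hκ, C, K0, hth⟩ := half γ hγ
  obtain ⟨D3, hD3, hG⟩ := pick1 (1 / 100000000) (1 / 200000000) (by norm_num) (by norm_num) (by positivity)
  refine ⟨κ, hκ, 10 + 2 * C + D3, max K0 1, ?_⟩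
  intro K hK t ht ht2
  have hK1 : 1 ≤ K := le_of_max_le_right hK
  have ht1 : 1 ≤ t := le_trans Nat.one_le_two_pow ht
  obtain ⟨H, a, b, hV, hE, hH⟩ := hth K (le_of_max_le_left hK) t ht ht2
  have hne : Nonempty (Om K t) := ⟨(⟨0, by positivity⟩, ⟨0, by omega⟩, ⟨0, by omega⟩, ⟨0, by omega⟩)⟩
  have hN0 : (0:ℝ) < Fintype.card (Om K t) := by exact_mod_cast Fintype.card_pos
  set N : ℝ := (Fintype.card (Om K t) : ℝ) with hN
  obtain ⟨ψ, hψ⟩ := hG (Om K t) (Om K t) le_rfl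
  set tl : Om K t × Fin D3 → H.V := fun e => b e.1 with htl
  set hd : Om K t × Fin D3 → H.rev.V := fun e => b (ψ e.1 e.2) with hhd
  refine ⟨Join H H.rev (Om K t × Fin D3) tl hd, fun x => Sum.inl (a x), fun x => Sum.inr (a x), ?_, ?_, ?_⟩
  · rw [Join.cardV]
    change Fintype.card H.V + Fintype.card H.V ≤ _
    nlinarith
  · rw [Join.cardE, Fintype.card_prod (Om K t), Fintype.card_fin D3]
    change Fintype.card H.E + Fintype.card H.E + _ ≤ _
    nlinarith
  · intro D hD
    have hcD := card_toLeft_add_card_toRight (u := D)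
    have hE1 : (#D.toLeft : ℝ) ≤ κ * N := le_trans (Nat.cast_le.2 (by omega)) hD
    have hE2 : (#(D.toRight : Finset H.V) : ℝ) ≤ κ * N := le_trans (Nat.cast_le.2 (by omega)) hD
    refine ⟨({x : Om K t | (#{z : Om K t | H.Rch D.toLeft 0 (a x) (b z)} : ℝ) < 1 / 100000000 * N} : Finset (Om K t))ᶜ, 
      ({x : Om K t | (#{z : Om K t | H.Rch D.toRight 0 (a x) (b z)} : ℝ) < 1 / 100000000 * N} : Finset (Om K t))ᶜ, ?_, ?_, ?_⟩
    · rw [compl_compl]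
      convert hH D.toLeft hE1
    · rw [compl_compl]
      convert hH D.toRight hE2
    · intro x hx y hy
      simp only [mem_compl, mem_filter, mem_univ, true_and, not_lt] at hx hy
      have h1 := hψ {z : Om K t | H.Rch D.toRight 0 (a y) (b z)} hy
      have hex : ∃ z : Om K t, H.Rch D.toLeft 0 (a x) (b z) ∧ ∃ d, H.Rch D.toRight 0 (a y) (b (ψ z d)) := by
        by_contra hcon
        push Not at hcon
        have : #{z : Om K t | H.Rch D.toLeft 0 (a x) (b z)} ≤ #{z | ∀ d, ψ z d ∉ ({z : Om K t | H.Rch D.toRight 0 (a y) (b z)} : Finset (Om K t))} := by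
          apply card_le_card
          intro z hz
          simp only [mem_filter, mem_univ, true_and] at hz ⊢
          exact hcon z hz
        have h2 := (Nat.cast_le (α := ℝ)).2 this
        have h3 : (#{z | ∀ d, ψ z d ∉ ({z : Om K t | H.Rch D.toRight 0 (a y) (b z)} : Finset (Om K t))} : ℝ) ≤ 1 / 200000000 * N := by
          convert h1 using 4
        linarith
      obtain ⟨z, hz1, d, hz2⟩ := hex
      have h1 := Join.left (A := H) (B := H.rev) (X := Om K t × Fin D3) (tl := tl) (hd := hd) (D := D) hz1
      have h3 := Join.right (A := H) (B := H.rev) (X := Om K t × Fin D3) (tl := tl) (hd := hd) (D := D) (Net.rev_rch hz2)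
      have h2 := Join.cross (A := H) (B := H.rev) (X := Om K t × Fin D3) (tl := tl) (hd := hd) (D := D) (z, d) h1.right_notMem h3.left_notMem
      exact ((h1.trans h2).trans h3).mono (by omega)

/-- hub property with depth `d` -/
def IsHub (γ κ : ℝ) (d : ℕ) (n : ℕ) (G : Net) (src snk : Fin n → G.V) : Prop :=
  ∀ D : Finset G.V, (#D : ℝ) ≤ κ * n → ∃ A B : Finset (Fin n), (#Aᶜ : ℝ) ≤ γ * n ∧ (#Bᶜ : ℝ) ≤ γ * n ∧
    ∀ x ∈ A, ∀ y ∈ B, G.Rch D d (src x) (snk y)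

theorem sq_le_two_pow (K : ℕ) (hK : 4 ≤ K) : K * K ≤ 2 ^ K := by
  induction K, hK using Nat.le_induction with
  | base => norm_num
  | succ k hk ih => rw [pow_succ]; nlinarith

theorem hub (γ : ℝ) (hγ : 0 < γ) : ∃ κ : ℝ, 0 < κ ∧ ∃ C : ℕ, 1 ≤ C ∧ ∀ n : ℕ, 1 ≤ n →
    ∃ (H : Net) (src snk : Fin n → H.V), Fintype.card H.V ≤ C * n ∧ Fintype.card H.E ≤ C * n ∧ IsHub γ κ 0 n H src snk := by
  obtain ⟨κ, hκ, C, K0, hth⟩ := hubN (γ / 2) (by positivity)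
  set K1 := max K0 4 with hK1
  refine ⟨min κ (1 / (2 * 8 ^ K1)), by positivity, 2 * C + 1, by omega, ?_⟩
  intro n hn
  have hn0 : (0:ℝ) < n := by exact_mod_cast hn
  by_cases hsm : n < 8 ^ K1
  · refine ⟨Layer Unit, fun _ => (), fun _ => (), ?_, ?_, ?_⟩
    · change Fintype.card Unit ≤ _
      rw [Fintype.card_unit]; nlinarith
    · change Fintype.card Empty ≤ _
      rw [Fintype.card_empty]; positivity
    · intro D hD
      have : (#D : ℝ) < 1 := by
        refine hD.trans_lt ?_
        have h8 : (0:ℝ) < 8 ^ K1 := by positivity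
        calc min κ (1 / (2 * 8 ^ K1)) * n ≤ (1 / (2 * 8 ^ K1)) * n := by gcongr; exact min_le_right _ _
          _ ≤ (1 / (2 * 8 ^ K1)) * 8 ^ K1 := by gcongr; exact_mod_cast hsm.le
          _ < 1 := by field_simp; norm_num
      have hD0 : D = ∅ := by
        rw [← card_eq_zero]
        have : #D < 1 := by exact_mod_cast this
        omega
      subst hD0
      refine ⟨univ, univ, ?_, ?_, fun x _ y _ => Net.Rch.refl (notMem_empty _)⟩
      all_goals simp; positivity
  · push Not at hsm
    set K := Nat.log 8 n with hK
    have hKK : K1 ≤ K := Nat.le_log_of_pow_le (by norm_num) hsm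
    have hK0 : K0 ≤ K := le_trans (le_max_left _ _) hKK
    have hK4 : 4 ≤ K := le_trans (le_max_right _ _) hKK
    have hl : 8 ^ K ≤ n := Nat.pow_log_le_self 8 (by omega)
    have hu : n < 8 ^ (K + 1) := Nat.lt_pow_succ_log_self (by norm_num) n
    have hsq := sq_le_two_pow K hK4
    set x := 2 ^ K with hx
    have h8 : 8 ^ K = x * x * x := by rw [hx, ← mul_pow, ← mul_pow]; norm_num
    have hx16 : 16 ≤ x := by
      calc 16 = 2 ^ 4 := by norm_num
        _ ≤ 2 ^ K := Nat.pow_le_pow_right (by norm_num) hK4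
    rw [pow_succ, h8] at hu
    rw [h8] at hl
    set P := x * (K * K) with hP
    have hP0 : 0 < P := by positivity
    have hPx : P ≤ x * x := Nat.mul_le_mul_left _ hsq
    set t := (n + P - 1) / P with ht
    have ht1 : n ≤ P * t := by
      have := Nat.lt_div_mul_add (a := n + P - 1) hP0
      rw [← ht] at this
      have h2 : t * P = P * t := mul_comm _ _
      omega
    have ht2 : P * t ≤ n + P - 1 := Nat.mul_div_le _ _
    have hN : Fintype.card (Om K t) = P * t := by
      change Fintype.card (Fin (2 ^ K) × Fin K × Fin K × Fin t) = _
      simp only [Fintype.card_prod, Fintype.card_fin]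
      rw [hP]; ring
    have hPn : P ≤ n := by nlinarith
    have htl : 2 ^ K ≤ t := by
      by_contra hc
      push Not at hc
      rw [← hx] at hc
      have : P * t < x * x * x := by
        calc P * t ≤ x * x * t := Nat.mul_le_mul_right _ hPx
          _ < x * x * x := Nat.mul_lt_mul_of_pos_left hc (by positivity)
      omega
    have htu : t ≤ 2 ^ (4 * K) := by
      have e : 2 ^ (4 * K) = x * x * (x * x) := by rw [hx]; ring
      rw [e]
      have h16 : 16 ≤ P := le_trans hx16 (Nat.le_mul_of_pos_right _ (by positivity))
      have : 16 * t ≤ 16 * (x * x * x) := by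
        have := Nat.mul_le_mul_right t h16
        omega
      nlinarith
    obtain ⟨H, a, b, hV, hE, hH⟩ := hth K hK0 t htl htu
    rw [hN] at hV hE hH
    obtain ⟨ι⟩ : Nonempty (Fin n ↪ Om K t) := Function.Embedding.nonempty_of_card_le (by rw [hN, Fintype.card_fin]; exact ht1)
    refine ⟨H, a ∘ ι, b ∘ ι, ?_, ?_, ?_⟩
    · refine hV.trans ?_
      have : P * t ≤ 2 * n := by omega
      nlinarith
    · refine hE.trans ?_
      have : P * t ≤ 2 * n := by omega
      nlinarith
    · intro D hD
      have hNn : (n:ℝ) ≤ (P * t : ℕ) := by exact_mod_cast ht1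
      have hNn2 : ((P * t : ℕ) : ℝ) ≤ 2 * n := by exact_mod_cast (by omega : P * t ≤ 2 * n)
      obtain ⟨A, B, hA, hB, hAB⟩ := hH D (hD.trans (mul_le_mul (min_le_left _ _) hNn (by positivity) hκ.le))
      have key : ∀ A : Finset (Om K t), (#Aᶜ : ℝ) ≤ γ / 2 * (P * t : ℕ) → (#(univ.filter (fun i => ι i ∈ A))ᶜ : ℝ) ≤ γ * n := by
        intro A hA
        calc (#(univ.filter (fun i => ι i ∈ A))ᶜ : ℝ) ≤ #Aᶜ := by
              apply Nat.cast_le.2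
              apply card_le_card_of_injOn ι _ ι.injective.injOn
              intro i hi
              simpa using hi
          _ ≤ _ := hA
          _ ≤ γ / 2 * (2 * n) := by gcongr
          _ = _ := by ring
      refine ⟨univ.filter (fun i => ι i ∈ A), univ.filter (fun i => ι i ∈ B), key A hA, key B hB, ?_⟩
      intro x hx y hy
      exact hAB _ (mem_filter.1 hx).2 _ (mem_filter.1 hy).2
end

section
open Finset Classical

theorem mem_blk {v h b : ℕ} : v ∈ Ico (b * 2 ^ h) ((b + 1) * 2 ^ h) ↔ v / 2 ^ h = b := by
  rw [mem_Ico, Nat.div_eq_iff (by positivity), add_mul]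
  have : 0 < 2 ^ h := by positivity
  omega

theorem div_eq_mono {v w i j : ℕ} (h : v / 2 ^ i = w / 2 ^ i) (hij : i ≤ j) : v / 2 ^ j = w / 2 ^ j := by
  obtain ⟨k, rfl⟩ := Nat.exists_eq_add_of_le hij
  rw [pow_add, ← Nat.div_div_eq_div_mul, ← Nat.div_div_eq_div_mul, h]

theorem opt_aux {p T o a b : ℝ} (hp0 : 0 < p) (hp1 : p ≤ 1) (h : T = (1 - p) * o + p / 2 * (a + b)) (ho : o < T) (hab : a ≤ b) : T ≤ b := by
  have h1 : (1 - p) * o ≤ (1 - p) * T := mul_le_mul_of_nonneg_left ho.le (by linarith)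
  have h2 : p / 2 * (a + b) ≤ p / 2 * (b + b) := by gcongr
  have h3 : p * T ≤ p * b := by linarith
  exact le_of_mul_le_mul_left h3 hp0

theorem tree (good : ℕ → ℕ → Prop) (p : ℝ) (hp0 : 0 < p) (hp1 : p ≤ 1) (h : ℕ) : ∀ (b : ℕ) (ω : ℕ → ℝ) (_ : ∀ v, 0 ≤ ω v),
    ∃ S ⊆ Ico (b * 2 ^ h) ((b + 1) * 2 ^ h), 
      (∀ v ∈ S, ∀ w ∈ S, ∀ i, v / 2 ^ i ≠ w / 2 ^ i → v / 2 ^ (i + 1) = w / 2 ^ (i + 1) → good i v) ∧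
      ∑ v ∈ Ico (b * 2 ^ h) ((b + 1) * 2 ^ h), ω v * ∏ i ∈ range h, (if good i v then 1 - p / 2 else p / 2) ≤ ∑ v ∈ S, ω v := by
  induction h with
  | zero =>
    intro b ω hω
    refine ⟨Ico (b * 2 ^ 0) ((b + 1) * 2 ^ 0), Subset.rfl, ?_, ?_⟩
    · intro v hv w hw i h1 h2
      exfalso
      have hv' := mem_blk.1 hv
      have hw' := mem_blk.1 hw
      rw [pow_zero, Nat.div_one] at hv' hw'
      subst hv' hw'
      exact h1 rfl
    · simp
  | succ h ih =>
    intro b ω hω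
    set f : ℕ → ℝ := fun v => if good h v then 1 - p / 2 else p / 2 with hf
    have hf0 : ∀ v, 0 ≤ f v := by
      intro v
      simp only [hf]
      split_ifs <;> linarith
    obtain ⟨S1, hS1, hc1, hw1⟩ := ih (2 * b) (fun v => ω v * f v) (fun v => mul_nonneg (hω v) (hf0 v))
    obtain ⟨S2, hS2, hc2, hw2⟩ := ih (2 * b + 1) (fun v => ω v * f v) (fun v => mul_nonneg (hω v) (hf0 v))
    have e1 : 2 * b * 2 ^ h = b * 2 ^ (h + 1) := by ring
    have e2 : (2 * b + 1 + 1) * 2 ^ h = (b + 1) * 2 ^ (h + 1) := by ring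
    have hle1 : b * 2 ^ (h + 1) ≤ (2 * b + 1) * 2 ^ h := by rw [← e1]; gcongr; omega
    have hle2 : (2 * b + 1) * 2 ^ h ≤ (b + 1) * 2 ^ (h + 1) := by rw [← e2]; gcongr; omega
    have hsum : ∑ v ∈ Ico (b * 2 ^ (h + 1)) ((b + 1) * 2 ^ (h + 1)), ω v * ∏ i ∈ range (h + 1), (if good i v then 1 - p / 2 else p / 2)
        ≤ ∑ v ∈ S1, ω v * f v + ∑ v ∈ S2, ω v * f v := by
      rw [← sum_Ico_consecutive _ hle1 hle2]
      refine add_le_add (le_trans (le_of_eq ?_) hw1) (le_trans (le_of_eq ?_) hw2)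
      · rw [e1]
        apply sum_congr rfl
        intro v _
        rw [prod_range_succ]; simp only [hf]; ring
      · rw [e2]
        apply sum_congr rfl
        intro v _
        rw [prod_range_succ]; simp only [hf]; ring
    have hI1 : ∀ v ∈ S1, v / 2 ^ h = 2 * b := fun v hv => mem_blk.1 (hS1 hv)
    have hI2 : ∀ v ∈ S2, v / 2 ^ h = 2 * b + 1 := fun v hv => mem_blk.1 (hS2 hv)
    have hdisj : Disjoint S1 S2 := by
      rw [disjoint_left]
      intro v h1 h2
      have := hI1 v h1
      have := hI2 v h2
      omega
    have hsub : S1 ∪ S2 ⊆ Ico (b * 2 ^ (h + 1)) ((b + 1) * 2 ^ (h + 1)) := by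
      intro v hv
      rw [mem_blk, pow_succ, ← Nat.div_div_eq_div_mul]
      rcases mem_union.1 hv with hv | hv
      · rw [hI1 v hv]; omega
      · rw [hI2 v hv]; omega
    set o1 : ℝ := ∑ v ∈ (S1 ∪ S2).filter (fun v => good h v), ω v with ho1
    have hf1 : ∑ v ∈ S1, ω v * f v + ∑ v ∈ S2, ω v * f v = (1 - p) * o1 + p / 2 * (∑ v ∈ S1, ω v + ∑ v ∈ S2, ω v) := by
      rw [← sum_union hdisj, ← sum_union hdisj, ho1, sum_filter, mul_sum, mul_sum, ← sum_add_distrib]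
      apply sum_congr rfl
      intro v _
      simp only [hf]
      split_ifs <;> ring
    by_cases hopt : ∑ v ∈ S1, ω v * f v + ∑ v ∈ S2, ω v * f v ≤ o1
    · refine ⟨(S1 ∪ S2).filter (fun v => good h v), (filter_subset _ _).trans hsub, ?_, hsum.trans hopt⟩
      intro v hv w hw i h1 h2
      obtain ⟨hv, hgv⟩ := mem_filter.1 hv
      obtain ⟨hw, hgw⟩ := mem_filter.1 hw
      by_cases hsame : v / 2 ^ h = w / 2 ^ h
      · rcases mem_union.1 hv with hv | hv <;> rcases mem_union.1 hw with hw | hw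
        · exact hc1 v hv w hw i h1 h2
        · have := hI1 v hv; have := hI2 w hw; omega
        · have := hI2 v hv; have := hI1 w hw; omega
        · exact hc2 v hv w hw i h1 h2
      · have hi1 : i < h + 1 := by
          by_contra hc
          push Not at hc
          refine h1 (div_eq_mono (i := h + 1) ?_ hc)
          rw [mem_blk.1 (hsub hv), mem_blk.1 (hsub hw)]
        have hi2 : h < i + 1 := by
          by_contra hc
          push Not at hc
          exact hsame (div_eq_mono h2 hc)
        have : i = h := by omega
        rw [this]; exact hgv
    · push Not at hopt
      by_cases h12 : ∑ v ∈ S1, ω v ≤ ∑ v ∈ S2, ω v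
      · refine ⟨S2, subset_union_right.trans hsub, hc2, hsum.trans ?_⟩
        exact opt_aux hp0 hp1 hf1 hopt h12
      · refine ⟨S1, subset_union_left.trans hsub, hc1, hsum.trans ?_⟩
        exact opt_aux hp0 hp1 (by rw [hf1]; ring) hopt (not_le.1 h12).le

/-- counting version -/
theorem tree_count (good : ℕ → ℕ → Prop) (p χ : ℝ) (hp0 : 0 < p) (hp1 : p ≤ 1) (hχ : 0 < χ) (hχ1 : χ ≤ 1 / 4) (L : ℕ) (hL : 1 ≤ L) (E : Finset ℕ)
    (hE : (#((range (2 ^ L)).filter (fun v => v ∉ E)) : ℝ) ≤ χ * 2 ^ L)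
    (hbad : (#((range (2 ^ L) ×ˢ range L).filter (fun x => ¬ good x.2 x.1)) : ℝ) ≤ χ * L * 2 ^ L) :
    ∃ S ⊆ range (2 ^ L), S ⊆ E ∧ 
      (∀ v ∈ S, ∀ w ∈ S, ∀ i, v / 2 ^ i ≠ w / 2 ^ i → v / 2 ^ (i + 1) = w / 2 ^ (i + 1) → good i v) ∧
      2 ^ L / 2 * ((1 - p / 2) ^ L * (p / 2) ^ (4 * χ * L)) ≤ (#S : ℝ) := by
  obtain ⟨S, hS, hc, hw⟩ := tree good p hp0 hp1 L 0 (fun v => if v ∈ E then 1 else 0) (fun v => by split_ifs <;> norm_num)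
  have eI : Ico (0 * 2 ^ L) ((0 + 1) * 2 ^ L) = range (2 ^ L) := by rw [zero_mul, zero_add, one_mul, range_eq_Ico]
  rw [eI] at hS hw
  refine ⟨S.filter (· ∈ E), (filter_subset _ _).trans hS, fun v hv => (mem_filter.1 hv).2, ?_, ?_⟩
  · intro v hv w hw
    exact hc v (mem_filter.1 hv).1 w (mem_filter.1 hw).1
  have e2 : ∑ v ∈ S, (if v ∈ E then (1:ℝ) else 0) = #(S.filter (· ∈ E)) := by
    rw [← sum_filter]; simp
  rw [e2] at hw
  refine le_trans ?_ hw
  have hL0 : (0:ℝ) < L := by exact_mod_cast hL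
  set bc : ℕ → ℕ := fun v => #((range L).filter (fun i => ¬ good i v)) with hbc
  have hbcs : (#((range (2 ^ L) ×ˢ range L).filter (fun x => ¬ good x.2 x.1)) : ℝ) = ∑ v ∈ range (2 ^ L), (bc v : ℝ) := by
    rw [card_eq_sum_ones, sum_filter, sum_product]
    simp only [hbc]
    push_cast
    apply sum_congr rfl
    intro v _
    rw [card_eq_sum_ones, sum_filter]; push_cast; rfl
  have hmk : (#((range (2 ^ L)).filter (fun v => 4 * χ * L < bc v)) : ℝ) ≤ 2 ^ L / 4 := by
    have h1 : (#((range (2 ^ L)).filter (fun v => 4 * χ * L < bc v)) : ℝ) * (4 * χ * L) ≤ ∑ v ∈ range (2 ^ L), (bc v : ℝ) := by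
      rw [← nsmul_eq_mul]
      refine (card_nsmul_le_sum _ (fun v => (bc v : ℝ)) _ ?_).trans (sum_le_sum_of_subset_of_nonneg (filter_subset _ _) (fun _ _ _ => Nat.cast_nonneg _))
      intro v hv
      exact (mem_filter.1 hv).2.le
    rw [← hbcs] at h1
    have h2 := h1.trans hbad
    have h3 : (0:ℝ) < χ * L := by positivity
    have h4 : (#((range (2 ^ L)).filter (fun v => 4 * χ * L < bc v)) : ℝ) * 4 * (χ * L) ≤ 2 ^ L * (χ * L) := by linarith
    have := le_of_mul_le_mul_right h4 h3
    linarith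
  set T := (range (2 ^ L)).filter (fun v => v ∈ E ∧ (bc v : ℝ) ≤ 4 * χ * L) with hT
  have hTc : (2:ℝ) ^ L / 2 ≤ #T := by
    have h1 : 2 ^ L ≤ #T + (#((range (2 ^ L)).filter (fun v => v ∉ E)) + #((range (2 ^ L)).filter (fun v => 4 * χ * L < bc v))) := by
      calc 2 ^ L = #(range (2 ^ L)) := (card_range _).symm
        _ ≤ #(T ∪ (((range (2 ^ L)).filter (fun v => v ∉ E)) ∪ ((range (2 ^ L)).filter (fun v => 4 * χ * L < bc v)))) := by
            apply card_le_card
            intro v hv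
            simp only [mem_union, hT, mem_filter, hv, true_and]
            by_cases h : v ∈ E <;> by_cases h' : (bc v : ℝ) ≤ 4 * χ * L
            · exact Or.inl ⟨h, h'⟩
            · exact Or.inr (Or.inr (not_le.1 h'))
            · exact Or.inr (Or.inl h)
            · exact Or.inr (Or.inl h)
        _ ≤ _ := (card_union_le _ _).trans (Nat.add_le_add_left (card_union_le _ _) _)
    have h2 := (Nat.cast_le (α := ℝ)).2 h1
    push_cast at h2
    have h3 : (0:ℝ) < 2 ^ L := by positivity
    have h4 : χ * 2 ^ L ≤ 1 / 4 * 2 ^ L := by gcongr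
    linarith
  have hpw : 0 ≤ (1 - p / 2) ^ L * (p / 2) ^ (4 * χ * L) := by
    have : 0 ≤ 1 - p / 2 := by linarith
    positivity
  calc 2 ^ L / 2 * ((1 - p / 2) ^ L * (p / 2) ^ (4 * χ * L)) ≤ #T * ((1 - p / 2) ^ L * (p / 2) ^ (4 * χ * L)) := by gcongr
    _ ≤ ∑ v ∈ T, (if v ∈ E then (1:ℝ) else 0) * ∏ i ∈ range L, (if good i v then 1 - p / 2 else p / 2) := by
        rw [← nsmul_eq_mul]
        apply card_nsmul_le_sum
        intro v hv
        simp only [hT, mem_filter] at hv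
        rw [if_pos hv.2.1, one_mul, prod_ite, prod_const, prod_const]
        apply mul_le_mul
        · apply pow_le_pow_of_le_one (by linarith) (by linarith)
          exact (card_filter_le _ _).trans (by rw [card_range])
        · rw [← Real.rpow_natCast]
          apply Real.rpow_le_rpow_of_exponent_ge (by linarith) (by linarith)
          exact hv.2.2
        · positivity
        · have : 0 ≤ 1 - p / 2 := by linarith
          positivity
    _ ≤ _ := by
        apply sum_le_sum_of_subset_of_nonneg (filter_subset _ _)
        intro v _ _
        apply mul_nonneg
        · split_ifs <;> norm_num
        · apply prod_nonneg
          intro i _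
          split_ifs <;> linarith

theorem exists_split {v w L : ℕ} (hv : v < 2 ^ L) (hw : w < 2 ^ L) (h : v < w) : 
    ∃ i < L, v / 2 ^ i ≠ w / 2 ^ i ∧ v / 2 ^ (i + 1) = w / 2 ^ (i + 1) ∧ (v / 2 ^ i) % 2 = 0 ∧ (w / 2 ^ i) % 2 = 1 := by
  have hex : ∃ j, v / 2 ^ j = w / 2 ^ j := ⟨L, by rw [Nat.div_eq_of_lt hv, Nat.div_eq_of_lt hw]⟩
  have h0 : Nat.find hex ≠ 0 := by
    intro h0
    have := Nat.find_spec hex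
    rw [h0] at this
    simp at this; omega
  obtain ⟨i, hi⟩ := Nat.exists_eq_succ_of_ne_zero h0
  have h1 : v / 2 ^ i ≠ w / 2 ^ i := Nat.find_min hex (by omega)
  have h2 : v / 2 ^ (i + 1) = w / 2 ^ (i + 1) := by
    have := Nat.find_spec hex
    rwa [hi] at this
  have hle : v / 2 ^ i ≤ w / 2 ^ i := Nat.div_le_div_right h.le
  have h3 := h2
  rw [pow_succ, ← Nat.div_div_eq_div_mul, ← Nat.div_div_eq_div_mul] at h3
  refine ⟨i, ?_, h1, h2, by omega, by omega⟩
  by_contra hc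
  push Not at hc
  apply h1
  rw [Nat.div_eq_of_lt (hv.trans_le (Nat.pow_le_pow_right (by norm_num) hc)), Nat.div_eq_of_lt (hw.trans_le (Nat.pow_le_pow_right (by norm_num) hc))]
end

section
open Finset Classical

/-- unconditional hub property, arbitrary port type -/
def HubT (γ κ : ℝ) (α : Type) [Fintype α] (H : Net) (src snk : α → H.V) : Prop :=
  ∀ D : Finset H.V, ∃ A B : Finset α, (#Aᶜ : ℝ) ≤ γ * Fintype.card α + #D / κ ∧ (#Bᶜ : ℝ) ≤ γ * Fintype.card α + #D / κ ∧
    ∀ x ∈ A, ∀ y ∈ B, H.Rch D 0 (src x) (snk y)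

theorem hubT (γ : ℝ) (hγ : 0 < γ) : ∃ κ : ℝ, 0 < κ ∧ ∃ C : ℕ, 1 ≤ C ∧ ∀ (α : Type) [Fintype α] [Nonempty α],
    ∃ (H : Net) (src snk : α → H.V), Fintype.card H.V ≤ C * Fintype.card α ∧ Fintype.card H.E ≤ C * Fintype.card α ∧ 
      HubT γ κ α H src snk := by
  obtain ⟨κ, hκ, C, hC, h⟩ := hub γ hγ
  refine ⟨κ, hκ, C, hC, ?_⟩
  intro α _ _
  obtain ⟨H, src, snk, hV, hE, hH⟩ := h (Fintype.card α) Fintype.card_pos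
  have e := Fintype.equivFin α
  refine ⟨H, src ∘ e, snk ∘ e, hV, hE, ?_⟩
  intro D
  by_cases hD : (#D : ℝ) ≤ κ * Fintype.card α
  · obtain ⟨A, B, hA, hB, hAB⟩ := hH D hD
    have h0 : (0:ℝ) ≤ #D / κ := by positivity
    have key : ∀ A : Finset (Fin (Fintype.card α)), #(univ.filter (fun x => e x ∈ A))ᶜ ≤ #Aᶜ := by
      intro A
      apply card_le_card_of_injOn e _ e.injective.injOn
      intro i hi
      simpa using hi
    refine ⟨univ.filter (fun x => e x ∈ A), univ.filter (fun x => e x ∈ B), ?_, ?_, ?_⟩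
    · have := (Nat.cast_le (α := ℝ)).2 (key A)
      linarith
    · have := (Nat.cast_le (α := ℝ)).2 (key B)
      linarith
    · intro x hx y hy
      exact hAB _ (mem_filter.1 hx).2 _ (mem_filter.1 hy).2
  · push Not at hD
    have h1 : (Fintype.card α : ℝ) ≤ #D / κ := by
      rw [le_div_iff₀ hκ]; linarith
    have h2 : 0 ≤ γ * Fintype.card α := by positivity
    refine ⟨∅, ∅, ?_, ?_, fun x hx => absurd hx (notMem_empty _)⟩
    all_goals
      rw [compl_empty, card_univ]; linarith

theorem chain_path (G : Net) (D : Finset G.V) (Sk : ℕ → Set G.V) (x : G.V) (S : Finset ℕ) 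
    (hstep : ∀ v ∈ S, ∀ w ∈ S, v < w → ∀ j, (∀ z ∈ Sk v, G.Rch D j x z) → ∀ z ∈ Sk w, G.Rch D (j + 1) x z)
    (h0 : ∀ v ∈ S, ∀ z ∈ Sk v, G.Rch D 1 x z) (hne : S.Nonempty) : ∃ v ∈ S, ∀ z ∈ Sk v, G.Rch D #S x z := by
  induction S using Finset.induction_on_max with
  | empty => exact absurd hne not_nonempty_empty
  | insert a s ha ih =>
    by_cases hs : s.Nonempty
    · obtain ⟨v, hv, hr⟩ := ih (fun v hv w hw => hstep v (mem_insert_of_mem hv) w (mem_insert_of_mem hw)) (fun v hv => h0 v (mem_insert_of_mem hv)) hs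
      refine ⟨a, mem_insert_self _ _, ?_⟩
      rw [card_insert_of_notMem (fun h => lt_irrefl _ (ha a h))]
      exact hstep v (mem_insert_of_mem hv) a (mem_insert_self _ _) (ha v hv) _ hr
    · rw [not_nonempty_iff_eq_empty] at hs
      subst hs
      exact ⟨a, mem_insert_self _ _, by simpa using h0 a (mem_insert_self _ _)⟩

abbrev Prt (L s : ℕ) := Fin L × Fin s
abbrev LfI (L : ℕ) := Fin (2 ^ L)
abbrev CnI (L : ℕ) := (h : Fin L) × Fin (2 ^ (L - h.1))
abbrev DpI (L : ℕ) := LfI L ⊕ (CnI L ⊕ Bool)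

def bkI {L : ℕ} (v : LfI L) (h : Fin L) : Fin (2 ^ (L - h.1)) := ⟨v.1 / 2 ^ (h.1 + 1), by
  have h1 : v.1 / 2 ^ (h.1 + 1) ≤ v.1 / 2 ^ h.1 := Nat.div_le_div_left (Nat.pow_le_pow_right (by norm_num) (by omega)) (by positivity)
  refine h1.trans_lt ?_
  rw [Nat.div_lt_iff_lt_mul (by positivity), ← pow_add]
  convert v.2 using 2
  omega⟩
def low {L : ℕ} (v : LfI L) (h : Fin L) : Fin (2 ^ h.1) := ⟨v.1 % 2 ^ h.1, Nat.mod_lt _ (by positivity)⟩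

theorem bkI_low_inj {L : ℕ} {v w : LfI L} {h : Fin L} (h1 : bkI v h = bkI w h) (h2 : low v h = low w h) 
    (h3 : (v.1 / 2 ^ h.1) % 2 = (w.1 / 2 ^ h.1) % 2) : v = w := by
  have h1 := Fin.mk.inj h1
  have h2 := Fin.mk.inj h2
  rw [pow_succ, ← Nat.div_div_eq_div_mul, ← Nat.div_div_eq_div_mul] at h1
  have h4 : v.1 / 2 ^ h.1 = w.1 / 2 ^ h.1 := by omega
  apply Fin.ext
  rw [← Nat.div_add_mod v.1 (2 ^ h.1), ← Nat.div_add_mod w.1 (2 ^ h.1), h4, h2]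

section
variable {L s : ℕ} {H1 F : Net} {Hc : Fin L → Net} 

noncomputable abbrev dpN (H1 F : Net) (Hc : Fin L → Net) : DpI L → Net := Sum.elim (fun _ => H1) (Sum.elim (fun c => Hc c.1) (fun _ => F))

abbrev DpV (H1 F : Net) (Hc : Fin L → Net) := (i : DpI L) × (dpN H1 F Hc i).V

abbrev lf (v : LfI L) (x : H1.V) : DpV H1 F Hc := ⟨.inl v, x⟩
abbrev cn (h : Fin L) (b : Fin (2 ^ (L - h.1))) (x : (Hc h).V) : DpV H1 F Hc := ⟨.inr (.inl ⟨h, b⟩), x⟩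
abbrev fb (b : Bool) (x : F.V) : DpV H1 F Hc := ⟨.inr (.inr b), x⟩

abbrev EvE (L s : ℕ) := {x : LfI L × Prt L s // (x.1.1 / 2 ^ x.2.1.1) % 2 = 0}
abbrev OdE (L s : ℕ) := {x : LfI L × Prt L s // (x.1.1 / 2 ^ x.2.1.1) % 2 = 1}
abbrev DpX (L s : ℕ) := (EvE L s ⊕ OdE L s) ⊕ ((LfI L × Prt L s) ⊕ (LfI L × Prt L s))

def dpLev : DpI L → ℕ := Sum.elim (fun v => 2 * v.1 + 1) (Sum.elim (fun c => 2 * ((2 * c.2.1 + 1) * 2 ^ c.1.1)) (fun b => if b then 2 * 2 ^ L + 1 else 0))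

variable (src1 snk1 : Prt L s ⊕ Prt L s → H1.V) (srcc snkc : (h : Fin L) → Fin (2 ^ h.1) × Fin s → (Hc h).V) (srcF snkF : LfI L × Prt L s → F.V)

abbrev dpTl : DpX L s → DpV H1 F Hc := Sum.elim 
  (Sum.elim (fun x => lf x.1.1 (snk1 (.inl x.1.2))) (fun x => cn x.1.2.1 (bkI x.1.1 x.1.2.1) (snkc x.1.2.1 (low x.1.1 x.1.2.1, x.1.2.2))))
  (Sum.elim (fun x => fb false (snkF x)) (fun x => lf x.1 (snk1 (.inr x.2))))
abbrev dpHd : DpX L s → DpV H1 F Hc := Sum.elim 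
  (Sum.elim (fun x => cn x.1.2.1 (bkI x.1.1 x.1.2.1) (srcc x.1.2.1 (low x.1.1 x.1.2.1, x.1.2.2))) (fun x => lf x.1.1 (src1 (.inl x.1.2))))
  (Sum.elim (fun x => lf x.1 (src1 (.inr x.2))) (fun x => fb true (srcF x)))

theorem even_lt {v h : ℕ} (he : (v / 2 ^ h) % 2 = 0) : v < (2 * (v / 2 ^ (h + 1)) + 1) * 2 ^ h := by
  rw [pow_succ, ← Nat.div_div_eq_div_mul]
  have h1 : 2 * (v / 2 ^ h / 2) = v / 2 ^ h := by omega
  rw [h1]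
  have := Nat.lt_mul_div_succ v (b := 2 ^ h) (by positivity)
  rwa [mul_comm] at this
theorem odd_le {v h : ℕ} (he : (v / 2 ^ h) % 2 = 1) : (2 * (v / 2 ^ (h + 1)) + 1) * 2 ^ h ≤ v := by
  rw [pow_succ, ← Nat.div_div_eq_div_mul]
  have h1 : 2 * (v / 2 ^ h / 2) + 1 = v / 2 ^ h := by omega
  rw [h1]
  exact Nat.div_mul_le_self _ _

theorem dp_lt (x : DpX L s) : dpLev (dpTl (F := F) (Hc := Hc) snk1 snkc snkF x).1 < dpLev (dpHd (F := F) (Hc := Hc) src1 srcc srcF x).1 := by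
  rcases x with (x | x) | (x | x)
  · have := even_lt x.2
    simp only [dpLev, Sum.elim_inl, Sum.elim_inr, bkI]
    omega
  · have := odd_le x.2
    simp only [dpLev, Sum.elim_inl, Sum.elim_inr, bkI]
    omega
  · simp [dpLev]
  · have := x.1.2
    simp [dpLev]

noncomputable abbrev DpNet : Net := Glue (dpN H1 F Hc) dpLev (DpX L s) (dpTl snk1 snkc snkF) (dpHd src1 srcc srcF) (dp_lt src1 snk1 srcc snkc srcF snkF)

variable {src1 snk1 srcc snkc srcF snkF} {D : Finset (DpV H1 F Hc)}

theorem dp_lf {v : LfI L} {l : ℕ} {x y : H1.V} (h : H1.Rch (sres D (.inl v)) l x y) : 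
    (DpNet src1 snk1 srcc snkc srcF snkF).Rch D l (lf v x) (lf v y) := Glue.lift h
theorem dp_cn {i : Fin L} {b : Fin (2 ^ (L - i.1))} {l : ℕ} {x y : (Hc i).V} (h : (Hc i).Rch (sres D (.inr (.inl ⟨i, b⟩))) l x y) : 
    (DpNet src1 snk1 srcc snkc srcF snkF).Rch D l (cn i b x) (cn i b y) := Glue.lift h
theorem dp_fb {b : Bool} {l : ℕ} {x y : F.V} (h : F.Rch (sres D (.inr (.inr b))) l x y) : 
    (DpNet src1 snk1 srcc snkc srcF snkF).Rch D l (fb b x) (fb b y) := Glue.lift h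

theorem dp_ev {v : LfI L} {i : Fin L} {k : Fin s} (he : (v.1 / 2 ^ i.1) % 2 = 0) 
    (h1 : lf v (snk1 (.inl (i, k))) ∉ D) (h2 : cn i (bkI v i) (srcc i (low v i, k)) ∉ D) : 
    (DpNet src1 snk1 srcc snkc srcF snkF).Rch D 1 (lf v (snk1 (.inl (i, k)))) (cn i (bkI v i) (srcc i (low v i, k))) := 
  Glue.cross (N := dpN H1 F Hc) (hl := dp_lt src1 snk1 srcc snkc srcF snkF) (.inl (.inl ⟨(v, i, k), he⟩)) h1 h2
theorem dp_od {v : LfI L} {i : Fin L} {k : Fin s} (he : (v.1 / 2 ^ i.1) % 2 = 1) 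
    (h1 : cn i (bkI v i) (snkc i (low v i, k)) ∉ D) (h2 : lf v (src1 (.inl (i, k))) ∉ D) : 
    (DpNet src1 snk1 srcc snkc srcF snkF).Rch D 1 (cn i (bkI v i) (snkc i (low v i, k))) (lf v (src1 (.inl (i, k)))) := 
  Glue.cross (N := dpN H1 F Hc) (hl := dp_lt src1 snk1 srcc snkc srcF snkF) (.inl (.inr ⟨(v, i, k), he⟩)) h1 h2
theorem dp_fr {v : LfI L} {k : Prt L s} 
    (h1 : fb false (snkF (v, k)) ∉ D) (h2 : lf v (src1 (.inr k)) ∉ D) : 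
    (DpNet src1 snk1 srcc snkc srcF snkF).Rch D 1 (fb false (snkF (v, k))) (lf v (src1 (.inr k))) := 
  Glue.cross (N := dpN H1 F Hc) (hl := dp_lt src1 snk1 srcc snkc srcF snkF) (.inr (.inl (v, k))) h1 h2
theorem dp_bk {v : LfI L} {k : Prt L s} 
    (h1 : lf v (snk1 (.inr k)) ∉ D) (h2 : fb true (srcF (v, k)) ∉ D) : 
    (DpNet src1 snk1 srcc snkc srcF snkF).Rch D 1 (lf v (snk1 (.inr k))) (fb true (srcF (v, k))) := 
  Glue.cross (N := dpN H1 F Hc) (hl := dp_lt src1 snk1 srcc snkc srcF snkF) (.inr (.inr (v, k))) h1 h2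

theorem dp_cardV (C : ℕ) (h1 : Fintype.card H1.V ≤ C * Fintype.card (Prt L s ⊕ Prt L s)) (h2 : ∀ h, Fintype.card (Hc h).V ≤ C * Fintype.card (Fin (2 ^ h.1) × Fin s))
    (h3 : Fintype.card F.V ≤ C * Fintype.card (LfI L × Prt L s)) : 
    Fintype.card (DpNet src1 snk1 srcc snkc srcF snkF).V ≤ 5 * C * Fintype.card (LfI L × Prt L s) := by
  rw [Glue.cardV, Fintype.sum_sum_type, Fintype.sum_sum_type]
  change ∑ _ : LfI L, Fintype.card H1.V + (∑ c : CnI L, Fintype.card (Hc c.1).V + ∑ _ : Bool, Fintype.card F.V) ≤ _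
  have a1 : ∑ _ : LfI L, Fintype.card H1.V ≤ ∑ _ : LfI L, C * (2 * (L * s)) := by
    apply sum_le_sum; intro _ _
    refine h1.trans (le_of_eq ?_)
    simp only [Fintype.card_sum, Fintype.card_prod, Fintype.card_fin]; ring
  have a2 : ∑ c : CnI L, Fintype.card (Hc c.1).V ≤ ∑ c : CnI L, C * (2 ^ c.1.1 * s) := by
    apply sum_le_sum; intro c _
    refine (h2 c.1).trans (le_of_eq ?_)
    simp only [Fintype.card_prod, Fintype.card_fin]
  have a3 : ∑ _ : Bool, Fintype.card F.V ≤ ∑ _ : Bool, C * (2 ^ L * (L * s)) := by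
    apply sum_le_sum; intro _ _
    refine h3.trans (le_of_eq ?_)
    simp only [Fintype.card_prod, Fintype.card_fin]
  have a4 : ∑ c : CnI L, C * (2 ^ c.1.1 * s) = C * (2 ^ L * (L * s)) := by
    rw [Fintype.sum_sigma]
    have : ∀ h : Fin L, ∑ _ : Fin (2 ^ (L - h.1)), C * (2 ^ h.1 * s) = C * (2 ^ L * s) := by
      intro h
      rw [sum_const, card_univ, Fintype.card_fin, smul_eq_mul]
      have e : 2 ^ L = 2 ^ (L - h.1) * 2 ^ h.1 := by rw [← pow_add]; congr 1; omega
      rw [e]; ring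
    simp only [this]
    rw [sum_const, card_univ, Fintype.card_fin, smul_eq_mul]; ring
  rw [a4] at a2
  simp only [sum_const, card_univ, Fintype.card_fin, Fintype.card_bool, smul_eq_mul] at a1 a3
  simp only [Fintype.card_prod, Fintype.card_fin]
  simp only [sum_const, card_univ, Fintype.card_fin, Fintype.card_bool, smul_eq_mul]
  nlinarith

theorem dp_cardE (C : ℕ) (h1 : Fintype.card H1.E ≤ C * Fintype.card (Prt L s ⊕ Prt L s)) (h2 : ∀ h, Fintype.card (Hc h).E ≤ C * Fintype.card (Fin (2 ^ h.1) × Fin s))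
    (h3 : Fintype.card F.E ≤ C * Fintype.card (LfI L × Prt L s)) : 
    Fintype.card (DpNet src1 snk1 srcc snkc srcF snkF).E ≤ (5 * C + 4) * Fintype.card (LfI L × Prt L s) := by
  rw [Glue.cardE, Fintype.sum_sum_type, Fintype.sum_sum_type]
  change ∑ _ : LfI L, Fintype.card H1.E + (∑ c : CnI L, Fintype.card (Hc c.1).E + ∑ _ : Bool, Fintype.card F.E) + _ ≤ _
  have hX : Fintype.card (DpX L s) ≤ 4 * Fintype.card (LfI L × Prt L s) := by
    rw [Fintype.card_sum, Fintype.card_sum, Fintype.card_sum]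
    have : Fintype.card (EvE L s) ≤ Fintype.card (LfI L × Prt L s) := Fintype.card_le_of_injective _ Subtype.val_injective
    have : Fintype.card (OdE L s) ≤ Fintype.card (LfI L × Prt L s) := Fintype.card_le_of_injective _ Subtype.val_injective
    omega
  have a1 : ∑ _ : LfI L, Fintype.card H1.E ≤ ∑ _ : LfI L, C * (2 * (L * s)) := by
    apply sum_le_sum; intro _ _
    refine h1.trans (le_of_eq ?_)
    simp only [Fintype.card_sum, Fintype.card_prod, Fintype.card_fin]; ring
  have a2 : ∑ c : CnI L, Fintype.card (Hc c.1).E ≤ ∑ c : CnI L, C * (2 ^ c.1.1 * s) := by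
    apply sum_le_sum; intro c _
    refine (h2 c.1).trans (le_of_eq ?_)
    simp only [Fintype.card_prod, Fintype.card_fin]
  have a3 : ∑ _ : Bool, Fintype.card F.E ≤ ∑ _ : Bool, C * (2 ^ L * (L * s)) := by
    apply sum_le_sum; intro _ _
    refine h3.trans (le_of_eq ?_)
    simp only [Fintype.card_prod, Fintype.card_fin]
  have a4 : ∑ c : CnI L, C * (2 ^ c.1.1 * s) = C * (2 ^ L * (L * s)) := by
    rw [Fintype.sum_sigma]
    have : ∀ h : Fin L, ∑ _ : Fin (2 ^ (L - h.1)), C * (2 ^ h.1 * s) = C * (2 ^ L * s) := by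
      intro h
      rw [sum_const, card_univ, Fintype.card_fin, smul_eq_mul]
      have e : 2 ^ L = 2 ^ (L - h.1) * 2 ^ h.1 := by rw [← pow_add]; congr 1; omega
      rw [e]; ring
    simp only [this]
    rw [sum_const, card_univ, Fintype.card_fin, smul_eq_mul]; ring
  rw [a4] at a2
  have hN : Fintype.card (LfI L × Prt L s) = 2 ^ L * (L * s) := by simp only [Fintype.card_prod, Fintype.card_fin]
  rw [hN] at hX ⊢
  simp only [sum_const, card_univ, Fintype.card_fin, Fintype.card_bool, smul_eq_mul] at a1 a3
  simp only [sum_const, card_univ, Fintype.card_fin, Fintype.card_bool, smul_eq_mul]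
  nlinarith
end
end

section
open Finset Classical

theorem cnt1 {α P Q : Type} [Fintype α] [Fintype P] [Fintype Q] (g : P → Q) (hg : Function.Injective g) (A : α → Finset Q) :
    #{x : α × P | g x.2 ∉ A x.1} ≤ ∑ v, #(A v)ᶜ := by
  rw [← card_sigma]
  apply card_le_card_of_injOn (fun x => (⟨x.1, g x.2⟩ : (_ : α) × Q))
  · intro x hx
    simpa using hx
  · intro x _ y _ h
    simp only [Sigma.mk.injEq, heq_eq_eq] at h
    exact Prod.ext h.1 (hg h.2)

theorem cnt2 {L s : ℕ} (r : ℕ) (A : (c : CnI L) → Finset (Fin (2 ^ c.1.1) × Fin s)) :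
    #{x : LfI L × Prt L s | (x.1.1 / 2 ^ x.2.1.1) % 2 = r ∧ (low x.1 x.2.1, x.2.2) ∉ A ⟨x.2.1, bkI x.1 x.2.1⟩} ≤ ∑ c, #(A c)ᶜ := by
  rw [← card_sigma]
  apply card_le_card_of_injOn (fun x => (⟨⟨x.2.1, bkI x.1 x.2.1⟩, (low x.1 x.2.1, x.2.2)⟩ : (c : CnI L) × (Fin (2 ^ c.1.1) × Fin s)))
  · intro x hx
    have := (mem_filter.1 hx).2.2
    simpa using this
  · rintro ⟨v, h, k⟩ hx ⟨v', h', k'⟩ hy e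
    have hx := (mem_filter.1 hx).2.1
    have hy := (mem_filter.1 hy).2.1
    simp only [Sigma.mk.injEq] at e
    obtain ⟨⟨rfl, e1⟩, e2⟩ := e
    simp only [heq_eq_eq, Prod.mk.injEq] at e1 e2
    obtain ⟨e2, rfl⟩ := e2
    rw [bkI_low_inj e1 e2 (by simp only at hx hy; rw [hx, hy])]

theorem sum_part {ι κ : Type} [Fintype ι] [Fintype κ] {V : ι → Type} (D : Finset ((i : ι) × V i)) (g : κ → ι) (hg : Function.Injective g) : 
    ∑ k, #(sres D (g k)) ≤ #D := by
  rw [← sum_sres D]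
  calc ∑ k, #(sres D (g k)) = ∑ i ∈ univ.map ⟨g, hg⟩, #(sres D i) := by rw [sum_map]; rfl
    _ ≤ _ := sum_le_sum_of_subset (subset_univ _)

theorem sumC (L s : ℕ) (c : ℝ) : ∑ i : CnI L, c * (Fintype.card (Fin (2 ^ i.1.1) × Fin s) : ℝ) = c * (2 ^ L * (L * s)) := by
  rw [Fintype.sum_sigma]
  have : ∀ h : Fin L, ∑ _ : Fin (2 ^ (L - h.1)), c * (Fintype.card (Fin (2 ^ h.1) × Fin s) : ℝ) = c * (2 ^ L * s) := by
    intro h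
    rw [sum_const, card_univ, Fintype.card_fin, nsmul_eq_mul]
    have e : (2:ℝ) ^ L = 2 ^ (L - h.1) * 2 ^ h.1 := by rw [← pow_add]; congr 1; omega
    simp only [Fintype.card_prod, Fintype.card_fin]
    push_cast
    rw [e]; ring
  simp only [this]
  rw [sum_const, card_univ, Fintype.card_fin, nsmul_eq_mul]; ring

set_option maxHeartbeats 4000000 in
theorem deep_net (χ : ℝ) (hχ : 0 < χ) (hχ1 : χ ≤ 1 / 4) : ∃ κ : ℝ, 0 < κ ∧ ∃ C : ℕ, 1 ≤ C ∧ ∀ L s : ℕ, 1 ≤ L → 1 ≤ s → 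
    ∃ (G : Net) (src snk : LfI L × Prt L s → G.V), Fintype.card G.V ≤ C * (2 ^ L * (L * s)) ∧ Fintype.card G.E ≤ C * (2 ^ L * (L * s)) ∧ 
    ∀ D : Finset G.V, (#D : ℝ) ≤ κ * (2 ^ L * (L * s)) → ∃ A B : Finset (LfI L × Prt L s), (#Aᶜ : ℝ) ≤ χ * (2 ^ L * (L * s)) ∧ (#Bᶜ : ℝ) ≤ χ * (2 ^ L * (L * s)) ∧
      ∀ p : ℝ, 0 < p → p ≤ 1 → ∀ d : ℕ, (d : ℝ) ≤ 2 ^ L / 2 * ((1 - p / 2) ^ L * (p / 2) ^ (4 * χ * L)) → ∀ x ∈ A, ∀ y ∈ B, G.Rch D d (src x) (snk y) := by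
  obtain ⟨κ, hκ, C, hC, hH⟩ := hubT (χ / 12) (by positivity)
  refine ⟨κ * χ / 8, by positivity, 5 * C + 4, by omega, ?_⟩
  intro L s hL hs
  have : Nonempty (Fin L) := ⟨⟨0, by omega⟩⟩
  have : Nonempty (Fin s) := ⟨⟨0, by omega⟩⟩
  have : ∀ h : ℕ, Nonempty (Fin (2 ^ h)) := fun h => ⟨⟨0, by positivity⟩⟩
  obtain ⟨H1, src1, snk1, hV1, hE1, h1⟩ := hH (Prt L s ⊕ Prt L s)
  have hc0 : ∀ h : Fin L, _ := fun h => hH (Fin (2 ^ h.1) × Fin s)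
  choose Hc srcc snkc hVc hEc hc using hc0
  obtain ⟨F, srcF, snkF, hVF, hEF, hF⟩ := hH (LfI L × Prt L s)
  have hcard : Fintype.card (LfI L × Prt L s) = 2 ^ L * (L * s) := by simp only [Fintype.card_prod, Fintype.card_fin]
  have hcard1 : Fintype.card (Prt L s ⊕ Prt L s) = 2 * (L * s) := by simp only [Fintype.card_prod, Fintype.card_sum, Fintype.card_fin]; ring
  have hL0 : (0:ℝ) < L := by exact_mod_cast hL
  have hs0 : (0:ℝ) < s := by exact_mod_cast hs
  refine ⟨DpNet src1 snk1 srcc snkc srcF snkF, fun x => fb false (srcF x), fun x => fb true (snkF x), ?_, ?_, ?_⟩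
  · have := dp_cardV (src1 := src1) (snk1 := snk1) (srcc := srcc) (snkc := snkc) (srcF := srcF) (snkF := snkF) C hV1 hVc hVF
    rw [hcard] at this
    refine this.trans ?_
    gcongr; omega
  · have := dp_cardE (src1 := src1) (snk1 := snk1) (srcc := srcc) (snkc := snkc) (srcF := srcF) (snkF := snkF) C hE1 hEc hEF
    rwa [hcard] at this
  intro D hD
  set D' : Finset (DpV H1 F Hc) := D with hD'
  set M : ℝ := 2 ^ L * (L * s) with hM
  have hM0 : 0 < M := by positivity
  choose A1 B1 hA1 hB1 hAB1 using fun v : LfI L => h1 (sres D' (.inl v))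
  choose Ac Bc hAc hBc hABc using fun c : CnI L => hc c.1 (sres D' (.inr (.inl c)))
  choose AF BF hAF hBF hABF using fun b : Bool => hF (sres D' (.inr (.inr b)))
  have hDk : (#D' : ℝ) / κ ≤ χ / 8 * M := by
    rw [div_le_iff₀ hκ]
    refine hD.trans (le_of_eq ?_); ring
  have hresb : ∀ i, #(sres D' i) ≤ #D' := fun i => by
    rw [← sum_sres D']
    exact single_le_sum (f := fun i => #(sres D' i)) (fun _ _ => Nat.zero_le _) (mem_univ i)
  -- sums
  have sum1 : ∀ Z : LfI L → Finset (Prt L s ⊕ Prt L s), (∀ v, (#(Z v)ᶜ : ℝ) ≤ χ / 12 * (Fintype.card (Prt L s ⊕ Prt L s)) + #(sres D' (.inl v)) / κ) → 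
      ∑ v, (#(Z v)ᶜ : ℝ) ≤ 7 / 24 * χ * M := by
    intro Z hZ
    calc ∑ v, (#(Z v)ᶜ : ℝ) ≤ ∑ v : LfI L, (χ / 12 * (Fintype.card (Prt L s ⊕ Prt L s)) + #(sres D' (.inl v)) / κ) := sum_le_sum fun v _ => hZ v
      _ = χ / 6 * M + (∑ v : LfI L, #(sres D' (.inl v)) : ℕ) / κ := by
          rw [sum_add_distrib, sum_const, card_univ, Fintype.card_fin, ← sum_div, hcard1, nsmul_eq_mul, hM]
          push_cast; ring
      _ ≤ χ / 6 * M + #D' / κ := by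
          gcongr
          exact sum_part D' _ Sum.inl_injective
      _ ≤ _ := by linarith
  have sum2 : ∀ Z : (c : CnI L) → Finset (Fin (2 ^ c.1.1) × Fin s), (∀ c, (#(Z c)ᶜ : ℝ) ≤ χ / 12 * (Fintype.card (Fin (2 ^ c.1.1) × Fin s)) + #(sres D' (.inr (.inl c))) / κ) → 
      ∑ v, (#(Z v)ᶜ : ℝ) ≤ 5 / 24 * χ * M := by
    intro Z hZ
    calc ∑ v, (#(Z v)ᶜ : ℝ) ≤ ∑ c : CnI L, (χ / 12 * (Fintype.card (Fin (2 ^ c.1.1) × Fin s)) + #(sres D' (.inr (.inl c))) / κ) := sum_le_sum fun v _ => hZ v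
      _ = χ / 12 * M + (∑ c : CnI L, #(sres D' (.inr (.inl c))) : ℕ) / κ := by
          rw [sum_add_distrib, sumC, ← sum_div, hM]
          push_cast; ring
      _ ≤ χ / 12 * M + #D' / κ := by
          gcongr
          exact sum_part D' (fun c => .inr (.inl c)) (Sum.inr_injective.comp Sum.inl_injective)
      _ ≤ _ := by linarith
  have sum3 : ∀ (b : Bool) (Z : Finset (LfI L × Prt L s)), ((#Zᶜ : ℝ) ≤ χ / 12 * (Fintype.card (LfI L × Prt L s)) + #(sres D' (.inr (.inr b))) / κ) → (#Zᶜ : ℝ) ≤ 5 / 24 * χ * M := by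
    intro b Z hZ
    have e1 : (Fintype.card (LfI L × Prt L s) : ℝ) = M := by rw [hcard, hM]; push_cast; rfl
    rw [e1] at hZ
    have : (#(sres D' (.inr (.inr b))) : ℝ) / κ ≤ #D' / κ := by
      gcongr; exact hresb _
    linarith
  have hAF' := sum3 false (AF false) (by first | exact hAF false | (convert hAF false <;> rfl))
  have hBF' := sum3 false (BF false) (by first | exact hBF false | (convert hBF false <;> rfl))
  have hAF2 := sum3 true (AF true) (by first | exact hAF true | (convert hAF true <;> rfl))
  have hBF2 := sum3 true (BF true) (by first | exact hBF true | (convert hBF true <;> rfl))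
  have hA1' := sum1 A1 (fun v => by first | exact hA1 v | (convert hA1 v <;> rfl))
  have hB1' := sum1 B1 (fun v => by first | exact hB1 v | (convert hB1 v <;> rfl))
  have hAc' := sum2 Ac (fun v => by first | exact hAc v | (convert hAc v <;> rfl))
  have hBc' := sum2 Bc (fun v => by first | exact hBc v | (convert hBc v <;> rfl))
  have hχM : 0 < χ * M := by positivity
  refine ⟨AF false, BF true, by linarith, by linarith, ?_⟩
  intro p hp0 hp1 d hd x hx y hy
  -- goodness
  set Gd : LfI L → Fin L → Prop := fun v h => ∃ k : Fin s, 
    ((v.1 / 2 ^ h.1) % 2 = 0 → .inl (h, k) ∈ B1 v ∧ (low v h, k) ∈ Ac ⟨h, bkI v h⟩) ∧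
    ((v.1 / 2 ^ h.1) % 2 = 1 → .inl (h, k) ∈ A1 v ∧ (low v h, k) ∈ Bc ⟨h, bkI v h⟩) with hGd
  set Ex : LfI L → Prop := fun v => (∃ k : Prt L s, (v, k) ∈ BF false ∧ .inr k ∈ A1 v) ∧ ∃ k : Prt L s, .inr k ∈ B1 v ∧ (v, k) ∈ AF true with hEx
  set good : ℕ → ℕ → Prop := fun i v => ∃ (hi : i < L) (hv : v < 2 ^ L), Gd ⟨v, hv⟩ ⟨i, hi⟩ with hgood
  set E : Finset ℕ := (range (2 ^ L)).filter (fun v => ∃ hv : v < 2 ^ L, Ex ⟨v, hv⟩) with hE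
  have hEc : (#((range (2 ^ L)).filter (fun v => v ∉ E)) : ℝ) ≤ χ * 2 ^ L := by
    have e1 : #((range (2 ^ L)).filter (fun v => v ∉ E)) ≤ #(univ.filter (fun v : LfI L => ¬ Ex v)) := by
      refine le_trans (card_le_card ?_) (card_image_le (f := fun v : LfI L => v.1) (s := univ.filter (fun v : LfI L => ¬ Ex v)))
      intro v hv
      obtain ⟨hv1, hv2⟩ := mem_filter.1 hv
      refine mem_image.2 ⟨⟨v, mem_range.1 hv1⟩, mem_filter.2 ⟨mem_univ _, fun h => hv2 ?_⟩, rfl⟩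
      exact mem_filter.2 ⟨hv1, _, h⟩
    have e2 : #(univ.filter (fun v : LfI L => ¬ Ex v)) * (L * s) ≤ 
        (#(BF false)ᶜ + ∑ v, #(A1 v)ᶜ) + (∑ v, #(B1 v)ᶜ + #(AF true)ᶜ) := by
      have : #(univ.filter (fun v : LfI L => ¬ Ex v)) * (L * s) = #((univ.filter (fun v : LfI L => ¬ Ex v)) ×ˢ (univ : Finset (Prt L s))) := by
        rw [card_product, card_univ, Fintype.card_prod, Fintype.card_fin, Fintype.card_fin]
      rw [this]
      refine le_trans (card_le_card (t := ((BF false)ᶜ ∪ ({x : LfI L × Prt L s | Sum.inr x.2 ∉ A1 x.1} : Finset _)) ∪ (({x : LfI L × Prt L s | Sum.inr x.2 ∉ B1 x.1} : Finset _) ∪ (AF true)ᶜ)) ?_) ?_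
      · rintro ⟨v, k⟩ hv
        have hv := (mem_filter.1 (mem_product.1 hv).1).2
        simp only [mem_union, mem_compl, mem_filter, mem_univ, true_and]
        by_contra hcon
        push Not at hcon
        exact hv ⟨⟨k, hcon.1.1, hcon.1.2⟩, ⟨k, hcon.2.1, hcon.2.2⟩⟩
      · have q1 := cnt1 (Sum.inr : Prt L s → Prt L s ⊕ Prt L s) Sum.inr_injective A1
        have q2 := cnt1 (Sum.inr : Prt L s → Prt L s ⊕ Prt L s) Sum.inr_injective B1
        refine (card_union_le _ _).trans (add_le_add ((card_union_le _ _).trans (add_le_add le_rfl ?_)) ((card_union_le _ _).trans (add_le_add ?_ le_rfl)))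
        · first | exact q1 | (convert q1 <;> rfl)
        · first | exact q2 | (convert q2 <;> rfl)
    have e3 := (Nat.cast_le (α := ℝ)).2 e2
    push_cast at e3
    have e4 : (#(univ.filter (fun v : LfI L => ¬ Ex v)) : ℝ) * (L * s) ≤ χ * 2 ^ L * (L * s) := by
      refine e3.trans ?_
      have : χ * 2 ^ L * (L * s) = χ * M := by rw [hM]; ring
      rw [this]
      linarith
    have e5 := le_of_mul_le_mul_right e4 (by positivity)
    exact le_trans (Nat.cast_le.2 e1) e5
  have hbad : (#((range (2 ^ L) ×ˢ range L).filter (fun x => ¬ good x.2 x.1)) : ℝ) ≤ χ * L * 2 ^ L := by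
    set W : Finset (LfI L × Fin L) := univ.filter (fun x => ¬ Gd x.1 x.2) with hW
    have e1 : #((range (2 ^ L) ×ˢ range L).filter (fun x => ¬ good x.2 x.1)) ≤ #W := by
      refine le_trans (card_le_card ?_) (card_image_le (f := fun v : LfI L × Fin L => (v.1.1, v.2.1)) (s := W))
      rintro ⟨v, i⟩ hv
      obtain ⟨hv1, hv2⟩ := mem_filter.1 hv
      rw [mem_product, mem_range, mem_range] at hv1
      refine mem_image.2 ⟨(⟨v, hv1.1⟩, ⟨i, hv1.2⟩), mem_filter.2 ⟨mem_univ _, fun h => hv2 ⟨hv1.2, hv1.1, h⟩⟩, rfl⟩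
    have e2 : #W * s ≤ (∑ v, #(B1 v)ᶜ + ∑ v, #(Ac v)ᶜ) + (∑ v, #(A1 v)ᶜ + ∑ v, #(Bc v)ᶜ) := by
      have : #W * s = #(W ×ˢ (univ : Finset (Fin s))) := by
        rw [card_product, card_univ, Fintype.card_fin]
      rw [this, ← card_map (Equiv.prodAssoc (LfI L) (Fin L) (Fin s)).toEmbedding]
      refine le_trans (card_le_card (t := (({x : LfI L × Prt L s | Sum.inl x.2 ∉ B1 x.1} : Finset _) ∪ ({x : LfI L × Prt L s | (x.1.1 / 2 ^ x.2.1.1) % 2 = 0 ∧ (low x.1 x.2.1, x.2.2) ∉ Ac ⟨x.2.1, bkI x.1 x.2.1⟩} : Finset _)) ∪ 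
        (({x : LfI L × Prt L s | Sum.inl x.2 ∉ A1 x.1} : Finset _) ∪ ({x : LfI L × Prt L s | (x.1.1 / 2 ^ x.2.1.1) % 2 = 1 ∧ (low x.1 x.2.1, x.2.2) ∉ Bc ⟨x.2.1, bkI x.1 x.2.1⟩} : Finset _))) ?_) ?_
      · intro z hz
        obtain ⟨⟨⟨v, h⟩, k⟩, hz2, rfl⟩ := mem_map.1 hz
        have hv := (mem_filter.1 (mem_product.1 hz2).1).2
        simp only [mem_union, mem_filter, mem_univ, true_and, Equiv.toEmbedding_apply, Equiv.prodAssoc_apply]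
        by_contra hcon
        push Not at hcon
        exact hv ⟨k, fun he => ⟨hcon.1.1, hcon.1.2 he⟩, fun he => ⟨hcon.2.1, hcon.2.2 he⟩⟩
      · have q1 := cnt1 (Sum.inl : Prt L s → Prt L s ⊕ Prt L s) Sum.inl_injective A1
        have q2 := cnt1 (Sum.inl : Prt L s → Prt L s ⊕ Prt L s) Sum.inl_injective B1
        have q3 := cnt2 0 Ac
        have q4 := cnt2 1 Bc
        refine (card_union_le _ _).trans (add_le_add ((card_union_le _ _).trans (add_le_add ?_ ?_)) ((card_union_le _ _).trans (add_le_add ?_ ?_)))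
        · first | exact q2 | (convert q2 <;> rfl)
        · first | exact q3 | (convert q3 <;> rfl)
        · first | exact q1 | (convert q1 <;> rfl)
        · first | exact q4 | (convert q4 <;> rfl)
    have e3 := (Nat.cast_le (α := ℝ)).2 e2
    push_cast at e3
    have e4 : (#W : ℝ) * s ≤ χ * L * 2 ^ L * s := by
      refine e3.trans ?_
      have : χ * L * 2 ^ L * s = χ * M := by rw [hM]; ring
      rw [this]
      linarith
    have e5 := le_of_mul_le_mul_right e4 hs0
    exact le_trans (Nat.cast_le.2 e1) e5
  obtain ⟨S, hS, hSE, hSc, hSn⟩ := tree_count good p χ hp0 hp1 hχ hχ1 L hL E (by convert hEc) (by convert hbad)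
  have hSpos : S.Nonempty := by
    rw [← card_pos]
    have h2 : 0 < 1 - p / 2 := by linarith
    have : (0:ℝ) < 2 ^ L / 2 * ((1 - p / 2) ^ L * (p / 2) ^ (4 * χ * L)) := by positivity
    exact_mod_cast this.trans_le hSn
  have hdS : d ≤ #S := by exact_mod_cast hd.trans hSn
  set Sk : ℕ → Set (DpV H1 F Hc) := fun v => {z | ∃ (hv : v < 2 ^ L) (k : _), k ∈ B1 ⟨v, hv⟩ ∧ z = lf ⟨v, hv⟩ (snk1 k)} with hSk
  obtain ⟨v, hvS, hvr⟩ := chain_path (DpNet src1 snk1 srcc snkc srcF snkF) D' Sk (fb false (srcF x)) S (by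
    intro v hv w hw hvw j hr z hz
    obtain ⟨hw2, kz, hkz, rfl⟩ := hz
    have hv2 := mem_range.1 (hS hv)
    obtain ⟨i, hi, hne, heq, hev, hod⟩ := exists_split hv2 hw2 hvw
    obtain ⟨_, _, k, hk, _⟩ := hSc v hv w hw i hne heq
    obtain ⟨_, _, k', _, hk'⟩ := hSc w hw v hv i hne.symm heq.symm
    obtain ⟨hk1, hk2⟩ := hk hev
    obtain ⟨hk3, hk4⟩ := hk' hod
    have r1 := hr (lf ⟨v, hv2⟩ (snk1 (.inl (⟨i, hi⟩, k)))) ⟨hv2, _, hk1, rfl⟩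
    have eb : bkI (⟨v, hv2⟩ : LfI L) ⟨i, hi⟩ = bkI (⟨w, hw2⟩ : LfI L) ⟨i, hi⟩ := Fin.ext heq
    rw [← eb] at hk4
    have r3 := dp_cn (src1 := src1) (snk1 := snk1) (srcc := srcc) (snkc := snkc) (srcF := srcF) (snkF := snkF) (hABc _ _ hk2 _ hk4)
    have r5 := dp_lf (src1 := src1) (snk1 := snk1) (srcc := srcc) (snkc := snkc) (srcF := srcF) (snkF := snkF) (hAB1 _ _ hk3 _ hkz)
    have r2 := dp_ev (src1 := src1) (snk1 := snk1) (srcc := srcc) (snkc := snkc) (srcF := srcF) (snkF := snkF) hev r1.right_notMem r3.left_notMem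
    have r3' := r3.right_notMem
    simp only [eb] at r2 r3 r3'
    have r4 := dp_od (src1 := src1) (snk1 := snk1) (srcc := srcc) (snkc := snkc) (srcF := srcF) (snkF := snkF) hod r3' r5.left_notMem
    exact ((((r1.trans r2).trans r3).trans r4).trans r5).mono (by omega)) (by
    intro v hv z hz
    obtain ⟨hv2, kz, hkz, rfl⟩ := hz
    obtain ⟨_, ⟨k, hk1, hk2⟩, _⟩ := (mem_filter.1 (hSE hv)).2
    have r1 := dp_fb (src1 := src1) (snk1 := snk1) (srcc := srcc) (snkc := snkc) (srcF := srcF) (snkF := snkF) (hABF _ _ hx _ hk1)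
    have r3 := dp_lf (src1 := src1) (snk1 := snk1) (srcc := srcc) (snkc := snkc) (srcF := srcF) (snkF := snkF) (hAB1 _ _ hk2 _ hkz)
    have r2 := dp_fr (src1 := src1) (snk1 := snk1) (srcc := srcc) (snkc := snkc) (srcF := srcF) (snkF := snkF) r1.right_notMem r3.left_notMem
    exact ((r1.trans r2).trans r3).mono (by omega)) hSpos
  obtain ⟨hv2, _, ⟨k, hk1, hk2⟩⟩ := (mem_filter.1 (hSE hvS)).2
  have r1 := hvr (lf ⟨v, hv2⟩ (snk1 (.inr k))) ⟨hv2, _, hk1, rfl⟩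
  have r3 := dp_fb (src1 := src1) (snk1 := snk1) (srcc := srcc) (snkc := snkc) (srcF := srcF) (snkF := snkF) (hABF _ _ hk2 _ hy)
  have r2 := dp_bk (src1 := src1) (snk1 := snk1) (srcc := srcc) (snkc := snkc) (srcF := srcF) (snkF := snkF) r1.right_notMem r3.left_notMem
  exact ((r1.trans r2).trans r3).mono (by omega)
end

section
open Finset Classical

theorem num_L (ε : ℝ) (hε : 0 < ε) (hε1 : ε < 1) (x : ℝ) (hx : 32 / ε ^ 2 ≤ x) : ∃ L : ℕ, 1 ≤ L ∧
    (2:ℝ) ^ L * L ≤ (2:ℝ) ^ x ∧ 2 * (2:ℝ) ^ ((1 - ε) * x) ≤ 2 ^ L / 2 * (2:ℝ) ^ (-(ε / 4) * L) := by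
  have hε2 : 0 < ε ^ 2 := by positivity
  have h1 : 32 ≤ x * ε ^ 2 := by rwa [div_le_iff₀ hε2] at hx
  have hx0 : 0 < x := by
    by_contra hc; push Not at hc; nlinarith
  have hxe : 32 ≤ x * ε := by nlinarith [mul_pos hx0 hε]
  have hx32 : 32 ≤ x := by nlinarith
  set L := ⌊(1 - ε / 2) * x⌋₊ with hL
  have hL1 : (L:ℝ) ≤ (1 - ε / 2) * x := Nat.floor_le (mul_nonneg (by linarith) hx0.le)
  have hL2 : (1 - ε / 2) * x < L + 1 := Nat.lt_floor_add_one _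
  refine ⟨L, ?_, ?_, ?_⟩
  · have : (0:ℝ) < L := by nlinarith
    exact_mod_cast this
  · have hlog : 0.69 < Real.log 2 := by have := Real.log_two_gt_d9; linarith
    have e1 : x ≤ (2:ℝ) ^ (ε / 2 * x) := by
      rw [Real.rpow_def_of_pos (by norm_num)]
      have hy : 0 ≤ Real.log 2 * (ε / 2 * x) := by positivity
      have := Real.quadratic_le_exp_of_nonneg hy
      have h2 : x ≤ (Real.log 2 * (ε / 2 * x)) ^ 2 / 2 := by
        have e : (Real.log 2 * (ε / 2 * x)) ^ 2 / 2 = (Real.log 2) ^ 2 * (x * ε ^ 2) * x / 8 := by ring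
        rw [e]
        have h3 : 8 ≤ (Real.log 2) ^ 2 * (x * ε ^ 2) := by
          have : 0.47 ≤ (Real.log 2) ^ 2 := by nlinarith
          nlinarith
        nlinarith
      linarith
    have e2 : (2:ℝ) ^ L ≤ (2:ℝ) ^ ((1 - ε / 2) * x) := by
      rw [← Real.rpow_natCast]
      exact Real.rpow_le_rpow_of_exponent_le (by norm_num) hL1
    have e3 : (L:ℝ) ≤ x := by nlinarith
    calc (2:ℝ) ^ L * L ≤ (2:ℝ) ^ ((1 - ε / 2) * x) * (2:ℝ) ^ (ε / 2 * x) := by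
          gcongr; exact e3.trans e1
      _ = _ := by rw [← Real.rpow_add (by norm_num)]; congr 1; ring
  · have e : (2:ℝ) ^ L / 2 * (2:ℝ) ^ (-(ε / 4) * L) = (2:ℝ) ^ ((1 - ε / 4) * L - 1) := by
      rw [← Real.rpow_natCast, div_mul_eq_mul_div, ← Real.rpow_add (by norm_num), Real.rpow_sub (by norm_num), Real.rpow_one]
      congr 2; ring
    have e' : 2 * (2:ℝ) ^ ((1 - ε) * x) = (2:ℝ) ^ ((1 - ε) * x + 1) := by
      rw [Real.rpow_add (by norm_num), Real.rpow_one]; ring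
    rw [e, e']
    apply Real.rpow_le_rpow_of_exponent_le (by norm_num)
    nlinarith

/-- simple path net -/
abbrev PathNet (n : ℕ) : Net where
  V := Fin (n + 1)
  E := Fin n
  s := Fin.castSucc
  t := Fin.succ
  rk v := v.1
  rk_lt e := by simp

theorem PathNet.reach (n : ℕ) (k : ℕ) (hk : k < n + 1) : (PathNet n).Rch ∅ k 0 ⟨k, hk⟩ := by
  induction k with
  | zero => exact Net.Rch.refl (G := PathNet n) (notMem_empty _)
  | succ k ih => 
    exact Net.Rch.snoc (G := PathNet n) (⟨k, by omega⟩ : Fin n) (ih (by omega)) (notMem_empty _)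

theorem deepHub (ε γ : ℝ) (hε : 0 < ε) (hε1 : ε < 1) (hγ : 0 < γ) : ∃ κ : ℝ, 0 < κ ∧ ∃ C : ℕ, 1 ≤ C ∧ ∀ n : ℕ, 1 ≤ n →
    ∃ (G : Net) (src snk : Fin n → G.V), Fintype.card G.V ≤ C * n ∧ Fintype.card G.E ≤ C * n ∧ 
      ∃ d : ℕ, (n:ℝ) ^ (1 - ε) ≤ d ∧ IsHub γ κ d n G src snk := by
  set r : ℝ := (2:ℝ) ^ (-(ε / 8)) with hr
  have hr1 : r < 1 := Real.rpow_lt_one_of_one_lt_of_neg (by norm_num) (by linarith)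
  have hr2 : 1 / 2 ≤ r := by
    have : (2:ℝ) ^ (-1:ℝ) ≤ r := Real.rpow_le_rpow_of_exponent_le (by norm_num) (by linarith)
    rwa [Real.rpow_neg_one, ← one_div] at this
  have hr0 : 0 < r := by linarith
  set t := 1 - r with ht
  have ht0 : 0 < t := by linarith
  have ht1 : t < 1 := by linarith
  have hlt : Real.log t < 0 := Real.log_neg ht0 ht1
  have hlr : Real.log r < 0 := Real.log_neg hr0 hr1
  set χ := min (min (1 / 4) (γ / 2)) (Real.log r / (4 * Real.log t)) with hχd
  have hχ0 : 0 < χ := lt_min (lt_min (by norm_num) (by linarith)) (div_pos_of_neg_of_neg hlr (by linarith))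
  have hχ1 : χ ≤ 1 / 4 := (min_le_left _ _).trans (min_le_left _ _)
  have hχ2 : χ ≤ γ / 2 := (min_le_left _ _).trans (min_le_right _ _)
  have hχ3 : χ ≤ Real.log r / (4 * Real.log t) := min_le_right _ _
  have htr : r ≤ t ^ (4 * χ) := by
    rw [Real.rpow_def_of_pos ht0, ← Real.log_le_iff_le_exp hr0]
    rw [le_div_iff_of_neg (by linarith)] at hχ3
    linarith
  obtain ⟨κ, hκ, C, hC, hdn⟩ := deep_net χ hχ0 hχ1
  set n1 : ℕ := 2 ^ ⌈32 / ε ^ 2⌉₊ with hn1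
  have hn10 : (0:ℝ) < n1 := by rw [hn1]; positivity
  refine ⟨min κ (1 / (n1 + 1)), lt_min hκ (by positivity), 2 * C, by omega, fun n hn => ?_⟩
  have hn0 : (0:ℝ) < n := by exact_mod_cast hn
  rcases lt_or_ge n n1 with hsm | hlg
  · refine ⟨PathNet n, fun _ => 0, fun _ => Fin.last n, ?_, ?_, n, ?_, ?_⟩
    · rw [Fintype.card_fin]; nlinarith
    · rw [Fintype.card_fin]; nlinarith
    · calc (n:ℝ) ^ (1 - ε) ≤ (n:ℝ) ^ (1:ℝ) := Real.rpow_le_rpow_of_exponent_le (by exact_mod_cast hn) (by linarith)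
        _ = n := Real.rpow_one _
    · intro D hD
      have hD0 : D = ∅ := by
        rw [← card_eq_zero]
        have h1 : (#D:ℝ) < 1 := by
          refine hD.trans_lt ?_
          calc min κ (1 / (n1 + 1)) * n ≤ 1 / (n1 + 1) * n1 := by
                gcongr
                · exact min_le_right _ _
            _ < 1 := by rw [div_mul_eq_mul_div, one_mul, div_lt_one (by positivity)]; linarith
        have : #D < 1 := by exact_mod_cast h1
        omega
      subst hD0
      refine ⟨univ, univ, ?_, ?_, fun x _ y _ => PathNet.reach n n (by omega)⟩
      all_goals simp; positivity
  · have hx : 32 / ε ^ 2 ≤ Real.logb 2 n := by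
      rw [Real.le_logb_iff_rpow_le (by norm_num) hn0]
      calc (2:ℝ) ^ (32 / ε ^ 2) ≤ (2:ℝ) ^ ((⌈32 / ε ^ 2⌉₊ : ℕ) : ℝ) := Real.rpow_le_rpow_of_exponent_le (by norm_num) (Nat.le_ceil _)
        _ = n1 := by rw [Real.rpow_natCast, hn1]; push_cast; rfl
        _ ≤ n := by exact_mod_cast hlg
    obtain ⟨L, hL, hLn, hLd⟩ := num_L ε hε hε1 _ hx
    have hxn : (2:ℝ) ^ (Real.logb 2 n) = n := Real.rpow_logb (by norm_num) (by norm_num) hn0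
    rw [mul_comm (1 - ε), Real.rpow_mul (by norm_num), hxn] at hLd
    rw [hxn] at hLn
    have hPn : 2 ^ L * L ≤ n := by exact_mod_cast hLn
    set P := 2 ^ L * L with hP
    have hP0 : 0 < P := by positivity
    set s := (n + P - 1) / P with hs
    have hs1 : n ≤ P * s := by
      have := Nat.lt_div_mul_add (a := n + P - 1) hP0
      rw [← hs] at this
      have h2 : s * P = P * s := mul_comm _ _
      omega
    have hs2 : P * s ≤ n + P - 1 := Nat.mul_div_le _ _
    have hs0 : 1 ≤ s := by
      rcases Nat.eq_zero_or_pos s with h | h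
      · rw [h] at hs1; omega
      · exact h
    obtain ⟨G, src, snk, hV, hE, hG⟩ := hdn L s hL hs0
    have hcard : Fintype.card (LfI L × Prt L s) = P * s := by simp only [Fintype.card_prod, Fintype.card_fin, hP, mul_assoc]
    have hPs : 2 ^ L * (L * s) = P * s := by rw [hP, mul_assoc]
    have hPsR : (2:ℝ) ^ L * (L * s) = (P * s : ℕ) := by rw [← hPs]; push_cast; rfl
    rw [hPs] at hV hE
    rw [hPsR] at hG
    obtain ⟨ι⟩ : Nonempty (Fin n ↪ LfI L × Prt L s) := Function.Embedding.nonempty_of_card_le (by rw [hcard, Fintype.card_fin]; exact hs1)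
    have hNn : (n:ℝ) ≤ (P * s : ℕ) := by exact_mod_cast hs1
    have hPs2 : P * s ≤ 2 * n := by omega
    have hNn2 : ((P * s : ℕ) : ℝ) ≤ 2 * n := by exact_mod_cast hPs2
    refine ⟨G, src ∘ ι, snk ∘ ι, ?_, ?_, ⌈(n:ℝ) ^ (1 - ε)⌉₊, Nat.le_ceil _, ?_⟩
    · nlinarith
    · nlinarith
    intro D hD
    obtain ⟨A, B, hA, hB, hAB⟩ := hG D (hD.trans (mul_le_mul (min_le_left _ _) hNn (by positivity) hκ.le))
    have key : ∀ A : Finset (LfI L × Prt L s), (#Aᶜ : ℝ) ≤ χ * (P * s : ℕ) → (#(univ.filter (fun i => ι i ∈ A))ᶜ : ℝ) ≤ γ * n := by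
      intro A hA
      calc (#(univ.filter (fun i => ι i ∈ A))ᶜ : ℝ) ≤ #Aᶜ := by
            apply Nat.cast_le.2
            apply card_le_card_of_injOn ι _ ι.injective.injOn
            intro i hi
            simpa using hi
        _ ≤ _ := hA
        _ ≤ γ / 2 * (2 * n) := by gcongr
        _ = _ := by ring
    refine ⟨univ.filter (fun i => ι i ∈ A), univ.filter (fun i => ι i ∈ B), key A (by convert hA), key B (by convert hB), ?_⟩
    intro x hx y hy
    refine hAB (2 * t) (by linarith) (by linarith) _ ?_ _ (mem_filter.1 hx).2 _ (mem_filter.1 hy).2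
    have hpow : 1 ≤ (n:ℝ) ^ (1 - ε) := Real.one_le_rpow (by exact_mod_cast hn) (by linarith)
    have h1 : ((⌈(n:ℝ) ^ (1 - ε)⌉₊ : ℕ) : ℝ) ≤ 2 * (n:ℝ) ^ (1 - ε) := by
      have := Nat.ceil_lt_add_one (zero_le_one.trans hpow)
      linarith
    refine h1.trans (hLd.trans ?_)
    have e1 : 1 - 2 * t / 2 = r := by rw [ht]; ring
    have e2 : 2 * t / 2 = t := by ring
    rw [e1, e2, Real.rpow_mul ht0.le, Real.rpow_natCast]
    have e3 : (2:ℝ) ^ (-(ε / 4) * L) = r ^ L * r ^ L := by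
      rw [Real.rpow_mul (by norm_num), Real.rpow_natCast, ← mul_pow, hr, ← Real.rpow_add (by norm_num)]
      congr 2; ring
    rw [e3]
    gcongr
end

section
open Finset Classical

/-- input layer, then `N`, then output layer -/
noncomputable abbrev Sand (N : Net) (α X Y : Type) [Fintype α] [Fintype X] [Fintype Y] (tl : X → α) (hd : X → N.V) (tl' : Y → N.V) (hd' : Y → α) : Net :=
  Join (Layer α) (Join N (Layer α) Y tl' hd') X tl (fun x => .inl (hd x))

theorem Sand.path {N : Net} {α X Y : Type} [Fintype α] [Fintype X] [Fintype Y] {tl : X → α} {hd : X → N.V} {tl' : Y → N.V} {hd' : Y → α}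
    {D : Finset (α ⊕ (N.V ⊕ α))} (x : X) (y : Y) {d : ℕ} (h : N.Rch D.toRight.toLeft d (hd x) (tl' y)) (hx : tl x ∉ D.toLeft) 
    (hy : hd' y ∉ D.toRight.toRight) : (Sand N α X Y tl hd tl' hd').Rch D d (.inl (tl x)) (.inr (.inr (hd' y))) := by
  have h1 := Join.left (A := N) (B := Layer α) (X := Y) (tl := tl') (hd := hd') (D := D.toRight) h
  have h2 := Join.cross (A := N) (B := Layer α) (X := Y) (tl := tl') (hd := hd') (D := D.toRight) y h1.right_notMem (by simpa using hy)
  have h3 := Join.right (A := Layer α) (B := Join N (Layer α) Y tl' hd') (X := X) (tl := tl) (hd := fun x => .inl (hd x)) (D := D) (h1.trans h2)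
  have h4 := Join.cross (A := Layer α) (B := Join N (Layer α) Y tl' hd') (X := X) (tl := tl) (hd := fun x => .inl (hd x)) (D := D) x (by simpa using hx) h3.left_notMem
  exact (h4.trans h3).mono (by omega)

theorem Sand.cardV {N : Net} {α X Y : Type} [Fintype α] [Fintype X] [Fintype Y] {tl : X → α} {hd : X → N.V} {tl' : Y → N.V} {hd' : Y → α} :
    Fintype.card (Sand N α X Y tl hd tl' hd').V = 2 * Fintype.card α + Fintype.card N.V := by
  change Fintype.card (α ⊕ (N.V ⊕ α)) = _
  rw [Fintype.card_sum, Fintype.card_sum]; ring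

theorem Sand.cardE {N : Net} {α X Y : Type} [Fintype α] [Fintype X] [Fintype Y] {tl : X → α} {hd : X → N.V} {tl' : Y → N.V} {hd' : Y → α} :
    Fintype.card (Sand N α X Y tl hd tl' hd').E = Fintype.card N.E + Fintype.card X + Fintype.card Y := by
  rw [Join.cardE, Join.cardE]
  have : Fintype.card (Layer α).E = 0 := by
    change Fintype.card Empty = 0
    rfl
  rw [this]; ring

theorem card_LR {α β : Type} (D : Finset (α ⊕ β)) : #D = #D.toLeft + #D.toRight := by
  rw [card_toLeft_add_card_toRight]

def ChainP (q : ℕ) (γ κ : ℝ) (c d m : ℕ) (M : Net) (a b : Fin (c * 2 ^ m) → M.V) : Prop := 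
  ∀ D : Finset M.V, ∀ i < m, (#D : ℝ) ≤ κ * (c * 2 ^ (i + 1)) → ∃ A B : Finset (Fin (c * 2 ^ m)), 
    (#Aᶜ : ℝ) ≤ #D + γ * (c * 2 ^ (i + 1)) / q ^ (m - 1 - i) ∧ (#Bᶜ : ℝ) ≤ #D + γ * (c * 2 ^ (i + 1)) / q ^ (m - 1 - i) ∧ 
    ∀ x ∈ A, ∀ y ∈ B, M.Rch D d (a x) (b y)

theorem chain_small {q : ℕ} {γ κ : ℝ} {c m i e : ℕ} {D z : ℝ} (hq : 2 ≤ q) (hκ : κ ≤ 1 / 32) (hγ : γ ≤ 1 / 32) (hγ0 : 0 < γ) (hi : i < m) (h : z ≤ D + γ * (c * 2 ^ (i + 1)) / q ^ e)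
    (hD : D ≤ κ * (c * 2 ^ (i + 1))) : 16 * z ≤ c * 2 ^ m := by
  have h1 : γ * (c * 2 ^ (i + 1)) / (q:ℝ) ^ e ≤ 1 / 32 * (c * 2 ^ (i + 1)) := by
    refine (div_le_self (by positivity) (one_le_pow₀ (by exact_mod_cast (by omega : 1 ≤ q)))).trans ?_
    gcongr
  have h2 : κ * ((c:ℝ) * 2 ^ (i + 1)) ≤ 1 / 32 * (c * 2 ^ (i + 1)) := by gcongr
  have h3 : (c:ℝ) * 2 ^ (i + 1) ≤ c * 2 ^ m := by
    gcongr
    · norm_num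
    · omega
  linarith

theorem spread {α β : Type} [Fintype α] [Fintype β] [DecidableEq α] [DecidableEq β] {q : ℕ} (hq : 2 ≤ q) (f : α → Fin (4 * q) → β) (hf : ∀ Z : Finset β, 16 * #Z ≤ Fintype.card β → q * #{x | ∀ a, f x a ∈ Z} ≤ #Z)
    (A : Finset β) (DL : Finset α) (hA : 16 * (#Aᶜ : ℝ) ≤ Fintype.card β) : 
    (#({x | x ∉ DL ∧ ∃ k, f x k ∈ A} : Finset α)ᶜ : ℝ) ≤ #DL + #Aᶜ / q := by
  have hq0 : (0:ℝ) < q := by exact_mod_cast (by omega : 0 < q)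
  have h1 := hf Aᶜ (by exact_mod_cast hA)
  have h2 : (q:ℝ) * #{x | ∀ a, f x a ∈ Aᶜ} ≤ #Aᶜ := by exact_mod_cast h1
  have h3 : (#{x | ∀ a, f x a ∈ Aᶜ} : ℝ) ≤ #Aᶜ / q := by rw [le_div_iff₀ hq0]; linarith
  have h4 : ({x | x ∉ DL ∧ ∃ k, f x k ∈ A} : Finset α)ᶜ ⊆ DL ∪ ({x | ∀ a, f x a ∈ Aᶜ} : Finset α) := by
    intro x hx
    simp only [mem_compl, mem_filter, mem_univ, true_and, mem_union] at hx ⊢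
    by_contra hc
    push Not at hc
    exact hx hc
  have h5 := (card_le_card h4).trans (card_union_le _ _)
  have h6 : (#({x | x ∉ DL ∧ ∃ k, f x k ∈ A} : Finset α)ᶜ : ℝ) ≤ #DL + #{x | ∀ a, f x a ∈ Aᶜ} := by exact_mod_cast h5
  linarith

theorem chain (q C : ℕ) (γ κ : ℝ) (c d : ℕ) (hq : 2 ≤ q) (hγ0 : 0 < γ) (hγ : γ ≤ 1 / 32) (hκ0 : 0 < κ) (hκ : κ ≤ 1 / 32) (hc : 1 ≤ c)
    (hub : ∀ n, c ≤ n → ∃ (G : Net) (src snk : Fin n → G.V), Fintype.card G.V ≤ C * n ∧ Fintype.card G.E ≤ C * n ∧ IsHub γ κ d n G src snk) (m : ℕ) : 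
    ∃ (M : Net) (a b : Fin (c * 2 ^ m) → M.V), Fintype.card M.V ≤ 2 * (C + 4 + 8 * q) * (c * 2 ^ m) ∧ Fintype.card M.E ≤ 2 * (C + 4 + 8 * q) * (c * 2 ^ m) ∧ 
      ChainP q γ κ c d m M a b := by
  induction m with
  | zero =>
    refine ⟨Layer (Fin (c * 2 ^ 0) ⊕ Fin (c * 2 ^ 0)), .inl, .inr, ?_, ?_, ?_⟩
    · rw [Fintype.card_sum, Fintype.card_fin]; nlinarith
    · change Fintype.card Empty ≤ _
      rw [Fintype.card_empty]; omega
    · intro D i hi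
      omega
  | succ m ih =>
    obtain ⟨M, a, b, hV, hE, hM⟩ := ih
    obtain ⟨G, src, snk, hGV, hGE, hG⟩ := hub (c * 2 ^ (m + 1)) (Nat.le_mul_of_pos_right _ (by positivity))
    have : Nonempty (Fin (c * 2 ^ m)) := ⟨⟨0, by positivity⟩⟩
    obtain ⟨f, hf⟩ := lemS q hq (Fin (c * 2 ^ (m + 1))) (Fin (c * 2 ^ m)) (by simp only [Fintype.card_fin]; rw [pow_succ]; linarith)
    have hXc : Fintype.card ((Fin (c * 2 ^ (m + 1))) ⊕ ((Fin (c * 2 ^ (m + 1))) × Fin (4 * q))) = (1 + 4 * q) * (c * 2 ^ (m + 1)) := by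
      rw [Fintype.card_sum, Fintype.card_prod, Fintype.card_fin, Fintype.card_fin]; ring
    refine ⟨Sand (Join G M Empty Empty.elim Empty.elim) (Fin (c * 2 ^ (m + 1))) ((Fin (c * 2 ^ (m + 1))) ⊕ ((Fin (c * 2 ^ (m + 1))) × Fin (4 * q))) ((Fin (c * 2 ^ (m + 1))) ⊕ ((Fin (c * 2 ^ (m + 1))) × Fin (4 * q))) (Sum.elim id Prod.fst) (Sum.elim (fun x => .inl (src x)) (fun x => .inr (a (f x.1 x.2))))
      (Sum.elim (fun x => .inl (snk x)) (fun x => .inr (b (f x.1 x.2)))) (Sum.elim id Prod.fst), .inl, fun x => .inr (.inr x), ?_, ?_, ?_⟩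
    · rw [Sand.cardV, Join.cardV, Fintype.card_fin]
      rw [pow_succ] at *
      nlinarith
    · rw [Sand.cardE, Join.cardE, hXc, Fintype.card_empty]
      rw [pow_succ] at *
      nlinarith
    · intro D i hi hD
      set D' : Finset ((Fin (c * 2 ^ (m + 1))) ⊕ ((G.V ⊕ M.V) ⊕ (Fin (c * 2 ^ (m + 1))))) := D with hD'
      have hc1 : #D' = #D'.toLeft + ((#D'.toRight.toLeft.toLeft + #D'.toRight.toLeft.toRight) + #D'.toRight.toRight) := by
        rw [card_LR D', card_LR D'.toRight, card_LR D'.toRight.toLeft]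
      have hc2 : (#D' : ℝ) = #D'.toLeft + ((#D'.toRight.toLeft.toLeft + #D'.toRight.toLeft.toRight) + #D'.toRight.toRight) := by
        exact_mod_cast hc1
      have n1 : (0:ℝ) ≤ #D'.toLeft := by positivity
      have n2 : (0:ℝ) ≤ #D'.toRight.toLeft.toLeft := by positivity
      have n3 : (0:ℝ) ≤ #D'.toRight.toLeft.toRight := by positivity
      have n4 : (0:ℝ) ≤ #D'.toRight.toRight := by positivity
      rcases Nat.lt_succ_iff_lt_or_eq.1 hi with him | rfl
      · obtain ⟨A, B, hA, hB, hAB⟩ := hM D'.toRight.toLeft.toRight i him (by linarith)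
        have hq0 : (0:ℝ) < q := by exact_mod_cast (by omega : 0 < q)
        have key : ∀ (A : Finset (Fin (c * 2 ^ m))) (DL : Finset (Fin (c * 2 ^ (m + 1)))), (#DL : ℝ) + #D'.toRight.toLeft.toRight ≤ #D' → 
            (#Aᶜ : ℝ) ≤ #D'.toRight.toLeft.toRight + γ * (c * 2 ^ (i + 1)) / q ^ (m - 1 - i) → 
            (#({x | x ∉ DL ∧ ∃ k, f x k ∈ A} : Finset (Fin (c * 2 ^ (m + 1))))ᶜ : ℝ) ≤ #D' + γ * (c * 2 ^ (i + 1)) / q ^ (m + 1 - 1 - i) := by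
          intro A DL hDL hA
          have h16 := chain_small hq hκ hγ hγ0 him hA (by linarith)
          have h1 := spread hq f (fun Z hZ => by convert hf Z hZ) A DL (by rw [Fintype.card_fin]; push_cast; convert h16)
          have h2 : (#Aᶜ : ℝ) / q ≤ #D'.toRight.toLeft.toRight + γ * (c * 2 ^ (i + 1)) / q ^ (m + 1 - 1 - i) := by
            have e : m + 1 - 1 - i = (m - 1 - i) + 1 := by omega
            rw [e, pow_succ (q:ℝ), ← div_div]
            refine (div_le_div_of_nonneg_right (by convert hA) hq0.le).trans ?_
            rw [add_div]
            gcongr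
            exact div_le_self n3 (by exact_mod_cast (by omega : 1 ≤ q))
          linarith
        refine ⟨_, _, key A D'.toLeft (by linarith) hA, key B D'.toRight.toRight (by linarith) hB, ?_⟩
        intro x hx y hy
        obtain ⟨hx1, k, hk⟩ := (mem_filter.1 hx).2
        obtain ⟨hy1, j, hj⟩ := (mem_filter.1 hy).2
        have r := Join.right (A := G) (B := M) (X := Empty) (tl := Empty.elim) (hd := Empty.elim) (D := D'.toRight.toLeft) (hAB _ hk _ hj)
        exact Sand.path (N := Join G M Empty Empty.elim Empty.elim) (X := (Fin (c * 2 ^ (m + 1))) ⊕ ((Fin (c * 2 ^ (m + 1))) × Fin (4 * q))) (Y := (Fin (c * 2 ^ (m + 1))) ⊕ ((Fin (c * 2 ^ (m + 1))) × Fin (4 * q))) (tl := Sum.elim id Prod.fst) (hd := Sum.elim (fun x => .inl (src x)) (fun x => .inr (a (f x.1 x.2))))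
          (tl' := Sum.elim (fun x => .inl (snk x)) (fun x => .inr (b (f x.1 x.2)))) (hd' := Sum.elim id Prod.fst) (D := D') (.inr (x, k)) (.inr (y, j)) r hx1 hy1
      · obtain ⟨A, B, hA, hB, hAB⟩ := hG D'.toRight.toLeft.toLeft (by push_cast; linarith)
        push_cast at hA hB
        have key : ∀ (A DL : Finset (Fin (c * 2 ^ (i + 1)))), (#DL : ℝ) ≤ #D' → 
            (#Aᶜ : ℝ) ≤ γ * (c * 2 ^ (i + 1)) → 
            (#(A \ DL)ᶜ : ℝ) ≤ #D' + γ * (c * 2 ^ (i + 1)) / q ^ (i + 1 - 1 - i) := by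
          intro A DL hDL hA
          have e : i + 1 - 1 - i = 0 := by omega
          rw [e, pow_zero, div_one]
          have : (A \ DL)ᶜ ⊆ DL ∪ Aᶜ := by
            intro x hx
            simp only [mem_compl, mem_sdiff, mem_union] at hx ⊢
            tauto
          have h5 := (card_le_card this).trans (card_union_le _ _)
          have h6 : (#(A \ DL)ᶜ : ℝ) ≤ #DL + #Aᶜ := by exact_mod_cast h5
          linarith
        refine ⟨A \ D'.toLeft, B \ D'.toRight.toRight, ?_, ?_, ?_⟩
        · convert key A D'.toLeft (by linarith) (by convert hA)
        · convert key B D'.toRight.toRight (by linarith) (by convert hB)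
        intro x hx y hy
        obtain ⟨hx1, hx2⟩ := mem_sdiff.1 hx
        obtain ⟨hy1, hy2⟩ := mem_sdiff.1 hy
        have r := Join.left (A := G) (B := M) (X := Empty) (tl := Empty.elim) (hd := Empty.elim) (D := D'.toRight.toLeft) (hAB _ hx1 _ hy1)
        exact Sand.path (N := Join G M Empty Empty.elim Empty.elim) (X := (Fin (c * 2 ^ (i + 1))) ⊕ ((Fin (c * 2 ^ (i + 1))) × Fin (4 * q))) (Y := (Fin (c * 2 ^ (i + 1))) ⊕ ((Fin (c * 2 ^ (i + 1))) × Fin (4 * q))) (tl := Sum.elim id Prod.fst) (hd := Sum.elim (fun x => .inl (src x)) (fun x => .inr (a (f x.1 x.2))))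
          (tl' := Sum.elim (fun x => .inl (snk x)) (fun x => .inr (b (f x.1 x.2)))) (hd' := Sum.elim id Prod.fst) (D := D') (.inl x) (.inl y) r hx2 hy2
end

section
open Finset Classical

theorem num_J (ε : ℝ) (hε : 0 < ε) (hε1 : ε < 1) (a : ℕ) (ha : 2 / ε ≤ a) (n : ℕ) (hn : 1 ≤ n) : ∃ J w : ℕ, 1 ≤ w ∧ n ≤ w * 2 ^ J ∧ w * 2 ^ J ≤ 2 * n ∧
    n ≤ 2 ^ (a * (J + 1)) ∧ (n:ℝ) ^ (1 - ε) ≤ (w:ℝ) ^ (1 - ε / 2) := by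
  have hn0 : (0:ℝ) < n := by exact_mod_cast hn
  have hn1 : (1:ℝ) ≤ n := by exact_mod_cast hn
  set x := Real.logb 2 n with hx
  have hxn : (2:ℝ) ^ x = n := Real.rpow_logb (by norm_num) (by norm_num) hn0
  have hx0 : 0 ≤ x := Real.logb_nonneg (by norm_num) hn1
  set J := ⌊ε / 2 * x⌋₊ with hJ
  have hJ1 : (J:ℝ) ≤ ε / 2 * x := Nat.floor_le (by positivity)
  have hJ2 : ε / 2 * x < J + 1 := Nat.lt_floor_add_one _
  have h2J : (2:ℝ) ^ J ≤ (n:ℝ) ^ (ε / 2) := by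
    rw [← hxn, ← Real.rpow_mul (by norm_num), ← Real.rpow_natCast]
    exact Real.rpow_le_rpow_of_exponent_le (by norm_num) (by linarith)
  have h2Jn : 2 ^ J ≤ n := by
    have : (2:ℝ) ^ J ≤ n := h2J.trans (by
      calc (n:ℝ) ^ (ε / 2) ≤ (n:ℝ) ^ (1:ℝ) := Real.rpow_le_rpow_of_exponent_le hn1 (by linarith)
        _ = n := Real.rpow_one _)
    exact_mod_cast this
  set P := 2 ^ J with hP
  have hP0 : 0 < P := by positivity
  set w := (n + P - 1) / P with hw
  have hs1 : n ≤ w * P := by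
    have := Nat.lt_div_mul_add (a := n + P - 1) hP0
    rw [← hw] at this
    omega
  have hs2 : w * P ≤ n + P - 1 := Nat.div_mul_le_self _ _
  have hs0 : 1 ≤ w := by
    rcases Nat.eq_zero_or_pos w with h | h
    · rw [h] at hs1; omega
    · exact h
  refine ⟨J, w, hs0, hs1, hs2.trans (by omega), ?_, ?_⟩
  · have : (n:ℝ) ≤ (2:ℝ) ^ (a * (J + 1)) := by
      rw [← hxn, ← Real.rpow_natCast]
      apply Real.rpow_le_rpow_of_exponent_le (by norm_num)
      push_cast
      rw [div_le_iff₀ hε] at ha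
      have h3 : x ≤ 2 / ε * (J + 1) := by
        rw [div_mul_eq_mul_div, le_div_iff₀ hε]; nlinarith
      refine h3.trans ?_
      gcongr
      rwa [div_le_iff₀ hε]
    exact_mod_cast this
  · have hw1 : (n:ℝ) ^ (1 - ε / 2) ≤ w := by
      have h4 : (n:ℝ) ≤ w * (n:ℝ) ^ (ε / 2) := by
        calc (n:ℝ) ≤ w * 2 ^ J := by exact_mod_cast hs1
          _ ≤ _ := by gcongr
      rw [Real.rpow_sub hn0, Real.rpow_one, div_le_iff₀ (by positivity)]
      exact h4
    calc (n:ℝ) ^ (1 - ε) ≤ (n:ℝ) ^ ((1 - ε / 2) * (1 - ε / 2)) := Real.rpow_le_rpow_of_exponent_le hn1 (by nlinarith)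
      _ = ((n:ℝ) ^ (1 - ε / 2)) ^ (1 - ε / 2) := Real.rpow_mul hn0.le _ _
      _ ≤ _ := Real.rpow_le_rpow (by positivity) hw1 (by linarith)

set_option maxHeartbeats 2000000 in
theorem finalNet (ε : ℝ) (hε : 0 < ε) (hε1 : ε < 1) : ∃ C : ℕ, 1 ≤ C ∧ ∀ n : ℕ, 1 ≤ n → ∃ (M : Net) (inp out : Fin n → M.V), 
    Function.Injective inp ∧ Function.Injective out ∧ Fintype.card M.V ≤ C * n ∧ Fintype.card M.E ≤ C * n ∧ 
    ∀ D : Finset M.V, ∃ A B : Finset (Fin n), n ≤ #A + #D ∧ n ≤ #B + #D ∧ ∀ x ∈ A, ∀ y ∈ B, M.Rch D ⌊(n:ℝ) ^ (1 - ε)⌋₊ (inp x) (out y) := by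
  obtain ⟨κ0, hκ0, C, hC, hdeep⟩ := deepHub (ε / 2) (1 / 32) (by linarith) (by linarith) (by norm_num)
  set κ := min κ0 (1 / 32) with hκd
  have hκ : 0 < κ := lt_min hκ0 (by norm_num)
  have hκ1 : κ ≤ 1 / 32 := min_le_right _ _
  set c0 := ⌈1 / κ⌉₊ with hc0d
  have hc0 : 1 ≤ κ * c0 := by
    have : 1 / κ ≤ c0 := Nat.le_ceil _
    rw [div_le_iff₀ hκ] at this; linarith
  have hc01 : 1 ≤ c0 := by
    rcases Nat.eq_zero_or_pos c0 with h | h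
    · rw [h] at hc0; norm_num at hc0
    · exact h
  set a := ⌈2 / ε⌉₊ with had
  set q := 8 * c0 * 2 ^ a + ⌈4 / κ⌉₊ with hqd
  have hq8 : 8 * c0 * 2 ^ a ≤ q := by omega
  have hqκ : 4 ≤ κ * q := by
    have : 4 / κ ≤ ⌈4 / κ⌉₊ := Nat.le_ceil _
    have h2 : (⌈4 / κ⌉₊ : ℝ) ≤ q := by exact_mod_cast (by omega : ⌈4 / κ⌉₊ ≤ q)
    have h3 := this.trans h2
    rw [div_le_iff₀ hκ] at h3; linarith
  have hq2 : 2 ≤ q := by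
    have : 1 ≤ c0 * 2 ^ a := Nat.mul_pos hc01 (by positivity)
    nlinarith
  clear_value q
  set K := 2 * (C + 4 + 8 * q) with hK
  refine ⟨2 + K * (4 * c0) + 8 * q, by omega, fun n hn => ?_⟩
  obtain ⟨J, w, hw, hnw, hwn, hnJ, hdw⟩ := num_J ε hε hε1 a (Nat.le_ceil _) n hn
  have hn0 : (0:ℝ) < n := by exact_mod_cast hn
  set d := ⌊(n:ℝ) ^ (1 - ε)⌋₊ with hd
  have hdd : (d:ℝ) ≤ (n:ℝ) ^ (1 - ε) := Nat.floor_le (by positivity)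
  set c := c0 * w with hc
  have hc1 : 1 ≤ c := Nat.mul_pos hc01 hw
  have hwc : w ≤ c := Nat.le_mul_of_pos_left _ hc01
  have hub : ∀ n', c ≤ n' → ∃ (G : Net) (src snk : Fin n' → G.V), Fintype.card G.V ≤ C * n' ∧ Fintype.card G.E ≤ C * n' ∧ IsHub (1 / 32) κ d n' G src snk := by
    intro n' hn'
    obtain ⟨G, src, snk, hV, hE, d', hd', hG⟩ := hdeep n' (by omega)
    refine ⟨G, src, snk, hV, hE, fun D hD => ?_⟩
    obtain ⟨A, B, hA, hB, hAB⟩ := hG D (hD.trans (by gcongr; exact min_le_left _ _))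
    refine ⟨A, B, hA, hB, fun x hx y hy => (hAB x hx y hy).mono ?_⟩
    have : (d:ℝ) ≤ d' := by
      refine hdd.trans (hdw.trans (le_trans ?_ hd'))
      exact Real.rpow_le_rpow (by positivity) (by exact_mod_cast hwc.trans hn') (by linarith)
    exact_mod_cast this
  obtain ⟨M, s, t, hV, hE, hM⟩ := chain q C (1 / 32) κ c d hq2 (by norm_num) le_rfl hκ hκ1 hc1 hub (J + 1)
  have hsz : c * 2 ^ (J + 1) = 2 * c0 * (w * 2 ^ J) := by rw [hc, pow_succ]; ring
  have hβ : Nonempty (Fin (c * 2 ^ (J + 1))) := ⟨⟨0, by positivity⟩⟩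
  have hnc : n ≤ c * 2 ^ (J + 1) := by rw [hsz]; nlinarith
  obtain ⟨f, hf⟩ := lemS q hq2 (Fin n) (Fin (c * 2 ^ (J + 1))) (by simp only [Fintype.card_fin]; omega)
  have hszn : c * 2 ^ (J + 1) ≤ 4 * c0 * n := by rw [hsz]; nlinarith
  have hKn : K * (c * 2 ^ (J + 1)) ≤ K * (4 * c0) * n := by rw [mul_assoc K]; exact Nat.mul_le_mul_left _ hszn
  replace hV : Fintype.card M.V ≤ K * (c * 2 ^ (J + 1)) := hV
  replace hE : Fintype.card M.E ≤ K * (c * 2 ^ (J + 1)) := hE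
  clear_value K
  refine ⟨Sand M (Fin n) (Fin n × Fin (4 * q)) (Fin n × Fin (4 * q)) Prod.fst (fun x => s (f x.1 x.2)) (fun x => t (f x.1 x.2)) Prod.fst, 
    .inl, fun x => .inr (.inr x), Sum.inl_injective, Sum.inr_injective.comp Sum.inr_injective, ?_, ?_, ?_⟩
  · rw [Sand.cardV, Fintype.card_fin]
    nlinarith
  · rw [Sand.cardE, Fintype.card_prod, Fintype.card_fin, Fintype.card_fin]
    nlinarith
  intro D
  set D' : Finset (Fin n ⊕ (M.V ⊕ Fin n)) := D with hD'
  have hcd : #D' = #D'.toLeft + (#D'.toRight.toLeft + #D'.toRight.toRight) := by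
    rw [card_LR D', card_LR D'.toRight]
  rcases le_or_gt n (#D') with hbig | hsm
  · exact ⟨∅, ∅, by omega, by omega, fun x hx => absurd hx (notMem_empty _)⟩
  set k := #D'.toRight.toLeft with hk
  have hJmem : (k:ℝ) ≤ κ * (c * 2 ^ (J + 1)) := by
    have h1 : (k:ℝ) ≤ n := by exact_mod_cast (by omega : k ≤ n)
    have h2 : (n:ℝ) ≤ w * 2 ^ J := by exact_mod_cast hnw
    have e : κ * (c * 2 ^ (J + 1)) = (κ * c0) * (2 * (w * 2 ^ J)) := by rw [hc, pow_succ]; push_cast; ring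
    rw [e]
    nlinarith
  have hex : ∃ i, (k:ℝ) ≤ κ * (c * 2 ^ (i + 1)) := ⟨J, hJmem⟩
  set i := Nat.find hex with hi
  have hi1 : (k:ℝ) ≤ κ * (c * 2 ^ (i + 1)) := Nat.find_spec hex
  have hiJ : i ≤ J := Nat.find_min' hex hJmem
  obtain ⟨A, B, hA, hB, hAB⟩ := hM D'.toRight.toLeft i (by omega) hi1
  rw [← hk] at hA hB
  have hq0 : (0:ℝ) < q := by exact_mod_cast (by omega : 0 < q)
  have hq1 : (1:ℝ) ≤ q := by exact_mod_cast (by omega : 1 ≤ q)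
  have hk0 : (0:ℝ) ≤ k := by positivity
  have hbd : ((k:ℝ) + 1 / 32 * (c * 2 ^ (i + 1)) / q ^ (J + 1 - 1 - i)) / q < k + 1 := by
    rcases Nat.eq_zero_or_pos i with h0 | h0
    · rw [h0, add_div, div_div, ← pow_succ]
      have e1 : (k:ℝ) / q ≤ k := div_le_self hk0 hq1
      have e2 : 2 * c ≤ q ^ (J + 1) := by
        have g1 : w ≤ 2 * n := le_trans (Nat.le_mul_of_pos_right _ (by positivity)) hwn
        calc 2 * c ≤ 8 * c0 * n := by rw [hc]; nlinarith
          _ ≤ 8 * c0 * 2 ^ (a * (J + 1)) := by gcongr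
          _ = 8 * c0 * (2 ^ a) ^ (J + 1) := by rw [pow_mul]
          _ ≤ (8 * c0) ^ (J + 1) * (2 ^ a) ^ (J + 1) := by
              gcongr
              exact Nat.le_self_pow (by omega) _
          _ = (8 * c0 * 2 ^ a) ^ (J + 1) := (mul_pow _ _ _).symm
          _ ≤ _ := by gcongr
      have e3 : 2 * (c:ℝ) ≤ (q:ℝ) ^ (J + 1) := by exact_mod_cast e2
      have e4 : 1 / 32 * ((c:ℝ) * 2 ^ (0 + 1)) / (q:ℝ) ^ (J + 1 - 1 - 0 + 1) < 1 := by
        have e5 : J + 1 - 1 - 0 + 1 = J + 1 := by omega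
        have e6 : (0:ℝ) < (q:ℝ) ^ (J + 1) := by positivity
        rw [e5, div_lt_one e6]
        have : (0:ℝ) < c := by exact_mod_cast hc1
        linarith
      linarith
    · have hlt : κ * (c * 2 ^ i) < k := by
        have := Nat.find_min hex (m := i - 1) (by omega)
        rw [Nat.sub_add_cancel h0] at this
        exact not_le.1 this
      have e1 : 1 / 32 * ((c:ℝ) * 2 ^ (i + 1)) / (q:ℝ) ^ (J + 1 - 1 - i) ≤ 1 / 32 * (c * 2 ^ (i + 1)) := 
        div_le_self (by positivity) (one_le_pow₀ hq1)
      have e2 : 1 / 32 * ((c:ℝ) * 2 ^ (i + 1)) ≤ k * q / 2 := by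
        rw [pow_succ]
        have : (0:ℝ) ≤ c * 2 ^ i := by positivity
        have g : κ * (c * 2 ^ i) * q ≤ k * q := by gcongr
        nlinarith
      rw [div_lt_iff₀ hq0]
      have hq2' : (2:ℝ) ≤ q := by exact_mod_cast hq2
      nlinarith
  have key : ∀ (A : Finset (Fin (c * 2 ^ (J + 1)))) (DL : Finset (Fin n)), #DL + k ≤ #D' → 
      (#Aᶜ : ℝ) ≤ k + 1 / 32 * (c * 2 ^ (i + 1)) / q ^ (J + 1 - 1 - i) → 
      n ≤ #({x | x ∉ DL ∧ ∃ k, f x k ∈ A} : Finset (Fin n)) + #D' := by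
    intro A DL hDL hA
    have h16 := chain_small hq2 hκ1 (by norm_num) (by norm_num) (show i < J + 1 by omega) hA hi1
    have h1 := spread hq2 f (fun Z hZ => by convert hf Z hZ) A DL (by rw [Fintype.card_fin]; push_cast; convert h16)
    have h2 := (div_le_div_of_nonneg_right hA hq0.le).trans_lt hbd
    have h3 : (#({x | x ∉ DL ∧ ∃ k, f x k ∈ A} : Finset (Fin n))ᶜ : ℝ) < #DL + (k + 1) := by linarith
    have h4 : #({x | x ∉ DL ∧ ∃ k, f x k ∈ A} : Finset (Fin n))ᶜ < #DL + (k + 1) := by exact_mod_cast h3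
    have h5 := card_add_card_compl ({x | x ∉ DL ∧ ∃ k, f x k ∈ A} : Finset (Fin n))
    rw [Fintype.card_fin] at h5
    omega
  refine ⟨_, _, key A D'.toLeft (by omega) hA, key B D'.toRight.toRight (by omega) hB, ?_⟩
  intro x hx y hy
  obtain ⟨hx1, k1, hk1⟩ := (mem_filter.1 hx).2
  obtain ⟨hy1, k2, hk2⟩ := (mem_filter.1 hy).2
  exact Sand.path (N := M) (X := Fin n × Fin (4 * q)) (Y := Fin n × Fin (4 * q)) (tl := Prod.fst) (hd := fun x => s (f x.1 x.2))
    (tl' := fun x => t (f x.1 x.2)) (hd' := Prod.fst) (D := D') (x, k1) (y, k2) (hAB _ hk1 _ hk2) hx1 hy1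
end

section
open Finset Classical

theorem ConnAvoidingLen.snoc {V : Type*} {Adj : V → V → Prop} {S : Finset V} {d : ℕ} {u v w : V} (h : ConnAvoidingLen Adj S d u v) (hvw : Adj v w) (hw : w ∉ S) :
    ConnAvoidingLen Adj S (d + 1) u w := by
  obtain ⟨p, ⟨hne, hch⟩, hS, hh, hl, hd⟩ := h
  refine ⟨p ++ [w], ⟨by simp, ?_⟩, ?_, ?_, by simp, by simpa using hd⟩
  · refine List.isChain_append.2 ⟨hch, by simp, ?_⟩
    intro x hx y hy
    rw [hl] at hx
    simp only [Option.mem_def, Option.some.injEq, List.head?_cons] at hx hy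
    subst hx; subst hy
    exact hvw
  · intro x hx
    rcases List.mem_append.1 hx with hx | hx
    · exact hS x hx
    · rw [List.mem_singleton.1 hx]; exact hw
  · rw [List.head?_append, hh]; rfl

theorem ConnAvoidingLen.mono {V : Type*} {Adj : V → V → Prop} {S : Finset V} {d d' : ℕ} {u v : V} (h : ConnAvoidingLen Adj S d u v) (hd : d' ≤ d) :
    ConnAvoidingLen Adj S d' u v := by
  obtain ⟨p, h1, h2, h3, h4, h5⟩ := h
  exact ⟨p, h1, h2, h3, h4, by omega⟩

theorem ConnAvoidingLen.nil {V : Type*} {Adj : V → V → Prop} {S : Finset V} {u : V} (h : u ∉ S) : ConnAvoidingLen Adj S 0 u u :=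
  ⟨[u], ⟨by simp, List.isChain_singleton u⟩, by simpa using h, rfl, rfl, by simp⟩

section
variable (M : Net)

noncomputable def eOrd (e : M.E) : ℕ := (Fintype.equivFin M.E e).1

theorem eOrd_lt (e : M.E) : eOrd M e < Fintype.card M.E := (Fintype.equivFin M.E e).2

theorem eOrd_inj {e g : M.E} (h : eOrd M e = eOrd M g) : e = g := (Fintype.equivFin M.E).injective (Fin.ext h)

/-- the degree reduced relation: in-edges of a vertex become a path leading to it -/
def rAdj : M.V ⊕ M.E → M.V ⊕ M.E → Prop
  | .inl u, .inr e => M.s e = u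
  | .inr e, .inr g => M.t e = M.t g ∧ eOrd M e < eOrd M g ∧ ∀ h, M.t h = M.t e → eOrd M e < eOrd M h → eOrd M g ≤ eOrd M h
  | .inr e, .inl v => M.t e = v ∧ ∀ h, M.t h = v → eOrd M h ≤ eOrd M e
  | .inl _, .inl _ => False

noncomputable def rRk : M.V ⊕ M.E → ℕ
  | .inl v => M.rk v * (Fintype.card M.E + 1) + Fintype.card M.E
  | .inr e => M.rk (M.t e) * (Fintype.card M.E + 1) + eOrd M e

theorem rRk_lt {x y : M.V ⊕ M.E} (h : rAdj M x y) : rRk M x < rRk M y := by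
  rcases x with u | e <;> rcases y with v | g
  · exact h.elim
  · have h : M.s g = u := h
    subst h
    have h1 := M.rk_lt g
    have h2 : (M.rk (M.s g) + 1) * (Fintype.card M.E + 1) ≤ M.rk (M.t g) * (Fintype.card M.E + 1) := Nat.mul_le_mul_right _ h1
    simp only [rRk]
    rw [add_mul] at h2
    omega
  · have h1 := h.1
    subst h1
    have := eOrd_lt M e
    simp only [rRk]
    omega
  · have h1 := h.1
    have h2 := h.2.1
    simp only [rRk]
    rw [h1]
    omega

theorem rAdj_acyclic : Acyclic (rAdj M) := by
  intro v hv
  have : ∀ w, Relation.TransGen (rAdj M) v w → rRk M v < rRk M w := by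
    intro w hw
    induction hw with
    | single h => exact rRk_lt M h
    | tail _ h ih => exact ih.trans (rRk_lt M h)
  exact lt_irrefl _ (this v hv)

theorem rAdj_indeg (v : M.V ⊕ M.E) : indeg (rAdj M) v ≤ 2 := by
  have : Function.Injective (fun u : {u // rAdj M u v} => u.1.isLeft) := by
    rintro ⟨x, hx⟩ ⟨y, hy⟩ h
    apply Subtype.ext
    rcases x with x | x <;> rcases y with y | y <;> rcases v with v | v <;> simp at h
    · exact hx.elim
    · have h1 : M.s v = x := hx
      have h2 : M.s v = y := hy
      exact congrArg Sum.inl (h1.symm.trans h2)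
    · have h1 := hx.2 y hy.1
      have h2 := hy.2 x hx.1
      exact congrArg Sum.inr (eOrd_inj M (le_antisymm h2 h1))
    · obtain ⟨a1, a2, a3⟩ := hx
      obtain ⟨b1, b2, b3⟩ := hy
      rcases lt_trichotomy (eOrd M x) (eOrd M y) with h | h | h
      · have := a3 y (b1.trans a1.symm) h
        omega
      · exact congrArg Sum.inr (eOrd_inj M h)
      · have := b3 x (a1.trans b1.symm) h
        omega
  have := Nat.card_le_card_of_injective _ this
  simpa [indeg] using this

theorem rAdj_descend {D : Finset (M.V ⊕ M.E)} {u : M.V ⊕ M.E} (e : M.E) (hD : ∀ g, M.t g = M.t e → Sum.inr g ∉ D) (hv : Sum.inl (M.t e) ∉ D) {d : ℕ}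
    (h : ConnAvoidingLen (rAdj M) D d u (.inr e)) : ConnAvoidingLen (rAdj M) D (d + 1) u (.inl (M.t e)) := by
  by_cases hl : ∀ g, M.t g = M.t e → eOrd M g ≤ eOrd M e
  · exact h.snoc (w := .inl (M.t e)) (show rAdj M (.inr e) (.inl (M.t e)) from ⟨rfl, hl⟩) hv
  · push Not at hl
    obtain ⟨g, hg, hmin⟩ := exists_min_image (univ.filter (fun g => M.t g = M.t e ∧ eOrd M e < eOrd M g)) (eOrd M) (by
      obtain ⟨g, hg⟩ := hl
      exact ⟨g, mem_filter.2 ⟨mem_univ _, hg⟩⟩)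
    obtain ⟨hg1, hg2⟩ := (mem_filter.1 hg).2
    have h1 := h.snoc (w := .inr g) (show rAdj M (.inr e) (.inr g) from ⟨hg1.symm, hg2, fun k hk1 hk2 => hmin k (mem_filter.2 ⟨mem_univ _, hk1, hk2⟩)⟩) (hD g hg1)
    have h2 := rAdj_descend g (fun k hk => hD k (hk.trans hg1)) (by rwa [hg1]) h1
    rw [hg1] at h2
    exact h2.mono (by omega)
termination_by Fintype.card M.E - eOrd M e
decreasing_by
  have := eOrd_lt M g
  omega

def rProj : M.V ⊕ M.E → M.V := Sum.elim id M.t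

theorem rAdj_wk {D : Finset (M.V ⊕ M.E)} {l : ℕ} {u v : M.V} (h : M.Wk (D.image (rProj M)) l u v) : ConnAvoidingLen (rAdj M) D l (.inl u) (.inl v) := by
  induction h with
  | nil v hv => exact .nil (fun h => hv (mem_image.2 ⟨_, h, rfl⟩))
  | snoc l u e _ ht ih =>
    have h1 : ∀ g, M.t g = M.t e → Sum.inr g ∉ D := fun g hg h => ht (mem_image.2 ⟨_, h, hg⟩)
    have h2 := ih.snoc (w := .inr e) (show rAdj M (.inl (M.s e)) (.inr e) from rfl) (h1 e rfl)
    exact (rAdj_descend M e h1 (fun h => ht (mem_image.2 ⟨_, h, rfl⟩)) h2).mono (by omega)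
end

theorem main_fam (ε : ℝ) (hε : 0 < ε) :
    ∃ c : ℝ, 0 < c ∧
      ∃ M : (n : ℕ) → IOGraph n, ∀ n, 1 ≤ n →
        Acyclic (M n).Adj ∧
        ((Nat.card (M n).V : ℝ) ≤ c * n) ∧
        (∀ v : (M n).V, (indeg (M n).Adj v : ℝ) ≤ c) ∧
        MaxSTRobustD (M n) ⌊(n : ℝ) ^ ((1 : ℝ) - ε)⌋₊ := by
  obtain ⟨C, hC, hfam⟩ := finalNet (min ε (1 / 2)) (lt_min hε (by norm_num)) ((min_le_right _ _).trans_lt (by norm_num))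
  refine ⟨2 * C, by positivity, ?_⟩
  have : ∀ n : ℕ, ∃ G : IOGraph n, 1 ≤ n → Acyclic G.Adj ∧
        ((Nat.card G.V : ℝ) ≤ 2 * C * n) ∧
        (∀ v : G.V, (indeg G.Adj v : ℝ) ≤ 2 * C) ∧
        MaxSTRobustD G ⌊(n : ℝ) ^ ((1 : ℝ) - ε)⌋₊ := by
    intro n
    rcases Nat.eq_zero_or_pos n with rfl | hn
    · exact ⟨⟨Empty, fun _ _ => False, ⟨Fin.elim0, fun x => x.elim0⟩, ⟨Fin.elim0, fun x => x.elim0⟩⟩, fun h => by omega⟩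
    obtain ⟨N, inp, out, hinp, hout, hV, hE, hN⟩ := hfam n hn
    refine ⟨⟨N.V ⊕ N.E, rAdj N, ⟨fun x => .inl (inp x), Sum.inl_injective.comp hinp⟩, ⟨fun x => .inl (out x), Sum.inl_injective.comp hout⟩⟩, fun _ => ⟨rAdj_acyclic N, ?_, ?_, ?_⟩⟩
    · change (Nat.card (N.V ⊕ N.E) : ℝ) ≤ _
      rw [Nat.card_eq_fintype_card, Fintype.card_sum]
      have : Fintype.card N.V + Fintype.card N.E ≤ 2 * C * n := by linarith
      exact_mod_cast this
    · intro v
      have h1 : indeg (rAdj N) v ≤ 2 * C := (rAdj_indeg N v).trans (by omega)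
      exact_mod_cast h1
    · intro k hk D hD
      set D' : Finset (N.V ⊕ N.E) := D with hD'
      obtain ⟨A, B, hA, hB, hAB⟩ := hN (D'.image (rProj N))
      have hc : #(D'.image (rProj N)) ≤ k := card_image_le.trans hD
      refine ⟨A, B, by omega, by omega, fun a ha b hb => ?_⟩
      obtain ⟨m, hm, hw⟩ := hAB a ha b hb
      refine (rAdj_wk N hw).mono (le_trans ?_ hm)
      apply Nat.floor_le_floor
      exact Real.rpow_le_rpow_of_exponent_le (by exact_mod_cast hn) (by linarith [min_le_left ε (1 / 2)])
  choose G hG using this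
  exact ⟨G, fun n hn => hG n hn⟩
end

/-- For every constant `ε > 0` there are a constant `c_ε > 0`
and a family `{M_n^ε}` of DAGs, each with `n` inputs and `n` outputs, at most
`c_ε·n` nodes, maximum indegree at most `c_ε`, that are maximally ST-robust with
depth `d = n^{1-ε}`. -/
theorem exists_linear_size_max_STRobust_family_with_depth (ε : ℝ) (hε : 0 < ε) :
    ∃ c : ℝ, 0 < c ∧
      ∃ M : (n : ℕ) → IOGraph n, ∀ n, 1 ≤ n →
        Acyclic (M n).Adj ∧
        ((Nat.card (M n).V : ℝ) ≤ c * n) ∧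
        (∀ v : (M n).V, (indeg (M n).Adj v : ℝ) ≤ c) ∧
        MaxSTRobustD (M n) ⌊(n : ℝ) ^ ((1 : ℝ) - ε)⌋₊ := by
  exact main_fam ε hε
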